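/- arXiv:2306.11997 — 4 statements merged into one kernel-verified Lean document; each statement's English description precedes it below -/
import Mathlib

section
/- For h ∈ {2,3,6}, there exists a (gh,h,4,1)-CDF for all positive integers g with gh ≡ h (mod 12) and gh ≥ 218. -/
/-- The multiset of differences `f - f'` (with `f ≠ f'`) from a finset `F`. -/
def blockDiffs {G : Type*} [AddGroup G] [DecidableEq G] (F : Finset G) : Multiset G :=
  ((F ×ˢ F).filter fun p => p.1 ≠ p.2).val.map fun p => p.1 - p.2

/-- A `(gh,h,k,1)`-CDF (cyclic relative difference family): a family `𝓕` of
`k`-element subsets of `Z_{gh}` (base blocks, possibly with repetitions) such that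
the multiset of differences from all base blocks contains every element of
`Z_{gh}` outside the subgroup `H = g·Z_{gh}` (of order `h`) exactly once and
contains no element of `H`. -/
def IsCDF (g h k : ℕ) (𝓕 : Multiset (Finset (ZMod (g * h)))) : Prop :=
  (∀ F ∈ 𝓕, F.card = k) ∧
  (∀ x : ZMod (g * h), x ∈ AddSubgroup.zmultiples ((g : ZMod (g * h))) →
    (𝓕.bind blockDiffs).count x = 0) ∧
  (∀ x : ZMod (g * h), x ∉ AddSubgroup.zmultiples ((g : ZMod (g * h))) →
    (𝓕.bind blockDiffs).count x = 1)

namespace CDFAux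

/-- A point `1000 k + b` encodes the affine expression `k n + b`. -/
def pt (n p : ℕ) : ℤ := ((p / 1000 : ℕ) : ℤ) * n + ((p % 1000 : ℕ) : ℤ)

/-- The block `{0, a + m, b + 2 m, c + 3 m}`. -/
def blk (v n : ℕ) (x : ℕ × ℕ × ℕ) (m : ℕ) : Finset (ZMod v) :=
  {0, ((pt n x.1 + m : ℤ) : ZMod v), ((pt n x.2.1 + 2 * m : ℤ) : ZMod v),
    ((pt n x.2.2 + 3 * m : ℤ) : ZMod v)}

/-- All blocks: the sporadic ones and the `n` members of each linear family. -/
def fml (v n : ℕ) (sp fam : List (ℕ × ℕ × ℕ)) : Multiset (Finset (ZMod v)) :=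
  ((sp.map fun x => blk v n x 0 : List _) : Multiset _) +
    (fam : Multiset (ℕ × ℕ × ℕ)).bind fun x => (Multiset.range n).map (blk v n x)

/-- Differences (larger point, smaller point, slope) of a block. -/
def ups (x : ℕ × ℕ × ℕ) : List (ℕ × ℕ × ℕ) :=
  [(x.1, 0, 1), (x.2.1, 0, 2), (x.2.2, 0, 3), (x.2.1, x.1, 1), (x.2.2, x.1, 2), (x.2.2, x.2.1, 1)]

/-- The pair `(K, B)` of `p - q - s n + s`. -/
def dif (p q s : ℕ) : ℤ × ℤ :=
  (((p / 1000 : ℕ) : ℤ) - ((q / 1000 : ℕ) : ℤ) - s,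
    ((p % 1000 : ℕ) : ℤ) - ((q % 1000 : ℕ) : ℤ) + s)

def shf (w : ℕ) (z : ℤ × ℤ) : ℤ := z.2 - w * (z.1 / 72) + 2000

def code (w : ℕ) (z : ℤ × ℤ) : ℕ := (z.1 % 72).toNat * 4096 + (shf w z).toNat

def okz (w : ℕ) (z : ℤ × ℤ) : Bool := decide (0 ≤ shf w z) && decide (shf w z < 4096)

def singles (sp : List (ℕ × ℕ × ℕ)) : List (ℤ × ℤ) :=
  sp.flatMap fun x => (ups x).flatMap fun y => [dif y.1 y.2.1 0, dif y.2.1 y.1 0]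

def hol (h w : ℕ) : List (ℤ × ℤ) :=
  (List.range h).map fun j => (((72 / h * j : ℕ) : ℤ), ((w / h * j : ℕ) : ℤ))

def aps (s : ℕ) (fam : List (ℕ × ℕ × ℕ)) : List (ℤ × ℤ) :=
  fam.flatMap fun x => (ups x).flatMap fun y =>
    if y.2.2 = s then [dif y.1 y.2.1 0, dif y.2.1 y.1 s] else []

def mask : List ℕ → ℕ
  | [] => 0
  | c :: l => mask l ||| 2 ^ c

def walk (m0 m1 m2 m3 e : ℕ) : ℕ → ℕ → ℕ → Bool
  | 0, _, _ => false
  | f + 1, k, b =>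
    bif k == 72 then b == e else
    bif Nat.ble 4090 b then false else
    bif m0.testBit (k * 4096 + b) then walk m0 m1 m2 m3 e f k (b + 1) else
    bif m1.testBit (k * 4096 + b) then walk m0 m1 m2 m3 e f (k + 1) b else
    bif m2.testBit (k * 4096 + b) && m2.testBit (k * 4096 + (b + 1)) then
      walk m0 m1 m2 m3 e f (k + 2) b else
    m3.testBit (k * 4096 + b) && m3.testBit (k * 4096 + (b + 1)) &&
      m3.testBit (k * 4096 + (b + 2)) && walk m0 m1 m2 m3 e f (k + 3) b

/-- The full certificate check. -/
def check (h c s : ℕ) (sp fam : List (ℕ × ℕ × ℕ)) : Bool :=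
  let w := 12 * c + h
  let l0 := hol h w ++ singles sp
  sp.length == c && fam.length == 6 && l0.all (okz w) && (aps 1 fam).all (okz w) &&
    (aps 2 fam).all (okz w) && (aps 3 fam).all (okz w) &&
    walk (mask (l0.map (code w))) (mask ((aps 1 fam).map (code w)))
      (mask ((aps 2 fam).map (code w))) (mask ((aps 3 fam).map (code w)))
      (s + w) 500 0 s

theorem mem_of_mask {l : List ℕ} {c : ℕ} (h : (mask l).testBit c = true) : c ∈ l := by
  induction l with
  | nil => simp [mask] at h
  | cons a l ih =>
    simp only [mask, Nat.testBit_or, Bool.or_eq_true, Nat.testBit_two_pow, decide_eq_true_eq] at h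
    rcases h with h | h
    · exact List.mem_cons_of_mem _ (ih h)
    · simp [h]

/-- Being covered. -/
def Cov (v g : ℕ) (𝓕 : Multiset (Finset (ZMod v))) (x : ZMod v) : Prop :=
  x ∈ AddSubgroup.zmultiples ((g : ZMod v)) ∨ ∃ F ∈ 𝓕, ∃ p ∈ F, ∃ q ∈ F, p - q = x

theorem code_val {w n k b : ℕ} {l : List (ℤ × ℤ)} (hok : l.all (okz w) = true)
    (hb : b < 4096) (hm : (mask (l.map (code w))).testBit (k * 4096 + b) = true) :
    ∃ z ∈ l, ∃ j : ℤ, (k : ℤ) * n + b - 2000 = z.1 * n + z.2 - j * (72 * n + w) := by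
  have := mem_of_mask hm
  rw [List.mem_map] at this
  obtain ⟨z, hz, hc⟩ := this
  refine ⟨z, hz, z.1 / 72, ?_⟩
  have h1 := (List.all_eq_true.1 hok) z hz
  simp only [okz, Bool.and_eq_true, decide_eq_true_eq] at h1
  unfold code at hc
  have h2 : 0 ≤ z.1 % 72 := Int.emod_nonneg _ (by norm_num)
  have h3 : (z.1 % 72).toNat = k := by omega
  have h4 : (shf w z).toNat = b := by omega
  have h5 : (k : ℤ) = z.1 % 72 := by omega
  have h6 : (b : ℤ) = shf w z := by omega
  have h7 := Int.emod_add_mul_ediv z.1 72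
  rw [h6, h5]
  unfold shf
  have h8 : z.1 % 72 = z.1 - 72 * (z.1 / 72) := by omega
  rw [h8]; ring

theorem pt_sub (n p q s : ℕ) :
    (dif p q s).1 * n + (dif p q s).2 = pt n p - pt n q - s * n + s := by
  simp only [dif, pt]; ring

theorem cast_zero' {v n w : ℕ} (hv : v = 72 * n + w) (a b j : ℤ)
    (h : a = b - j * (72 * n + w)) : (a : ZMod v) = (b : ZMod v) := by
  have : (a : ZMod v) = ((b - j * (v : ℤ) : ℤ) : ZMod v) := by rw [h, hv]; push_cast; rfl
  rw [this]; simp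

theorem mem_blk {v n : ℕ} {x y : ℕ × ℕ × ℕ} (hy : y ∈ ups x) (m : ℕ) :
    ∃ p ∈ blk v n x m, ∃ q ∈ blk v n x m,
      p - q = ((pt n y.1 - pt n y.2.1 + y.2.2 * m : ℤ) : ZMod v) := by
  have h0 : pt n 0 = 0 := by simp [pt]
  simp only [ups, List.mem_cons, List.not_mem_nil, or_false] at hy
  rcases hy with rfl | rfl | rfl | rfl | rfl | rfl
  · exact ⟨_, by simp only [blk, Finset.mem_insert]; exact Or.inr (Or.inl rfl), 0, by simp [blk], by
      push_cast; simp [h0]⟩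
  · exact ⟨_, by simp only [blk, Finset.mem_insert]; exact Or.inr (Or.inr (Or.inl rfl)), 0,
      by simp [blk], by push_cast; simp [h0]⟩
  · exact ⟨_, by simp only [blk, Finset.mem_insert, Finset.mem_singleton]; exact Or.inr (Or.inr (Or.inr rfl)), 0,
      by simp [blk], by push_cast; simp [h0]⟩
  · exact ⟨_, by simp only [blk, Finset.mem_insert]; exact Or.inr (Or.inr (Or.inl rfl)),
      _, by simp only [blk, Finset.mem_insert]; exact Or.inr (Or.inl rfl), by push_cast; ring⟩
  · exact ⟨_, by simp only [blk, Finset.mem_insert, Finset.mem_singleton]; exact Or.inr (Or.inr (Or.inr rfl)),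
      _, by simp only [blk, Finset.mem_insert]; exact Or.inr (Or.inl rfl), by push_cast; ring⟩
  · exact ⟨_, by simp only [blk, Finset.mem_insert, Finset.mem_singleton]; exact Or.inr (Or.inr (Or.inr rfl)),
      _, by simp only [blk, Finset.mem_insert]; exact Or.inr (Or.inr (Or.inl rfl)), by push_cast; ring⟩

theorem cov_singles {v n g : ℕ} {sp fam : List (ℕ × ℕ × ℕ)} {z : ℤ × ℤ} (hz : z ∈ singles sp) :
    Cov v g (fml v n sp fam) ((z.1 * n + z.2 : ℤ) : ZMod v) := by
  simp only [singles, List.mem_flatMap] at hz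
  obtain ⟨x, hx, y, hy, hz⟩ := hz
  obtain ⟨p, hp, q, hq, hpq⟩ := mem_blk (v := v) (n := n) hy 0
  have hF : blk v n x 0 ∈ fml v n sp fam := by
    simp only [fml, Multiset.mem_add, Multiset.mem_coe, List.mem_map]
    exact Or.inl ⟨x, hx, rfl⟩
  simp only [List.mem_cons, List.not_mem_nil, or_false] at hz
  rcases hz with rfl | rfl
  · refine Or.inr ⟨_, hF, p, hp, q, hq, ?_⟩
    rw [hpq, pt_sub]; congr 1; push_cast; ring
  · refine Or.inr ⟨_, hF, q, hq, p, hp, ?_⟩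
    rw [← neg_sub, hpq, pt_sub, ← Int.cast_neg]; congr 1; push_cast; ring

theorem cov_hol {v n g h w : ℕ} {𝓕 : Multiset (Finset (ZMod v))} (hh : 0 < h)
    (h1 : h ∣ 72) (h2 : h ∣ w) (hg : g * h = 72 * n + w) {z : ℤ × ℤ} (hz : z ∈ hol h w) :
    Cov v g 𝓕 ((z.1 * n + z.2 : ℤ) : ZMod v) := by
  simp only [hol, List.mem_map, List.mem_range] at hz
  obtain ⟨j, hj, rfl⟩ := hz
  left
  obtain ⟨a, ha⟩ := h1
  obtain ⟨b, rfl⟩ := h2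
  have h3 : 72 / h = a := by rw [ha]; exact Nat.mul_div_cancel_left _ hh
  have h4 : h * b / h = b := Nat.mul_div_cancel_left _ hh
  have h5 : g = a * n + b := by
    apply Nat.eq_of_mul_eq_mul_right hh
    rw [hg, ha]; ring
  rw [AddSubgroup.mem_zmultiples_iff]
  refine ⟨j, ?_⟩
  simp only [h3, h4, h5]
  push_cast
  simp only [zsmul_eq_mul]; push_cast; ring

theorem cov_aps {v n g s : ℕ} {sp fam : List (ℕ × ℕ × ℕ)} {z : ℤ × ℤ} (hz : z ∈ aps s fam)
    (m : ℕ) (hm : m < n) :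
    Cov v g (fml v n sp fam) ((z.1 * n + z.2 + s * m : ℤ) : ZMod v) := by
  simp only [aps, List.mem_flatMap] at hz
  obtain ⟨x, hx, y, hy, hz⟩ := hz
  have hF : ∀ m < n, blk v n x m ∈ fml v n sp fam := by
    intro m hm
    simp only [fml, Multiset.mem_add, Multiset.mem_bind, Multiset.mem_coe, Multiset.mem_map,
      Multiset.mem_range]
    exact Or.inr ⟨x, hx, m, hm, rfl⟩
  split_ifs at hz with hs
  · simp only [List.mem_cons, List.not_mem_nil, or_false] at hz
    rcases hz with rfl | rfl
    · obtain ⟨p, hp, q, hq, hpq⟩ := mem_blk (v := v) (n := n) hy m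
      refine Or.inr ⟨_, hF m hm, p, hp, q, hq, ?_⟩
      rw [hpq, pt_sub, hs]; congr 1; push_cast; ring
    · obtain ⟨p, hp, q, hq, hpq⟩ := mem_blk (v := v) (n := n) hy (n - 1 - m)
      refine Or.inr ⟨_, hF _ (by omega), q, hq, p, hp, ?_⟩
      rw [← neg_sub, hpq, pt_sub, hs, ← Int.cast_neg]; congr 1
      have : ((n - 1 - m : ℕ) : ℤ) = n - 1 - m := by omega
      rw [this]; ring
  · simp at hz

theorem walk_sound {v n g w h e : ℕ} {sp fam : List (ℕ × ℕ × ℕ)} (hh : 0 < h)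
    (h1 : h ∣ 72) (h2 : h ∣ w) (hg : g * h = 72 * n + w) (hv : v = 72 * n + w)
    (o0 : (hol h w ++ singles sp).all (okz w) = true)
    (o1 : (aps 1 fam).all (okz w) = true) (o2 : (aps 2 fam).all (okz w) = true)
    (o3 : (aps 3 fam).all (okz w) = true) (f : ℕ) : ∀ k b : ℕ,
    walk (mask ((hol h w ++ singles sp).map (code w))) (mask ((aps 1 fam).map (code w)))
      (mask ((aps 2 fam).map (code w))) (mask ((aps 3 fam).map (code w))) e f k b = true →
    ∀ z : ℤ, (k : ℤ) * n + b - 2000 ≤ z → z < 72 * n + e - 2000 →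
      Cov v g (fml v n sp fam) (z : ZMod v) := by
  have A : ∀ (s k b : ℕ), (aps s fam).all (okz w) = true → b < 4096 →
      (mask ((aps s fam).map (code w))).testBit (k * 4096 + b) = true → ∀ z : ℤ, ∀ m : ℕ, m < n →
      z = k * n + b - 2000 + s * m → Cov v g (fml v n sp fam) (z : ZMod v) := by
    intro s k b ho hb hm z m hmn hz
    obtain ⟨y, hy, j, hj⟩ := code_val (n := n) ho hb hm
    have := cov_aps (v := v) (g := g) (sp := sp) hy m hmn
    rwa [← cast_zero' hv z _ j (by rw [hz, hj]; ring)] at this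
  induction f with
  | zero => intro k b hw; simp [walk] at hw
  | succ f ih =>
    intro k b hw z hz1 hz2
    unfold walk at hw
    simp only [cond_eq_ite] at hw
    split_ifs at hw with c1 c2 c3 c4 c5
    · simp only [beq_iff_eq] at c1 hw
      subst c1 hw
      push_cast at hz1
      omega
    · have hb : b < 4090 := by
        by_contra hcon
        exact c2 (Nat.ble_eq_true_of_le (by omega))
      by_cases hzz : z = k * n + b - 2000
      · obtain ⟨y, hy, j, hj⟩ := code_val (n := n) o0 (by omega) c3
        have hc := cast_zero' hv z _ j (by rw [hzz, hj])
        rw [hc]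
        rcases List.mem_append.1 hy with hy | hy
        · exact cov_hol hh h1 h2 hg hy
        · exact cov_singles hy
      · exact ih k (b + 1) hw z (by push_cast; omega) hz2
    · have hb : b < 4090 := by
        by_contra hcon
        exact c2 (Nat.ble_eq_true_of_le (by omega))
      by_cases hzz : (k + 1 : ℤ) * n + b - 2000 ≤ z
      · exact ih _ _ hw z (by push_cast; exact hzz) hz2
      · have hzz' : z < k * n + n + b - 2000 := by linarith
        have A0 := A 1 k b o1 (by omega) c4 z
        generalize (k : ℤ) * n = kn at *
        exact A0 (z - (kn + b - 2000)).toNat (by omega) (by push_cast; omega)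
    · have hb : b < 4090 := by
        by_contra hcon
        exact c2 (Nat.ble_eq_true_of_le (by omega))
      rw [Bool.and_eq_true] at c5
      by_cases hzz : (k + 2 : ℤ) * n + b - 2000 ≤ z
      · exact ih _ _ hw z (by push_cast; exact hzz) hz2
      · have hzz' : z < k * n + 2 * n + b - 2000 := by linarith
        have A0 := A 2 k b o2 (by omega) c5.1 z
        have A1 := A 2 k (b + 1) o2 (by omega) c5.2 z
        generalize (k : ℤ) * n = kn at *
        obtain hr | hr : (z - (kn + b - 2000)) % 2 = 0 ∨ (z - (kn + b - 2000)) % 2 = 1 := by omega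
        · exact A0 ((z - (kn + b - 2000)) / 2).toNat (by omega) (by push_cast; omega)
        · exact A1 ((z - (kn + b - 2000)) / 2).toNat (by omega) (by push_cast; omega)
    · have hb : b < 4090 := by
        by_contra hcon
        exact c2 (Nat.ble_eq_true_of_le (by omega))
      simp only [Bool.and_eq_true] at hw
      obtain ⟨⟨⟨d0, d1⟩, d2⟩, hw⟩ := hw
      by_cases hzz : (k + 3 : ℤ) * n + b - 2000 ≤ z
      · exact ih _ _ hw z (by push_cast; exact hzz) hz2
      · have hzz' : z < k * n + 3 * n + b - 2000 := by linarith
        have A0 := A 3 k b o3 (by omega) d0 z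
        have A1 := A 3 k (b + 1) o3 (by omega) d1 z
        have A2 := A 3 k (b + 2) o3 (by omega) d2 z
        generalize (k : ℤ) * n = kn at *
        obtain hr | hr | hr : (z - (kn + b - 2000)) % 3 = 0 ∨ (z - (kn + b - 2000)) % 3 = 1 ∨
            (z - (kn + b - 2000)) % 3 = 2 := by omega
        · exact A0 ((z - (kn + b - 2000)) / 3).toNat (by omega) (by push_cast; omega)
        · exact A1 ((z - (kn + b - 2000)) / 3).toNat (by omega) (by push_cast; omega)
        · exact A2 ((z - (kn + b - 2000)) / 3).toNat (by omega) (by push_cast; omega)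

theorem card_blockDiffs {G : Type*} [AddGroup G] [DecidableEq G] (F : Finset G) :
    (blockDiffs F).card = F.card * F.card - F.card := by
  rw [← Finset.offDiag_card]
  simp only [blockDiffs, Multiset.card_map]
  change Finset.card _ = _
  congr 1
  ext p
  simp [Finset.mem_offDiag, and_assoc]

theorem card_bind_le {G : Type*} [AddGroup G] [DecidableEq G] (𝓕 : Multiset (Finset G))
    (h : ∀ F ∈ 𝓕, F.card ≤ 4) : (𝓕.bind blockDiffs).card ≤ 12 * 𝓕.card := by
  induction 𝓕 using Multiset.induction with
  | empty => simp
  | cons F 𝓕 ih =>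
    have h1 := ih fun F hF => h F (Multiset.mem_cons_of_mem hF)
    have h2 := h F (Multiset.mem_cons_self _ _)
    have h3 : (blockDiffs F).card ≤ 12 := by
      rw [card_blockDiffs]; interval_cases F.card <;> norm_num
    simp only [Multiset.cons_bind, Multiset.card_add, Multiset.card_cons]
    omega

theorem isCDF_of_cov {g h : ℕ} (hg : 0 < g) (hh : 0 < h) (𝓕 : Multiset (Finset (ZMod (g * h))))
    (h4 : ∀ F ∈ 𝓕, F.card ≤ 4) (hc : 12 * 𝓕.card + h = g * h)
    (hcov : ∀ x : ZMod (g * h), Cov (g * h) g 𝓕 x) : IsCDF g h 4 𝓕 := by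
  classical
  have hpos : 0 < g * h := Nat.mul_pos hg hh
  have : NeZero (g * h) := ⟨hpos.ne'⟩
  set H := AddSubgroup.zmultiples ((g : ZMod (g * h))) with hH
  let S : Finset (ZMod (g * h)) := Finset.univ.filter fun x => x ∉ H
  have hHc : (Finset.univ.filter fun x => x ∈ H).card ≤ h := by
    have e1 : (Finset.univ.filter fun x => x ∈ H).card = Nat.card H := by
      rw [Nat.card_eq_fintype_card, Fintype.card_subtype]
    rw [e1, hH, Nat.card_zmultiples]
    apply addOrderOf_le_of_nsmul_eq_zero hh
    rw [nsmul_eq_mul, mul_comm, ← Nat.cast_mul, ZMod.natCast_self]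
  have hS : g * h ≤ S.card + h := by
    have := Finset.card_filter_add_card_filter_not (s := (Finset.univ : Finset (ZMod (g * h))))
      (fun x => x ∈ H)
    rw [Finset.card_univ, ZMod.card] at this
    change _ + S.card = _ at this
    omega
  have hle : S.val ≤ 𝓕.bind blockDiffs := by
    rw [Multiset.le_iff_subset S.nodup]
    intro x hx
    have hx' : x ∉ H := by simpa [S] using hx
    rcases hcov x with h | ⟨F, hF, p, hp, q, hq, hpq⟩
    · exact absurd h hx'
    · rw [Multiset.mem_bind]
      refine ⟨F, hF, ?_⟩
      rw [blockDiffs, Multiset.mem_map]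
      refine ⟨(p, q), ?_, hpq⟩
      rw [Finset.mem_val, Finset.mem_filter, Finset.mem_product]
      refine ⟨⟨hp, hq⟩, ?_⟩
      rintro (rfl : p = q)
      apply hx'
      rw [← hpq, sub_self]
      exact H.zero_mem
  have hcard := card_bind_le 𝓕 h4
  have heq : S.val = 𝓕.bind blockDiffs := by
    apply Multiset.eq_of_le_of_card_le hle
    change _ ≤ S.card
    omega
  refine ⟨?_, ?_, ?_⟩
  · intro F hF
    obtain ⟨𝓖, rfl⟩ := Multiset.exists_cons_of_mem hF
    have e1 := card_bind_le 𝓖 fun F hF => h4 F (Multiset.mem_cons_of_mem hF)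
    have e2 : S.card = ((F ::ₘ 𝓖).bind blockDiffs).card := by rw [← heq]; rfl
    have e3 := h4 F hF
    simp only [Multiset.cons_bind, Multiset.card_add, Multiset.card_cons] at e2 hc
    have e4 : 12 ≤ (blockDiffs F).card := by omega
    rw [card_blockDiffs] at e4
    interval_cases F.card <;> simp_all
  · intro x hx
    rw [← heq, Multiset.count_eq_zero]
    simpa [S] using hx
  · intro x hx
    rw [← heq]
    exact Multiset.count_eq_one_of_mem S.nodup (by simpa [S] using hx)

theorem main {h c s : ℕ} {sp fam : List (ℕ × ℕ × ℕ)} (hk : check h c s sp fam = true)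
    (hh : h ∣ 12) (g n : ℕ) (hg : 0 < g) (hgh : g * h = 12 * (6 * n + c) + h) :
    ∃ 𝓕 : Multiset (Finset (ZMod (g * h))), IsCDF g h 4 𝓕 := by
  have hh0 : 0 < h := Nat.pos_of_dvd_of_pos hh (by norm_num)
  simp only [check, Bool.and_eq_true, beq_iff_eq] at hk
  obtain ⟨⟨⟨⟨⟨⟨k1, k2⟩, k3⟩, k4⟩, k5⟩, k6⟩, k7⟩ := hk
  have hv : g * h = 72 * n + (12 * c + h) := by rw [hgh]; ring
  refine ⟨fml (g * h) n sp fam, isCDF_of_cov hg hh0 _ ?_ ?_ ?_⟩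
  · have hb : ∀ x m, (blk (g * h) n x m).card ≤ 4 := fun x m => Finset.card_le_four
    intro F hF
    simp only [fml, Multiset.mem_add, Multiset.mem_bind, Multiset.mem_coe, Multiset.mem_map,
      List.mem_map] at hF
    rcases hF with ⟨x, -, rfl⟩ | ⟨x, -, m, -, rfl⟩ <;> exact hb _ _
  · have : (fml (g * h) n sp fam).card = c + 6 * n := by
      simp [fml, Multiset.card_bind, k1, k2]
      ring
    rw [this, hgh]; ring
  · intro x
    have : NeZero (g * h) := ⟨(Nat.mul_pos hg hh0).ne'⟩
    have hw := walk_sound (v := g * h) hh0 (hh.trans (by norm_num))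
      (Nat.dvd_add (hh.mul_right c) dvd_rfl) hv hv k3 k4 k5 k6 500 0 s k7
    set a : ℤ := (s : ℤ) - 2000 with ha
    set y : ℤ := a + ((x.val : ℤ) - a) % ((g * h : ℕ) : ℤ) with hy
    have hp : (0 : ℤ) < ((g * h : ℕ) : ℤ) := by exact_mod_cast Nat.mul_pos hg hh0
    have y1 := Int.emod_nonneg ((x.val : ℤ) - a) hp.ne'
    have y2 := Int.emod_lt_of_pos ((x.val : ℤ) - a) hp
    have hv' : ((g * h : ℕ) : ℤ) = 72 * n + (12 * c + h) := by exact_mod_cast hv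
    have hyx : (y : ZMod (g * h)) = x := by
      rw [hy, Int.cast_add, ZMod.intCast_mod]
      push_cast
      rw [ZMod.natCast_zmod_val]; ring
    rw [← hyx]
    apply hw
    · push_cast; linarith
    · push_cast; linarith

theorem k2_0 : check 2 18 1995
    [(44135, 66200, 72215), (30093, 48149, 54163), (33101, 61183, 61188), (29088, 44137, 69212),
    (35106, 54164, 54168), (40122, 54166, 72217), (46139, 61187, 69207), (50154, 58175, 69211),
    (30090, 53157, 72216), (33099, 57173, 66202), (33100, 48147, 61184), (36110, 61186, 64196),
    (32098, 58176, 64195), (58177, 66201, 69210), (35105, 54165, 59178), (42127, 51155, 64193),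
    (35107, 48146, 63192), (33102, 42129, 68206)]
    [(35108, 59183, 6), (18057, 64199, 69213), (10030, 59182, 54170), (43131, 19063, 15052),
    (57174, 6020, 15050), (32099, 40125, 69214)] = true := by
  decide +kernel

theorem k2_1 : check 2 19 1997
    [(41134, 69225, 72229), (36112, 68212, 68215), (36114, 61196, 68220), (41132, 58184, 62201),
    (47149, 51165, 69223), (36113, 57183, 64202), (40125, 55175, 59188), (50159, 65210, 68216),
    (25078, 47151, 51162), (21064, 40126, 58185), (27088, 48154, 59187), (35111, 48155, 60191),
    (50158, 62199, 65207), (32101, 40128, 69221), (41133, 60193, 68218), (46147, 57182, 65208),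
    (28090, 55177, 62198), (24077, 45144, 62200), (43136, 60190, 72228)]
    [(50160, 62202, 65212), (24078, 38125, 4), (17057, 62203, 6), (44142, 51167, 4020),
    (43139, 29095, 65214), (53171, 41136, 5)] = true := by
  decide +kernel

theorem k2_2 : check 2 20 1996
    [(39134, 69233, 69237), (30106, 46158, 57194), (36123, 51170, 72239), (38129, 53175, 72241),
    (26085, 45153, 53178), (55186, 63212, 66220), (30104, 42141, 66221), (34114, 64219, 67225),
    (36120, 60203, 63210), (29094, 51169, 68229), (51172, 59200, 68231), (29095, 55181, 59197),
    (51171, 60204, 68228), (36124, 55187, 66222), (49164, 57191, 72240), (24081, 43146, 66223),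
    (46155, 59198, 63213), (33110, 57192, 60202), (38127, 56189, 60201), (27091, 43145, 66224)]
    [(18063, 13047, 69238), (8029, 24084, 69239), (29098, 34116, 5), (11037, 34117, 30107),
    (6023, 13046, 30108), (50169, 27094, 39136)] = true := by
  decide +kernel

theorem k2_3 : check 2 21 1996
    [(38136, 57204, 60209), (53182, 68238, 72251), (38137, 42151, 69248), (49172, 56193, 72253),
    (28100, 47171, 69246), (57197, 62214, 72250), (28101, 38138, 65231), (44155, 53187, 63225),
    (37132, 59206, 69245), (42152, 47170, 69247), (49176, 64227, 68242), (32114, 45160, 63224),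
    (31109, 44156, 67235), (34119, 56195, 59205), (47166, 57200, 65228), (27096, 39139, 65229),
    (46163, 62221, 69243), (26092, 38134, 63223), (42148, 54189, 72252), (35125, 60210, 65230),
    (32112, 47167, 62219)]
    [(59209, 5021, 5), (22078, 54193, 69251), (62222, 23084, 50182), (3012, 28102, 19074),
    (7027, 42153, 7), (37133, 10041, 50184)] = true := by
  decide +kernel

theorem k2_4 : check 2 16 1997
    [(38103, 66174, 66176), (55147, 60161, 69189), (40105, 63165, 68181), (28072, 52140, 56151),
    (38101, 59156, 72191), (29081, 55150, 69190), (40108, 49131, 63172), (40107, 64173, 68185),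
    (28075, 41112, 69186), (48127, 54146, 66177), (54143, 63169, 67179), (34092, 51138, 60162),
    (31084, 51137, 60164), (37098, 49132, 72193), (37100, 55149, 69188), (28077, 49135, 52142)]
    [(58156, 21059, 5), (4014, 52144, 60166), (5017, 52143, 69191), (39105, 26071, 60165),
    (46126, 29083, 4), (31085, 64175, 60167)] = true := by
  decide +kernel

theorem k2_5 : check 2 17 1997
    [(37106, 61176, 64180), (28079, 44126, 66192), (34094, 58162, 72203), (27073, 41115, 65184),
    (42124, 66191, 69200), (38108, 56161, 59166), (30085, 47134, 58163), (31090, 59167, 72204),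
    (30083, 51143, 72205), (50141, 61172, 68193), (53149, 61174, 64182), (41120, 51147, 68195),
    (53151, 60171, 66187), (31089, 37107, 68194), (51145, 59168, 69196), (19056, 38110, 56160),
    (41118, 47135, 69199)]
    [(16048, 4014, 4), (27077, 62180, 69203), (30086, 19058, 5), (34099, 51149, 38114),
    (13041, 62181, 38115), (6020, 56163, 31093)] = true := by
  decide +kernel

theorem k3_0 : check 3 18 1995
    [(46137, 52156, 72214), (29087, 46136, 61184), (39115, 60181, 60183), (24075, 48145, 63192),
    (42125, 54162, 66201), (46139, 51152, 69208), (36111, 65195, 65199), (33099, 63194, 69209),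
    (39116, 52157, 69207), (33100, 62186, 62189), (29090, 43134, 69213), (48148, 66203, 69212),
    (51154, 62188, 65196), (33101, 46141, 63193), (40121, 57174, 66202), (37112, 57173, 67205),
    (35105, 52159, 72218), (48147, 58176, 65198)]
    [(62191, 49152, 69216), (32099, 46144, 69214), (5015, 15049, 26085), (6020, 24078, 43136),
    (35108, 30096, 26084), (29091, 15050, 69215)] = true := by
  decide +kernel

theorem k3_1 : check 3 19 1997
    [(58189, 66216, 72230), (62201, 69225, 69227), (36119, 48155, 69226), (38122, 52169, 58185),
    (51163, 66211, 69224), (30095, 54175, 60193), (28087, 49157, 60191), (30097, 51162, 58187),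
    (38120, 54173, 72228), (26081, 42135, 56180), (40129, 66214, 69223), (29091, 41130, 65209),
    (33105, 51165, 65208), (26086, 44143, 62202), (46147, 57182, 69219), (36117, 62200, 65210),
    (33106, 56179, 62198), (38121, 48153, 64203), (28089, 49156, 69220)]
    [(64205, 52170, 4), (12041, 44146, 66218), (28091, 34112, 5), (14048, 24082, 66219),
    (41132, 62204, 3014), (56182, 24081, 6)] = true := by
  decide +kernel

theorem k3_2 : check 3 20 1995
    [(66220, 66225, 72239), (69234, 72240, 72241), (36123, 58197, 66228), (26088, 48163, 66219),
    (28097, 54186, 66227), (40135, 50170, 64214), (30102, 51172, 60206), (32110, 56193, 59201),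
    (29099, 45153, 69231), (43143, 53179, 69230), (44147, 58196, 64213), (34117, 54185, 66223),
    (20069, 40136, 54184), (34114, 56190, 64215), (28095, 42140, 64217), (25086, 44149, 60204),
    (37124, 45151, 69233), (34116, 53178, 59200), (29098, 47158, 56191), (51171, 63211, 69232)]
    [(13044, 22079, 69239), (53182, 6026, 69238), (11037, 38131, 3014), (43146, 16057, 3016),
    (61207, 40138, 3015), (29101, 48167, 69240)] = true := by
  decide +kernel

theorem k3_3 : check 3 21 1996
    [(37135, 62222, 72254), (48172, 69246, 69250), (33111, 47163, 58204), (50174, 68236, 72253),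
    (39143, 42151, 69249), (30109, 43154, 59212), (26094, 47166, 68239), (30107, 37134, 66234),
    (33115, 39139, 69244), (21077, 39142, 55195), (36125, 54189, 58207), (47165, 55196, 68240),
    (61216, 69245, 72252), (54192, 61218, 65230), (35123, 48169, 64225), (48171, 62220, 68242),
    (22080, 42147, 55194), (25091, 45160, 61215), (45159, 61213, 65227), (27097, 52185, 66235),
    (35122, 56198, 62221)]
    [(65231, 11043, 69251), (61220, 22083, 69252), (29104, 8033, 5), (35124, 56203, 39145),
    (19067, 56204, 30111), (54194, 27100, 30112)] = true := by
  decide +kernel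

theorem k3_4 : check 3 22 1994
    [(50182, 72261, 72263), (39139, 57209, 68248), (48174, 61225, 72262), (33127, 36138, 69259),
    (28104, 52196, 55203), (44162, 57214, 66246), (40152, 55207, 66247), (33125, 51190, 72266),
    (36133, 68249, 72264), (32117, 59218, 68254), (33123, 51192, 59219), (45169, 54200, 65243),
    (39147, 48181, 68253), (61229, 65241, 69257), (42153, 54199, 66244), (32118, 56208, 64237),
    (30112, 50185, 59220), (42156, 59217, 63234), (26097, 48180, 65242), (29107, 54201, 57210),
    (33124, 55204, 61226), (30113, 45167, 60223)]
    [(60224, 52198, 36140), (20075, 66248, 33129), (21079, 66249, 69261), (8031, 52197, 69262),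
    (47174, 30115, 36139), (42158, 13053, 7)] = true := by
  decide +kernel

theorem k3_5 : check 3 23 1993
    [(66257, 66261, 72277), (34128, 66255, 72272), (50190, 58221, 72273), (42161, 56214, 72274),
    (52200, 69268, 72276), (38143, 44168, 69264), (38147, 60234, 66253), (38146, 55212, 69269),
    (25097, 38145, 61236), (44170, 53207, 63245), (36137, 56215, 59229), (38148, 46180, 69270),
    (50193, 69266, 69267), (41159, 50195, 63244), (28112, 56217, 64250), (42164, 54210, 64252),
    (30116, 44172, 60235), (46177, 56218, 66258), (26104, 46181, 58228), (26100, 40154, 64249),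
    (26101, 44171, 64251), (30114, 44169, 62240), (26103, 50197, 56220)]
    [(33128, 56221, 69272), (49190, 36143, 3016), (25098, 6027, 69273), (24096, 6028, 66264),
    (52204, 42167, 8), (61237, 20082, 3017)] = true := by
  decide +kernel

theorem k6_0 : check 6 18 1997
    [(53165, 69215, 69218), (39122, 58176, 58177), (26078, 50154, 53166), (36115, 45142, 69217),
    (33101, 42127, 69214), (59178, 63192, 69211), (31097, 60188, 69216), (52159, 59181, 66206),
    (30092, 53161, 66204), (38116, 45140, 65202), (27085, 51157, 63193), (34104, 50156, 56171),
    (32099, 59180, 59182), (40124, 59184, 65201), (38117, 48149, 69213), (30093, 49152, 59183),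
    (27084, 43133, 69212), (49151, 56174, 68209)]
    [(12038, 63197, 6), (58178, 34107, 5), (22069, 43135, 16056), (68210, 43134, 4),
    (6020, 36116, 16055), (32100, 63198, 16054)] = true := by
  decide +kernel

theorem k6_1 : check 6 19 1996
    [(57187, 65214, 69229), (44139, 56183, 63204), (41132, 44141, 69226), (42138, 69227, 69228),
    (25084, 50165, 66218), (22074, 38126, 57189), (34106, 54174, 72230), (35113, 50159, 62200),
    (56180, 60194, 68223), (53170, 64206, 72231), (42135, 53172, 68221), (28092, 38127, 62203),
    (41133, 47151, 69224), (32104, 50163, 57186), (35114, 45146, 65212), (30097, 54177, 66215),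
    (34109, 52167, 56179), (34112, 56184, 66217), (40131, 64208, 64210)]
    [(9031, 20069, 57191), (68224, 48159, 6), (7024, 42140, 57190), (27091, 16056, 69230),
    (41135, 32106, 57192), (6020, 32107, 5)] = true := by
  decide +kernel

theorem k6_2 : check 6 20 1995
    [(36124, 58201, 64216), (66229, 69236, 72245), (48166, 58200, 69240), (30102, 56188, 59202),
    (40137, 56191, 56196), (62213, 65224, 72244), (35120, 43147, 65225), (30106, 46157, 58199),
    (53181, 69234, 69238), (37125, 58197, 65222), (26091, 46161, 52179), (35119, 48162, 69233),
    (29098, 50171, 61210), (28095, 54185, 61208), (23079, 43145, 61209), (40136, 64217, 72243),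
    (28096, 46159, 66227), (22076, 40138, 56194), (30103, 54186, 62214), (28094, 42142, 62211)]
    [(19066, 54188, 3017), (58202, 46162, 66233), (18065, 24085, 6), (61211, 26093, 3015),
    (39134, 26092, 69241), (64221, 30108, 7)] = true := by
  decide +kernel

theorem k6_3 : check 6 21 1995
    [(36126, 62220, 72253), (38139, 48173, 72257), (43156, 59208, 59212), (46168, 56200, 69249),
    (43155, 69250, 72256), (27100, 53193, 56205), (27099, 53190, 66241), (53194, 65233, 65236),
    (36133, 52187, 69248), (48175, 52188, 69251), (32113, 51179, 64227), (36130, 56203, 66240),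
    (39141, 60218, 66239), (30111, 53191, 60217), (38138, 46166, 65235), (34121, 55199, 68244),
    (42151, 62223, 69247), (38134, 62222, 68242), (25089, 48171, 56201), (43154, 60214, 64229),
    (34122, 51184, 64231)]
    [(33118, 10039, 69253), (64232, 17064, 6), (26096, 4017, 69254), (19070, 43159, 13054),
    (23083, 53195, 13052), (20074, 60220, 56208)] = true := by
  decide +kernel

theorem k6_4 : check 6 16 1998
    [(66184, 69193, 69195), (31087, 54152, 57156), (18052, 36102, 54153), (59163, 65175, 72197),
    (36103, 43121, 66185), (24068, 38106, 62173), (31085, 51139, 69192), (44124, 56155, 62171),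
    (26072, 40109, 62172), (30083, 46127, 58159), (51140, 66181, 69188), (26073, 52143, 66183),
    (43117, 51141, 65177), (31086, 62170, 69190), (22062, 44123, 51142), (32090, 43120, 61169)]
    [(20056, 8026, 3), (49135, 16045, 3012), (28077, 34095, 5), (42117, 52146, 66187),
    (41115, 62175, 3013), (56156, 24069, 4)] = true := by
  decide +kernel

theorem k6_5 : check 6 23 1994
    [(46181, 63252, 66259), (38147, 41155, 72276), (34128, 57219, 72280), (53210, 62241, 67263),
    (38148, 60230, 72279), (49193, 58225, 72281), (41156, 48185, 72278), (31120, 55218, 62243),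
    (52201, 67261, 72277), (30113, 47182, 61237), (30115, 55214, 60231), (41157, 60232, 69267),
    (53209, 62242, 65255), (28111, 48190, 63248), (28112, 50195, 55215), (28109, 55217, 58228),
    (42165, 52202, 69272), (35139, 52205, 57223), (34133, 45177, 69273), (35136, 42164, 69268),
    (27106, 50196, 57220), (53208, 62244, 65256), (26102, 50197, 61240)]
    [(52207, 58231, 7), (54211, 7030, 69276), (5023, 42170, 8), (26103, 3016, 38157),
    (60237, 15064, 38156), (10042, 63253, 38155)] = true := by
  decide +kernel

end CDFAux

/-- For `h ∈ {2,3,6}`, a `(gh,h,4,1)`-CDF exists for all positive `g` with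
`gh ≡ h (mod 12)` and `gh ≥ 218`. -/
theorem stmt_2 (g h : ℕ) (hg : 0 < g) (hh : h = 2 ∨ h = 3 ∨ h = 6)
    (hmod : g * h ≡ h [MOD 12]) (hge : 218 ≤ g * h) :
    ∃ 𝓕 : Multiset (Finset (ZMod (g * h))), IsCDF g h 4 𝓕 := by
  have key : ∃ t, g * h = 12 * t + h ∧ 18 ≤ t := by
    refine ⟨(g * h - h) / 12, ?_, ?_⟩ <;> (unfold Nat.ModEq at hmod; rcases hh with rfl | rfl | rfl <;> omega)
  obtain ⟨t, ht, ht18⟩ := key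
  rcases hh with rfl | rfl | rfl
  · obtain hr | hr | hr | hr | hr | hr : t % 6 = 0 ∨ t % 6 = 1 ∨ t % 6 = 2 ∨ t % 6 = 3 ∨ t % 6 = 4 ∨
        t % 6 = 5 := by omega
    · exact CDFAux.main CDFAux.k2_0 (by norm_num) g ((t - 18) / 6) hg (by omega)
    · exact CDFAux.main CDFAux.k2_1 (by norm_num) g ((t - 19) / 6) hg (by omega)
    · exact CDFAux.main CDFAux.k2_2 (by norm_num) g ((t - 20) / 6) hg (by omega)
    · exact CDFAux.main CDFAux.k2_3 (by norm_num) g ((t - 21) / 6) hg (by omega)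
    · exact CDFAux.main CDFAux.k2_4 (by norm_num) g ((t - 16) / 6) hg (by omega)
    · exact CDFAux.main CDFAux.k2_5 (by norm_num) g ((t - 17) / 6) hg (by omega)
  · obtain hr | hr | hr | hr | hr | hr : t % 6 = 0 ∨ t % 6 = 1 ∨ t % 6 = 2 ∨ t % 6 = 3 ∨ t % 6 = 4 ∨
        t % 6 = 5 := by omega
    · exact CDFAux.main CDFAux.k3_0 (by norm_num) g ((t - 18) / 6) hg (by omega)
    · exact CDFAux.main CDFAux.k3_1 (by norm_num) g ((t - 19) / 6) hg (by omega)
    · exact CDFAux.main CDFAux.k3_2 (by norm_num) g ((t - 20) / 6) hg (by omega)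
    · exact CDFAux.main CDFAux.k3_3 (by norm_num) g ((t - 21) / 6) hg (by omega)
    · exact CDFAux.main CDFAux.k3_4 (by norm_num) g ((t - 22) / 6) hg (by omega)
    · exact CDFAux.main CDFAux.k3_5 (by norm_num) g ((t - 23) / 6) hg (by omega)
  · obtain hr | hr | hr | hr | hr | hr : t % 6 = 0 ∨ t % 6 = 1 ∨ t % 6 = 2 ∨ t % 6 = 3 ∨ t % 6 = 4 ∨
        t % 6 = 5 := by omega
    · exact CDFAux.main CDFAux.k6_0 (by norm_num) g ((t - 18) / 6) hg (by omega)
    · exact CDFAux.main CDFAux.k6_1 (by norm_num) g ((t - 19) / 6) hg (by omega)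
    · exact CDFAux.main CDFAux.k6_2 (by norm_num) g ((t - 20) / 6) hg (by omega)
    · exact CDFAux.main CDFAux.k6_3 (by norm_num) g ((t - 21) / 6) hg (by omega)
    · exact CDFAux.main CDFAux.k6_4 (by norm_num) g ((t - 16) / 6) hg (by omega)
    · exact CDFAux.main CDFAux.k6_5 (by norm_num) g ((t - 23) / 6) hg (by omega)
end

section
/- There exists a (6g,6,4,1)-CDF for every positive integer g such that gcd(g,150) = 1 or gcd(g,150) = 25; moreover, there exists a (210,6,4,1)-CDF (i.e., the case g = 35). -/
def Skew (n : ℕ) : Prop := ∃ T : Finset (ℤ × ℤ), 2 * T.card + 1 ≤ n ∧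
  ∀ z : ℤ, ¬ (n : ℤ) ∣ z →
    (∃ p ∈ T, (n : ℤ) ∣ z - p.1 ∨ (n : ℤ) ∣ z - p.2) ∧
    (∃ p ∈ T, (n : ℤ) ∣ z - (p.1 - p.2) ∨ (n : ℤ) ∣ z + (p.1 - p.2)) ∧
    (∃ p ∈ T, (n : ℤ) ∣ z - (p.1 + p.2) ∨ (n : ℤ) ∣ z + (p.1 + p.2))

lemma skew_one : Skew 1 := ⟨∅, by simp, fun z hz => absurd (by simp) hz⟩

/-- Reduction of the definition to a finite check. -/
lemma skew_of_check (n : ℕ) (hn : 0 < n) (L : List (ℕ × ℕ)) (hL : 2 * L.length + 1 ≤ n)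
    (h : ∀ z < n, z ≠ 0 →
      (∃ p ∈ L, z = p.1 ∨ z = p.2) ∧
      (∃ p ∈ L, (z + p.2) % n = p.1 % n ∨ (z + p.1) % n = p.2 % n) ∧
      (∃ p ∈ L, z % n = (p.1 + p.2) % n ∨ (z + (p.1 + p.2)) % n = 0)) : Skew n := by
  classical
  refine ⟨(L.map fun p => ((p.1 : ℤ), (p.2 : ℤ))).toFinset, ?_, ?_⟩
  · have := List.toFinset_card_le (L.map fun p => ((p.1 : ℤ), (p.2 : ℤ)))
    rw [List.length_map] at this
    omega
  · intro z hz
    have hn' : (0 : ℤ) < n := by exact_mod_cast hn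
    have h0 := Int.emod_nonneg z hn'.ne'
    have h1 := Int.emod_lt_of_pos z hn'
    obtain ⟨w, hw⟩ := Int.eq_ofNat_of_zero_le h0
    have hzw : (n : ℤ) ∣ z - w := by
      rw [← hw]; exact Int.dvd_self_sub_emod
    have hw0 : w ≠ 0 := by
      rintro rfl
      exact hz (Int.dvd_of_emod_eq_zero (by simpa using hw))
    have hwn : w < n := by
      rw [hw] at h1; exact_mod_cast h1
    obtain ⟨⟨p, hp, hp'⟩, ⟨q, hq, hq'⟩, ⟨s, hs, hs'⟩⟩ := h w hwn hw0
    have mem : ∀ p ∈ L, ((p.1 : ℤ), (p.2 : ℤ)) ∈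
        (L.map fun p => ((p.1 : ℤ), (p.2 : ℤ))).toFinset := by
      intro p hp
      rw [List.mem_toFinset]
      exact List.mem_map_of_mem (f := fun p : ℕ × ℕ => ((p.1 : ℤ), (p.2 : ℤ))) hp
    refine ⟨⟨_, mem p hp, ?_⟩, ⟨_, mem q hq, ?_⟩, ⟨_, mem s hs, ?_⟩⟩
    · rcases hp' with h | h
      · left; rw [h] at hzw; exact hzw
      · right; rw [h] at hzw; exact hzw
    · rcases hq' with h | h
      · left
        have h2 := (Nat.modEq_iff_dvd.1 (show q.1 ≡ w + q.2 [MOD n] from h.symm))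
        push_cast at h2
        have := Int.dvd_add hzw h2
        convert this using 1; ring
      · right
        have h2 := (Nat.modEq_iff_dvd.1 (show q.2 ≡ w + q.1 [MOD n] from h.symm))
        push_cast at h2
        have := Int.dvd_add hzw h2
        convert this using 1; ring
    · rcases hs' with h | h
      · left
        have h2 := (Nat.modEq_iff_dvd.1 (show s.1 + s.2 ≡ w [MOD n] from h.symm))
        push_cast at h2
        have := Int.dvd_add hzw h2
        convert this using 1; ring
      · right
        have h2 : (n : ℤ) ∣ ((w + (s.1 + s.2) : ℕ) : ℤ) :=
          Int.natCast_dvd_natCast.2 (Nat.dvd_of_mod_eq_zero h)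
        push_cast at h2
        have := Int.dvd_add hzw h2
        convert this using 1; ring

lemma skew_25 : Skew 25 :=
  skew_of_check 25 (by norm_num)
    [(1,2), (4,14), (7,12), (13,22), (18,24), (10,17), (3,6), (23,15), (8,21), (11,9), (5,19),
     (16,20)] (by decide +kernel) (by decide +kernel)

lemma skew_35 : Skew 35 :=
  skew_of_check 35 (by norm_num)
    [(1,29), (2,6), (12,13), (11,27), (15,7), (24,10), (4,17), (5,34), (16,31), (26,28), (8,18),
     (25,30), (19,22), (9,33), (3,21), (14,23), (20,32)] (by decide +kernel) (by decide +kernel)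

lemma skew_125 : Skew 125 :=
  skew_of_check 125 (by norm_num)
    [(48,69), (47,105), (73,61), (37,11), (17,55), (103,87), (88,116), (102,24), (41,60), (15,30),
     (32,76), (12,108), (31,42), (123,124), (50,98), (58,53), (8,113), (100,44), (6,38), (25,70),
     (34,107), (5,28), (51,64), (95,59), (23,16), (117,99), (33,9), (2,110), (56,22), (109,101),
     (63,26), (36,115), (79,14), (77,46), (65,119), (10,72), (89,91), (1,40), (122,67), (20,120),
     (27,49), (68,111), (92,83), (85,75), (81,13), (19,94), (90,86), (18,45), (106,57), (80,39),
     (114,29), (35,118), (54,3), (66,52), (71,74), (84,78), (4,96), (21,93), (97,7), (82,112),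
     (43,104), (62,121)] (by decide +kernel) (by decide +kernel)

lemma exists_mul_modEq (n : ℕ) (hn : 0 < n) (c : ℤ) (hc : IsCoprime c (n : ℤ)) (w : ℤ) :
    ∃ j ∈ Finset.range n, (n : ℤ) ∣ w - c * j := by
  obtain ⟨a, b, hab⟩ := hc
  have hn' : (0 : ℤ) < n := by exact_mod_cast hn
  have h0 := Int.emod_nonneg (w * a) hn'.ne'
  have h1 := Int.emod_lt_of_pos (w * a) hn'
  obtain ⟨j, hj⟩ := Int.eq_ofNat_of_zero_le h0
  refine ⟨j, ?_, ?_⟩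
  · rw [Finset.mem_range]
    rw [hj] at h1; exact_mod_cast h1
  · have h2 : (n : ℤ) ∣ w * a - j := by rw [← hj]; exact Int.dvd_self_sub_emod
    have h3 : w - c * j = n * (w * b) + c * (w * a - j) := by linear_combination (-w) * hab
    rw [h3]
    exact dvd_add (dvd_mul_right _ _) (h2.mul_left _)

lemma lift_dvd (m n : ℕ) (hn : 0 < n) (c : ℤ) (hc : IsCoprime c (n : ℤ)) (z x : ℤ)
    (h : (m : ℤ) ∣ z - x) :
    ∃ j ∈ Finset.range n, ((m * n : ℕ) : ℤ) ∣ z - (x + c * (m * j)) := by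
  obtain ⟨w, hw⟩ := h
  obtain ⟨j, hj, e, he⟩ := exists_mul_modEq n hn c hc w
  refine ⟨j, hj, e, ?_⟩
  push_cast
  linear_combination hw + m * he

lemma skew_mul (m n : ℕ) (hn : 0 < n) (h6 : Nat.Coprime n 6) (hS : Skew m) (hT : Skew n) :
    Skew (m * n) := by
  classical
  obtain ⟨S, hS1, hS2⟩ := hS
  obtain ⟨T, hT1, hT2⟩ := hT
  have h6' : IsCoprime (6 : ℤ) (n : ℤ) := by
    have := Nat.isCoprime_iff_coprime.2 h6.symm
    exact_mod_cast this
  have c2 : IsCoprime (2 : ℤ) (n : ℤ) := h6'.of_isCoprime_of_dvd_left ⟨3, by norm_num⟩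
  have c3 : IsCoprime (3 : ℤ) (n : ℤ) := h6'.of_isCoprime_of_dvd_left ⟨2, by norm_num⟩
  have c1 : IsCoprime (1 : ℤ) (n : ℤ) := isCoprime_one_left
  have cm1 : IsCoprime (-1 : ℤ) (n : ℤ) := c1.neg_left
  have cm3 : IsCoprime (-3 : ℤ) (n : ℤ) := c3.neg_left
  let f : (ℤ × ℤ) × ℕ → ℤ × ℤ := fun a => (a.1.1 + m * a.2, a.1.2 + 2 * (m * a.2))
  let g : ℤ × ℤ → ℤ × ℤ := fun a => (m * a.1, m * a.2)
  refine ⟨(S ×ˢ Finset.range n).image f ∪ T.image g, ?_, ?_⟩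
  · have e1 := Finset.card_union_le ((S ×ˢ Finset.range n).image f) (T.image g)
    have e2 : ((S ×ˢ Finset.range n).image f).card ≤ _ := Finset.card_image_le
    have e3 : (T.image g).card ≤ _ := Finset.card_image_le
    rw [Finset.card_product, Finset.card_range] at e2
    nlinarith
  · intro z hz
    have memf : ∀ p ∈ S, ∀ j ∈ Finset.range n,
        f (p, j) ∈ (S ×ˢ Finset.range n).image f ∪ T.image g := fun p hp j hj =>
      Finset.mem_union_left _ (Finset.mem_image_of_mem _ (Finset.mk_mem_product hp hj))
    have memg : ∀ p ∈ T, g p ∈ (S ×ˢ Finset.range n).image f ∪ T.image g := fun p hp =>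
      Finset.mem_union_right _ (Finset.mem_image_of_mem _ hp)
    by_cases hm : (m : ℤ) ∣ z
    · obtain ⟨w, rfl⟩ := hm
      have hw : ¬ (n : ℤ) ∣ w := by
        intro h; apply hz; push_cast; exact mul_dvd_mul_left _ h
      obtain ⟨⟨p, hp, hp'⟩, ⟨q, hq, hq'⟩, ⟨s, hs, hs'⟩⟩ := hT2 w hw
      have key : ∀ a b : ℤ, (n : ℤ) ∣ a → b = m * a → ((m * n : ℕ) : ℤ) ∣ b := by
        rintro a b h rfl; push_cast; exact mul_dvd_mul_left _ h
      refine ⟨⟨_, memg p hp, ?_⟩, ⟨_, memg q hq, ?_⟩, ⟨_, memg s hs, ?_⟩⟩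
      · exact hp'.imp (fun h => key _ _ h (by simp only [g]; ring))
          (fun h => key _ _ h (by simp only [g]; ring))
      · exact hq'.imp (fun h => key _ _ h (by simp only [g]; ring))
          (fun h => key _ _ h (by simp only [g]; ring))
      · exact hs'.imp (fun h => key _ _ h (by simp only [g]; ring))
          (fun h => key _ _ h (by simp only [g]; ring))
    · obtain ⟨⟨p, hp, hp'⟩, ⟨q, hq, hq'⟩, ⟨s, hs, hs'⟩⟩ := hS2 z hm
      refine ⟨?_, ?_, ?_⟩
      · rcases hp' with h | h
        · obtain ⟨j, hj, hd⟩ := lift_dvd m n hn 1 c1 _ _ h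
          exact ⟨_, memf p hp j hj, Or.inl (by convert hd using 1; simp only [f]; ring)⟩
        · obtain ⟨j, hj, hd⟩ := lift_dvd m n hn 2 c2 _ _ h
          exact ⟨_, memf p hp j hj, Or.inr (by convert hd using 1)⟩
      · rcases hq' with h | h
        · obtain ⟨j, hj, hd⟩ := lift_dvd m n hn (-1) cm1 _ _ h
          exact ⟨_, memf q hq j hj, Or.inl (by convert hd using 1; simp only [f]; ring)⟩
        · obtain ⟨j, hj, hd⟩ := lift_dvd m n hn 1 c1 z (-(q.1 - q.2)) (by rwa [sub_neg_eq_add])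
          exact ⟨_, memf q hq j hj, Or.inr (by convert hd using 1; simp only [f]; ring)⟩
      · rcases hs' with h | h
        · obtain ⟨j, hj, hd⟩ := lift_dvd m n hn 3 c3 _ _ h
          exact ⟨_, memf s hs j hj, Or.inl (by convert hd using 1; simp only [f]; ring)⟩
        · obtain ⟨j, hj, hd⟩ := lift_dvd m n hn (-3) cm3 z (-(s.1 + s.2)) (by rwa [sub_neg_eq_add])
          exact ⟨_, memf s hs j hj, Or.inr (by convert hd using 1; simp only [f]; ring)⟩

/-- Mullin–Nemeth type starters. -/
lemma skew_prime_odd (p q : ℕ) (hp : p.Prime) (hq : q.Prime) (hqo : Odd q) (hqp : q ∣ p - 1) :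
    Skew p := by
  classical
  have : Fact p.Prime := ⟨hp⟩
  have : Fact q.Prime := ⟨hq⟩
  have hq2 : q ≠ 2 := by rintro rfl; exact absurd hqo (by decide)
  have hq3 : 3 ≤ q := by have := hq.two_le; omega
  have hp4 : 3 < p := by
    have := Nat.le_of_dvd (by have := hp.two_le; omega) hqp
    omega
  have hpodd : Odd p := hp.odd_of_ne_two (by omega)
  have hcard : q ∣ Fintype.card (ZMod p)ˣ := by rwa [ZMod.card_units]
  obtain ⟨u', hu'⟩ := exists_prime_orderOf_dvd_card q hcard
  obtain ⟨u, hu⟩ : ∃ u : ZMod p, u = u' := ⟨_, rfl⟩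
  have huq : u ^ q = 1 := by
    rw [hu, ← Units.val_pow_eq_pow_val, ← hu', pow_orderOf_eq_one, Units.val_one]
  have hu1 : u ≠ 1 := by
    rintro rfl
    have : u' = 1 := Units.ext hu.symm
    rw [this, orderOf_one] at hu'
    omega
  have hu0 : u ≠ 0 := by rw [hu]; exact u'.ne_zero
  have h11 : (-1 : ZMod p) ≠ 1 := by
    have : Fact (2 < p) := ⟨by omega⟩
    exact ZMod.neg_one_ne_one
  have hum : 1 + u ≠ 0 := by
    intro h
    have : u = -1 := by linear_combination h
    rw [this, hqo.neg_one_pow] at huq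
    exact h11 huq
  have hum' : u - 1 ≠ 0 := sub_ne_zero.2 hu1
  let H : Finset (ZMod p) := Finset.univ.filter fun x => 0 < (x ^ q).val ∧ 2 * (x ^ q).val < p
  have memH : ∀ x, x ∈ H ↔ 0 < (x ^ q).val ∧ 2 * (x ^ q).val < p := by simp [H]
  have negval : ∀ x : ZMod p, x ≠ 0 → ((-x) ^ q).val = p - (x ^ q).val := by
    intro x hx
    rw [hqo.neg_pow, ZMod.neg_val, if_neg (pow_ne_zero _ hx)]
  have cover : ∀ x : ZMod p, x ≠ 0 → x ∈ H ∨ -x ∈ H := by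
    intro x hx
    rw [memH, memH, negval x hx]
    have h1 := ZMod.val_lt (x ^ q)
    have h2 : (x ^ q).val ≠ 0 := by
      rw [Ne, ZMod.val_eq_zero]; exact pow_ne_zero _ hx
    obtain ⟨k, hk⟩ := hpodd
    omega
  have H0 : ∀ x ∈ H, x ≠ 0 := by
    rintro x hx rfl
    rw [memH, zero_pow hq.ne_zero] at hx
    simp at hx
  have hdisj : Disjoint H (H.image fun x => -x) := by
    rw [Finset.disjoint_left]
    intro x hx hx'
    obtain ⟨y, hy, rfl⟩ := Finset.mem_image.1 hx'
    have := negval y (H0 y hy)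
    rw [memH] at hx hy
    omega
  have hHcard : 2 * H.card + 1 ≤ p := by
    have h1 : (H ∪ H.image fun x => -x).card = 2 * H.card := by
      rw [Finset.card_union_of_disjoint hdisj, Finset.card_image_of_injective _ neg_injective]
      ring
    have h2 : (0 : ZMod p) ∉ H ∪ H.image fun x => -x := by
      intro h
      rcases Finset.mem_union.1 h with h | h
      · exact H0 _ h rfl
      · obtain ⟨y, hy, hy'⟩ := Finset.mem_image.1 h
        exact H0 y hy (neg_eq_zero.1 hy')
    have h3 := Finset.card_le_univ (insert 0 (H ∪ H.image fun x => -x))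
    rw [Finset.card_insert_of_notMem h2, h1, ZMod.card] at h3
    exact h3
  have Hu : ∀ x ∈ H, u⁻¹ * x ∈ H := by
    intro x hx
    rw [memH] at hx ⊢
    rwa [mul_pow, inv_pow, huq, inv_one, one_mul]
  let f : ZMod p → ℤ × ℤ := fun x => (-(x.val : ℤ), ((u * x).val : ℤ))
  refine ⟨H.image f, le_trans (by have : (H.image f).card ≤ _ := Finset.card_image_le; omega) hHcard, ?_⟩
  intro z hz
  have hz0 : (z : ZMod p) ≠ 0 := by rwa [Ne, ZMod.intCast_zmod_eq_zero_iff_dvd]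
  have memf : ∀ x ∈ H, f x ∈ H.image f := fun x hx => Finset.mem_image_of_mem _ hx
  have conv : ∀ a : ℤ, ((a : ℤ) : ZMod p) = 0 → (p : ℤ) ∣ a := fun a h =>
    (ZMod.intCast_zmod_eq_zero_iff_dvd a p).1 h
  refine ⟨?_, ?_, ?_⟩
  · rcases cover _ hz0 with h | h
    · refine ⟨_, memf _ (Hu _ h), Or.inr (conv _ ?_)⟩
      simp [f, hu0]
    · refine ⟨_, memf _ h, Or.inl (conv _ ?_)⟩
      simp [f]
  · have hw : (1 + u)⁻¹ * (z : ZMod p) ≠ 0 := mul_ne_zero (inv_ne_zero hum) hz0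
    rcases cover _ hw with h | h
    · refine ⟨_, memf _ h, Or.inr (conv _ ?_)⟩
      simp only [f]; push_cast; simp only [ZMod.natCast_zmod_val]
      field_simp; ring
    · refine ⟨_, memf _ h, Or.inl (conv _ ?_)⟩
      simp only [f]; push_cast; simp only [ZMod.natCast_zmod_val]
      field_simp; ring
  · have hw : (u - 1)⁻¹ * (z : ZMod p) ≠ 0 := mul_ne_zero (inv_ne_zero hum') hz0
    rcases cover _ hw with h | h
    · refine ⟨_, memf _ h, Or.inl (conv _ ?_)⟩
      simp only [f]; push_cast; simp only [ZMod.natCast_zmod_val]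
      field_simp; ring
    · refine ⟨_, memf _ h, Or.inr (conv _ ?_)⟩
      simp only [f]; push_cast; simp only [ZMod.natCast_zmod_val]
      field_simp; ring

/-- The eight blocks of the starter in `Z_{16 t^2 + 1}`. -/
def blk : Finset (ℤ × ℤ × ℤ × ℤ) :=
  {(0,0,0,0), (1,0,0,0), (2,0,0,1), (0,1,0,2), (1,1,0,2), (2,1,1,0), (1,2,1,0), (3,2,0,0)}

lemma blk_spec (p q : ℤ) (hp : 0 ≤ p) (hp' : p < 4) (hq : 0 ≤ q) (hq' : q < 4) :
    (∃ b ∈ blk, (b.1 = p ∧ b.2.1 = q) ∨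
      (3 - b.2.1 + b.2.2.1 - b.2.2.2 = p ∧ b.1 + b.2.2.1 + b.2.2.2 = q)) ∧
    (∃ b ∈ blk, (b.1 + b.2.2.1 = p ∧ b.2.1 + b.2.2.2 = q) ∨
      (b.1 + b.2.2.1 = 3 - p ∧ b.2.1 + b.2.2.2 = 3 - q)) ∧
    (∃ b ∈ blk, (3 - b.2.1 + b.2.2.1 = p ∧ b.1 + b.2.2.2 = q) ∨
      (3 - b.2.1 + b.2.2.1 = 3 - p ∧ b.1 + b.2.2.2 = 3 - q)) := by
  interval_cases p <;> interval_cases q <;> decide +kernel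

lemma coords (t : ℕ) (ht : 0 < t) (w : ℤ) (hw : ¬ ((16 * t ^ 2 + 1 : ℕ) : ℤ) ∣ w) :
    ∃ p q : ℤ, ∃ r ∈ Finset.range t, ∃ c ∈ Finset.range t, ∃ e : ℤ,
      0 ≤ p ∧ p < 4 ∧ 0 ≤ q ∧ q < 4 ∧
      w = 1 + (p * t + r) + 4 * t * (q * t + c) + (16 * t ^ 2 + 1) * e := by
  push_cast at hw
  have ht' : (0 : ℤ) < t := by exact_mod_cast ht
  obtain ⟨n, hn⟩ : ∃ n : ℤ, n = 16 * t ^ 2 + 1 := ⟨_, rfl⟩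
  have hn0 : 0 < n := by rw [hn]; positivity
  have h0 := Int.emod_nonneg w hn0.ne'
  have h1 := Int.emod_lt_of_pos w hn0
  have h2 := Int.mul_ediv_add_emod w n
  have h3 : w % n ≠ 0 := by
    intro h; apply hw; rw [← hn]; exact Int.dvd_of_emod_eq_zero h
  obtain ⟨v, hv⟩ : ∃ v, v = w % n - 1 := ⟨_, rfl⟩
  have hN : (0 : ℤ) < 4 * t := by positivity
  have a1 := Int.mul_ediv_add_emod v (4 * t)
  have a2 := Int.emod_nonneg v hN.ne'
  have a3 := Int.emod_lt_of_pos v hN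
  obtain ⟨X, hX⟩ : ∃ X, X = v % (4 * t) := ⟨_, rfl⟩
  obtain ⟨Y, hY⟩ : ∃ Y, Y = v / (4 * t) := ⟨_, rfl⟩
  have hv0 : 0 ≤ v := by omega
  have hvn : v < 4 * t * (4 * t) := by nlinarith [hn]
  have hY0 : 0 ≤ Y := by rw [hY]; exact Int.ediv_nonneg hv0 hN.le
  have hY1 : Y < 4 * t := by rw [hY]; exact Int.ediv_lt_of_lt_mul hN hvn
  rw [← hX] at a1 a2 a3
  rw [← hY] at a1
  have b1 := Int.mul_ediv_add_emod X t
  have b2 := Int.emod_nonneg X ht'.ne'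
  have b3 := Int.emod_lt_of_pos X ht'
  have c1 := Int.mul_ediv_add_emod Y t
  have c2 := Int.emod_nonneg Y ht'.ne'
  have c3 := Int.emod_lt_of_pos Y ht'
  obtain ⟨r, hr⟩ := Int.eq_ofNat_of_zero_le b2
  obtain ⟨c, hc⟩ := Int.eq_ofNat_of_zero_le c2
  refine ⟨X / t, Y / t, r, ?_, c, ?_, w / n, Int.ediv_nonneg a2 ht'.le,
    Int.ediv_lt_of_lt_mul ht' a3, Int.ediv_nonneg hY0 ht'.le, Int.ediv_lt_of_lt_mul ht' hY1, ?_⟩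
  · rw [Finset.mem_range]; omega
  · rw [Finset.mem_range]; omega
  · rw [hr] at b1
    rw [hc] at c1
    rw [← hn]
    linear_combination (-1 : ℤ) * h2 - hv - a1 - b1 - 4 * t * c1

lemma skew_sq (t : ℕ) (ht : 0 < t) : Skew (16 * t ^ 2 + 1) := by
  classical
  obtain ⟨x, hx⟩ : ∃ x : (ℤ × ℤ × ℤ × ℤ) → ℕ → ℕ → ℤ, ∀ b r c, x b r c =
    1 + (b.1 * t + r) + 4 * t * (b.2.1 * t + c) := ⟨_, fun _ _ _ => rfl⟩
  obtain ⟨κ, hκ⟩ : ∃ κ : (ℤ × ℤ × ℤ × ℤ) → ℤ, ∀ b, κ b =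
    t * (b.2.2.1 + 4 * t * b.2.2.2) := ⟨_, fun _ => rfl⟩
  let f : (ℤ × ℤ × ℤ × ℤ) × ℕ × ℕ → ℤ × ℤ := fun a =>
    (x a.1 a.2.1 a.2.2, 4 * t * x a.1 a.2.1 a.2.2 + (1 + 4 * t) * κ a.1)
  refine ⟨(blk ×ˢ Finset.range t ×ˢ Finset.range t).image f, ?_, ?_⟩
  · have e : ((blk ×ˢ Finset.range t ×ˢ Finset.range t).image f).card ≤ _ := Finset.card_image_le
    rw [Finset.card_product, Finset.card_product, Finset.card_range,
      show blk.card = 8 by decide +kernel] at e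
    nlinarith
  · intro z hz
    have memf : ∀ b ∈ blk, ∀ r ∈ Finset.range t, ∀ c ∈ Finset.range t,
        f (b, r, c) ∈ (blk ×ˢ Finset.range t ×ˢ Finset.range t).image f :=
      fun b hb r hr c hc => Finset.mem_image_of_mem _
        (Finset.mk_mem_product hb (Finset.mk_mem_product hr hc))
    have comp : ∀ r ∈ Finset.range t, ∃ r' ∈ Finset.range t, (r' : ℤ) = t - 1 - r := by
      intro r hr
      rw [Finset.mem_range] at hr
      exact ⟨t - 1 - r, Finset.mem_range.2 (by omega), by omega⟩
    obtain ⟨w, hw⟩ : ∃ w : ℤ, w = z * (1 - 4 * t) * (8 * t ^ 2 + 1) := ⟨_, rfl⟩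
    have hzw : z = (1 + 4 * t) * w + (16 * t ^ 2 + 1) * (z * (8 * t ^ 2)) := by
      rw [hw]; ring
    have hw' : ¬ ((16 * t ^ 2 + 1 : ℕ) : ℤ) ∣ w := by
      intro h; apply hz; rw [hzw]
      push_cast at h ⊢
      exact dvd_add (h.mul_left _) (dvd_mul_right _ _)
    push_cast
    refine ⟨?_, ?_, ?_⟩
    · obtain ⟨p, q, r, hr, c, hc, e, hp, hp', hq, hq', hz⟩ := coords t ht z hz
      obtain ⟨b, hb, ⟨h1, h2⟩ | ⟨h1, h2⟩⟩ := (blk_spec p q hp hp' hq hq').1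
      · refine ⟨_, memf b hb r hr c hc, Or.inl ⟨e, ?_⟩⟩
        simp only [f, hx]
        rw [hz, ← h1, ← h2]; ring
      · obtain ⟨r', hr', hrr⟩ := comp r hr
        refine ⟨_, memf b hb c hc r' hr', Or.inr ⟨e - (b.2.1 * t + r') - t * b.2.2.2, ?_⟩⟩
        simp only [f, hx, hκ]
        rw [hz, ← h1, ← h2, hrr]; ring
    · obtain ⟨p, q, r, hr, c, hc, e, hp, hp', hq, hq', hw⟩ := coords t ht w hw'
      obtain ⟨b, hb, ⟨h1, h2⟩ | ⟨h1, h2⟩⟩ := (blk_spec p q hp hp' hq hq').2.2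
      · obtain ⟨r', hr', hrr⟩ := comp r hr
        subst h1 h2
        refine ⟨_, memf b hb c hc r' hr', Or.inr ⟨z * (8 * t ^ 2) +
          (1 + 4 * t) * (e - (b.2.1 * t + r')) + x b c r', ?_⟩⟩
        simp only [f, hx, hκ]
        rw [hrr]
        linear_combination hzw + (1 + 4 * t) * hw
      · obtain ⟨c', hc', hcc⟩ := comp c hc
        obtain rfl : p = 3 - (3 - b.2.1 + b.2.2.1) := by linarith
        obtain rfl : q = 3 - (b.1 + b.2.2.2) := by linarith
        refine ⟨_, memf b hb c' hc' r hr, Or.inl ⟨z * (8 * t ^ 2) +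
          (1 + 4 * t) * (e + (b.2.1 * t + r) + 1) - x b c' r, ?_⟩⟩
        simp only [f, hx, hκ]
        rw [hcc]
        linear_combination hzw + (1 + 4 * t) * hw
    · obtain ⟨p, q, r, hr, c, hc, e, hp, hp', hq, hq', hw⟩ := coords t ht w hw'
      obtain ⟨b, hb, ⟨h1, h2⟩ | ⟨h1, h2⟩⟩ := (blk_spec p q hp hp' hq hq').2.1
      · subst h1 h2
        refine ⟨_, memf b hb r hr c hc, Or.inl ⟨z * (8 * t ^ 2) + (1 + 4 * t) * e, ?_⟩⟩
        simp only [f, hx, hκ]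
        linear_combination hzw + (1 + 4 * t) * hw
      · obtain ⟨c', hc', hcc⟩ := comp c hc
        obtain ⟨r', hr', hrr⟩ := comp r hr
        obtain rfl : p = 3 - (b.1 + b.2.2.1) := by linarith
        obtain rfl : q = 3 - (b.2.1 + b.2.2.2) := by linarith
        refine ⟨_, memf b hb r' hr' c' hc', Or.inr ⟨z * (8 * t ^ 2) + (1 + 4 * t) * (e + 1), ?_⟩⟩
        simp only [f, hx, hκ]
        rw [hcc, hrr]
        linear_combination hzw + (1 + 4 * t) * hw

lemma skew_prime (p : ℕ) (hp : p.Prime) (h7 : 7 ≤ p) : Skew p := by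
  rcases Nat.eq_two_pow_or_exists_odd_prime_and_dvd (p - 1) with ⟨k, hk⟩ | ⟨q, hq, hqp, hqo⟩
  · have hpk : p = 2 ^ k + 1 := by omega
    rcases Nat.even_or_odd' k with ⟨j, rfl | rfl⟩
    · have hj : 2 ≤ j := by
        by_contra h
        have : j = 0 ∨ j = 1 := by omega
        rcases this with rfl | rfl <;> norm_num at hpk <;> omega
      obtain ⟨i, rfl⟩ := Nat.exists_eq_add_of_le hj
      have : p = 16 * (2 ^ i) ^ 2 + 1 := by rw [hpk]; ring
      rw [this]
      exact skew_sq _ (by positivity)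
    · exfalso
      have h3 : 3 ∣ p := by
        have := Odd.nat_add_dvd_pow_add_pow 2 1 (n := 2 * j + 1) ⟨j, rfl⟩
        rw [one_pow, ← hpk] at this
        exact this
      have := (Nat.prime_dvd_prime_iff_eq Nat.prime_three hp).1 h3
      omega
  · exact skew_prime_odd p q hp hq hqo hqp

lemma skew_coprime (g : ℕ) (hg : 0 < g) (h : Nat.Coprime g 30) : Skew g := by
  induction g using induction_on_primes with
  | zero => omega
  | one => exact skew_one
  | prime_mul p a hp ih =>
    have ha : 0 < a := Nat.pos_of_mul_pos_left hg
    have h1 : Nat.Coprime a 30 := Nat.Coprime.coprime_mul_left h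
    have h2 : Nat.Coprime p 30 := Nat.Coprime.coprime_mul_right h
    have h7 : 7 ≤ p := by
      by_contra hlt
      have := hp.two_le
      have h8 : p < 7 := by omega
      interval_cases p <;> revert h2 hp <;> decide
    exact skew_mul p a ha (Nat.Coprime.coprime_dvd_right ⟨5, by norm_num⟩ h1)
      (skew_prime p hp h7) (ih ha h1)

lemma skew_five_pow (k : ℕ) : Skew (5 ^ (k + 2)) := by
  induction k using Nat.twoStepInduction with
  | zero => exact skew_25
  | one => exact skew_125
  | more k ih _ =>
    have : 5 ^ (k + 2 + 2) = 5 ^ (k + 2) * 25 := by ring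
    rw [this]
    exact skew_mul _ _ (by norm_num) (by norm_num) ih skew_25

lemma skew_main (g : ℕ) (hg : 0 < g) (h : Nat.gcd g 150 = 1 ∨ Nat.gcd g 150 = 25) :
    Skew g ∧ Nat.Coprime g 6 := by
  rcases h with h | h
  · exact ⟨skew_coprime g hg (Nat.Coprime.coprime_dvd_right ⟨5, by norm_num⟩ h),
      Nat.Coprime.coprime_dvd_right ⟨25, by norm_num⟩ h⟩
  · have h25 : 25 ∣ g := h ▸ Nat.gcd_dvd_left g 150
    have h6 : Nat.Coprime g 6 := by
      have h1 : Nat.gcd g 6 ∣ 25 := by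
        rw [← h]; exact Nat.gcd_dvd_gcd_of_dvd_right g ⟨25, by norm_num⟩
      exact Nat.eq_one_of_dvd_coprimes (show Nat.Coprime 25 6 by norm_num) h1 (Nat.gcd_dvd_right g 6)
    refine ⟨?_, h6⟩
    obtain ⟨k, m, hm, hgm⟩ := Nat.exists_eq_pow_mul_and_not_dvd hg.ne' 5 (by norm_num)
    have hm5 : Nat.Coprime m 5 := ((Nat.Prime.coprime_iff_not_dvd Nat.prime_five).2 hm).symm
    have hm0 : 0 < m := Nat.pos_of_ne_zero (by rintro rfl; simp at hm)
    have hm6 : Nat.Coprime m 6 := Nat.Coprime.coprime_dvd_left ⟨5 ^ k, by rw [hgm]; ring⟩ h6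
    have hk : 2 ≤ k := by
      have h1 : 5 ^ 2 ∣ 5 ^ k * m := by rw [← hgm]; exact h25
      have h2 := (Nat.Coprime.pow_left 2 hm5.symm).dvd_of_dvd_mul_right h1
      exact (Nat.pow_dvd_pow_iff_le_right (by norm_num)).1 h2
    obtain ⟨i, rfl⟩ := Nat.exists_eq_add_of_le' hk
    rw [hgm]
    exact skew_mul _ _ hm0 hm6 (skew_five_pow i)
      (skew_coprime m hm0 (by
        have := Nat.Coprime.mul_right hm5 hm6
        exact this))

lemma card_blockDiffs {G : Type*} [AddGroup G] [DecidableEq G] (F : Finset G) :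
    (blockDiffs F).card = F.card * F.card - F.card := by
  unfold blockDiffs
  rw [Multiset.card_map]
  rw [← Finset.offDiag_card]
  change Finset.card _ = _
  congr 1
  ext p
  simp [Finset.mem_offDiag, and_assoc]

lemma mem_blockDiffs {G : Type*} [AddGroup G] [DecidableEq G] (F : Finset G) (a b x : G)
    (ha : a ∈ F) (hb : b ∈ F) (hx : x ≠ 0) (h : x = a - b) : x ∈ blockDiffs F := by
  unfold blockDiffs
  rw [Multiset.mem_map]
  refine ⟨(a, b), ?_, h.symm⟩
  rw [Finset.mem_val, Finset.mem_filter]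
  refine ⟨Finset.mk_mem_product ha hb, ?_⟩
  intro hab
  apply hx
  rw [h]
  exact sub_eq_zero.2 hab

lemma cdf_of_skew (g : ℕ) (hg : 0 < g) (h6 : Nat.Coprime g 6) (hS : Skew g) :
    ∃ 𝓕 : Multiset (Finset (ZMod (g * 6))), IsCDF g 6 4 𝓕 := by
  classical
  obtain ⟨T, hT1, hT2⟩ := hS
  have : NeZero (g * 6) := ⟨by positivity⟩
  have hc : IsCoprime (g : ℤ) 6 := by
    have := Nat.isCoprime_iff_coprime.2 h6
    exact_mod_cast this
  obtain ⟨A, B, hAB⟩ := hc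
  -- `e r v` is congruent to `r` mod 6 and to `v` mod `g`
  obtain ⟨e, he⟩ : ∃ e : ℤ → ℤ → ℤ, ∀ r v, e r v = r * (A * g) + v * (B * 6) :=
    ⟨_, fun _ _ => rfl⟩
  let blkF : ℤ × ℤ → Finset (ZMod (g * 6)) := fun p =>
    {((e 0 (-2 * p.1) : ℤ) : ZMod (g * 6)), ((e 0 (-2 * p.2) : ℤ) : ZMod (g * 6)),
      ((e 1 0 : ℤ) : ZMod (g * 6)), ((e 4 (-(p.1 + p.2)) : ℤ) : ZMod (g * 6))}
  let 𝓕 : Multiset (Finset (ZMod (g * 6))) := T.val.map blkF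
  let M := 𝓕.bind blockDiffs
  let C : Finset (ZMod (g * 6)) :=
    Finset.univ.filter fun x => x ∉ AddSubgroup.zmultiples ((g : ZMod (g * 6)))
  have eqv : ∀ (z r v r' v' : ℤ), (6 : ℤ) ∣ z - (r - r') → (g : ℤ) ∣ z - (v - v') →
      (z : ZMod (g * 6)) = ((e r v : ℤ) : ZMod (g * 6)) - ((e r' v' : ℤ) : ZMod (g * 6)) := by
    rintro z r v r' v' ⟨a, ha⟩ ⟨b, hb⟩
    rw [← sub_eq_zero, ← Int.cast_sub, ← Int.cast_sub, ZMod.intCast_zmod_eq_zero_iff_dvd]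
    refine ⟨A * a + B * b, ?_⟩
    rw [he, he]
    push_cast
    linear_combination (A * g) * ha + (B * 6) * hb - z * hAB
  have c2 : IsCoprime (2 : ℤ) (g : ℤ) := ⟨3 * B, A, by linear_combination hAB⟩
  have surj : ∀ x ∈ C, x ∈ M := by
    intro x hx
    obtain ⟨z, rfl⟩ := ZMod.intCast_surjective x
    have hx' : (z : ZMod (g * 6)) ∉ AddSubgroup.zmultiples ((g : ZMod (g * 6))) :=
      (Finset.mem_filter.1 hx).2
    have hz : ¬ (g : ℤ) ∣ z := by
      rintro ⟨k, rfl⟩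
      apply hx'
      rw [AddSubgroup.mem_zmultiples_iff]
      exact ⟨k, by push_cast; rw [zsmul_eq_mul]; ring⟩
    have hz0 : (z : ZMod (g * 6)) ≠ 0 := by
      intro h; apply hx'; rw [h]; exact zero_mem _
    obtain ⟨j, -, hj⟩ := exists_mul_modEq g hg 2 c2 z
    have hjn : ¬ (g : ℤ) ∣ (j : ℤ) := by
      intro h; apply hz
      have := Int.dvd_add hj (h.mul_left 2)
      rwa [sub_add_cancel] at this
    have dbl : ∀ a b : ℤ, (g : ℤ) ∣ j - a → b = 2 * a → (g : ℤ) ∣ z - b := by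
      rintro a b h rfl
      have := Int.dvd_add hj (h.mul_left 2)
      convert this using 1; ring
    have dblm : ∀ a b : ℤ, (g : ℤ) ∣ j + a → b = -(2 * a) → (g : ℤ) ∣ z - b := by
      rintro a b h rfl
      have := Int.dvd_add hj (h.mul_left 2)
      convert this using 1; ring
    have dblm' : ∀ a b : ℤ, (g : ℤ) ∣ -j - a → b = -(2 * a) → (g : ℤ) ∣ z - b := by
      rintro a b h rfl
      have := Int.dvd_sub hj (h.mul_left 2)
      convert this using 1; ring
    have memM : ∀ p ∈ T, (z : ZMod (g * 6)) ∈ blockDiffs (blkF p) → (z : ZMod (g * 6)) ∈ M := by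
      intro p hp h
      exact Multiset.mem_bind.2 ⟨blkF p, Multiset.mem_map_of_mem _ hp, h⟩
    have m1 : ∀ p : ℤ × ℤ, ((e 0 (-2 * p.1) : ℤ) : ZMod (g * 6)) ∈ blkF p := by
      intro p; simp [blkF]
    have m2 : ∀ p : ℤ × ℤ, ((e 0 (-2 * p.2) : ℤ) : ZMod (g * 6)) ∈ blkF p := by
      intro p; simp [blkF]
    have m3 : ∀ p : ℤ × ℤ, ((e 1 0 : ℤ) : ZMod (g * 6)) ∈ blkF p := by
      intro p; simp [blkF]
    have m4 : ∀ p : ℤ × ℤ, ((e 4 (-(p.1 + p.2)) : ℤ) : ZMod (g * 6)) ∈ blkF p := by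
      intro p; simp [blkF]
    have hr : z % 6 = 0 ∨ z % 6 = 1 ∨ z % 6 = 2 ∨ z % 6 = 3 ∨ z % 6 = 4 ∨ z % 6 = 5 := by omega
    have hjn' : ¬ (g : ℤ) ∣ -(j : ℤ) := by rwa [dvd_neg]
    rcases hr with h | h | h | h | h | h
    · obtain ⟨p, hp, hd | hd⟩ := (hT2 j hjn).2.1
      · exact memM p hp (mem_blockDiffs _ _ _ _ (m2 p) (m1 p) hz0
          (eqv _ _ _ _ _ (by omega) (dbl _ _ hd (by ring))))
      · exact memM p hp (mem_blockDiffs _ _ _ _ (m1 p) (m2 p) hz0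
          (eqv _ _ _ _ _ (by omega) (dblm _ _ hd (by ring))))
    · obtain ⟨p, hp, hd | hd⟩ := (hT2 j hjn).1
      · exact memM p hp (mem_blockDiffs _ _ _ _ (m3 p) (m1 p) hz0
          (eqv _ _ _ _ _ (by omega) (dbl _ _ hd (by ring))))
      · exact memM p hp (mem_blockDiffs _ _ _ _ (m3 p) (m2 p) hz0
          (eqv _ _ _ _ _ (by omega) (dbl _ _ hd (by ring))))
    · obtain ⟨p, hp, hd | hd⟩ := (hT2 z hz).2.1
      · exact memM p hp (mem_blockDiffs _ _ _ _ (m2 p) (m4 p) hz0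
          (eqv _ _ _ _ _ (by omega) (by convert hd using 1; ring)))
      · exact memM p hp (mem_blockDiffs _ _ _ _ (m1 p) (m4 p) hz0
          (eqv _ _ _ _ _ (by omega) (by convert hd using 1; ring)))
    · obtain ⟨p, hp, hd | hd⟩ := (hT2 z hz).2.2
      · exact memM p hp (mem_blockDiffs _ _ _ _ (m3 p) (m4 p) hz0
          (eqv _ _ _ _ _ (by omega) (by convert hd using 1; ring)))
      · exact memM p hp (mem_blockDiffs _ _ _ _ (m4 p) (m3 p) hz0
          (eqv _ _ _ _ _ (by omega) (by convert hd using 1; ring)))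
    · obtain ⟨p, hp, hd | hd⟩ := (hT2 z hz).2.1
      · exact memM p hp (mem_blockDiffs _ _ _ _ (m4 p) (m1 p) hz0
          (eqv _ _ _ _ _ (by omega) (by convert hd using 1; ring)))
      · exact memM p hp (mem_blockDiffs _ _ _ _ (m4 p) (m2 p) hz0
          (eqv _ _ _ _ _ (by omega) (by convert hd using 1; ring)))
    · obtain ⟨p, hp, hd | hd⟩ := (hT2 (-j) hjn').1
      · exact memM p hp (mem_blockDiffs _ _ _ _ (m1 p) (m3 p) hz0
          (eqv _ _ _ _ _ (by omega) (dblm' _ _ hd (by ring))))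
      · exact memM p hp (mem_blockDiffs _ _ _ _ (m2 p) (m3 p) hz0
          (eqv _ _ _ _ _ (by omega) (dblm' _ _ hd (by ring))))
  have hle : C.val ≤ M := (Multiset.le_iff_subset C.nodup).2 surj
  have hblk : ∀ p, (blkF p).card ≤ 4 := fun p => Finset.card_le_four
  have hCcard : g * 6 - 6 ≤ C.card := by
    have h1 : (Finset.univ.filter fun x => x ∈ AddSubgroup.zmultiples ((g : ZMod (g * 6)))).card
        ≤ 6 := by
      have h2 : Nat.card (AddSubgroup.zmultiples ((g : ZMod (g * 6)))) ≤ 6 := by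
        rw [Nat.card_zmultiples]
        apply addOrderOf_le_of_nsmul_eq_zero (by norm_num)
        have := ZMod.natCast_self (g * 6)
        push_cast at this
        rw [nsmul_eq_mul]
        push_cast
        linear_combination this
      rw [← Fintype.card_subtype, ← Nat.card_eq_fintype_card]
      exact h2
    have h3 := Finset.card_filter_add_card_filter_not (s := (Finset.univ : Finset (ZMod (g * 6))))
      (fun x => x ∈ AddSubgroup.zmultiples ((g : ZMod (g * 6))))
    rw [Finset.card_univ, ZMod.card] at h3
    simp only [C]
    omega
  have hMcard : M.card = ∑ p ∈ T, (blockDiffs (blkF p)).card := by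
    simp only [M, 𝓕, Multiset.card_bind, Multiset.map_map]
    rfl
  have hb12 : ∀ p ∈ T, (blockDiffs (blkF p)).card ≤ 12 := by
    intro p _
    rw [card_blockDiffs]
    have := hblk p
    interval_cases (blkF p).card <;> simp
  have hM12 : M.card ≤ 12 * T.card := by
    rw [hMcard]
    have := Finset.sum_le_card_nsmul T _ 12 hb12
    rw [smul_eq_mul] at this
    omega
  have hMC : C.val = M := Multiset.eq_of_le_of_card_le hle (by
    have : C.val.card = C.card := rfl
    omega)
  have hcount : ∀ x, M.count x = if x ∈ C then 1 else 0 := by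
    intro x
    rw [← hMC]
    exact Multiset.count_eq_of_nodup C.nodup
  refine ⟨𝓕, ?_, ?_, ?_⟩
  · intro F hF
    obtain ⟨p, hp, rfl⟩ := Multiset.mem_map.1 hF
    by_contra hne
    have hlt : (blockDiffs (blkF p)).card < 12 := by
      rw [card_blockDiffs]
      have := hblk p
      have : (blkF p).card ≤ 3 := by omega
      interval_cases (blkF p).card <;> simp
    have h1 : ∑ p ∈ T, (blockDiffs (blkF p)).card < ∑ p ∈ T, 12 :=
      Finset.sum_lt_sum hb12 ⟨p, hp, hlt⟩
    rw [← hMcard, ← hMC, Finset.sum_const, smul_eq_mul] at h1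
    have : C.val.card = C.card := rfl
    omega
  · intro x hx
    rw [hcount, if_neg]
    simp only [C, Finset.mem_filter, not_and, not_not]
    exact fun _ => hx
  · intro x hx
    rw [hcount, if_pos]
    simp only [C, Finset.mem_filter]
    exact ⟨Finset.mem_univ _, hx⟩

/-- A `(6g,6,4,1)`-CDF exists for every positive integer `g` with
`gcd(g,150) = 1` or `gcd(g,150) = 25`; moreover a `(210,6,4,1)`-CDF exists
(the case `g = 35`). -/
theorem stmt_9 :
    (∀ g : ℕ, 0 < g → (Nat.gcd g 150 = 1 ∨ Nat.gcd g 150 = 25) →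
      ∃ 𝓕 : Multiset (Finset (ZMod (g * 6))), IsCDF g 6 4 𝓕) ∧
    (∃ 𝓕 : Multiset (Finset (ZMod (35 * 6))), IsCDF 35 6 4 𝓕) := by
  refine ⟨fun g hg h => ?_, cdf_of_skew 35 (by norm_num) (by norm_num) skew_35⟩
  obtain ⟨h1, h2⟩ := skew_main g hg h
  exact cdf_of_skew g hg h2 h1
end

section
/- For every integer v ≥ 2, a (v,4,1)-CDM exists if and only if v is odd, v ≥ 5, and v ≠ 9. -/
/-- A `(v,k,1)`-CDM (cyclic difference matrix): a `k × v` matrix with entries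
in `Z_v` such that for any two distinct rows, the list of componentwise
differences contains each element of `Z_v` exactly once. -/
def IsCDM (v k : ℕ) (D : Fin k → Fin v → ZMod v) : Prop :=
  ∀ x y : Fin k, x ≠ y → Function.Bijective fun j => D x j - D y j


def HasCDM (v : ℕ) : Prop := ∃ D : Fin 4 → Fin v → ZMod v, IsCDM v 4 D

theorem hasCDM_of_inj {v : ℕ} [NeZero v] {ι H : Type} [Fintype ι] [AddCommGroup H]
    (hc : Fintype.card ι = v) (e : H ≃+ ZMod v) (D : Fin 4 → ι → H)
    (hD : ∀ x y, x ≠ y → Function.Injective fun j => D x j - D y j) : HasCDM v := by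
  let f : Fin v ≃ ι := (Fintype.equivFinOfCardEq hc).symm
  refine ⟨fun x j => e (D x (f j)), fun x y hxy => ?_⟩
  rw [Fintype.bijective_iff_injective_and_card]
  refine ⟨fun i j hij => ?_, by simp [ZMod.card]⟩
  simp only [← map_sub] at hij
  exact f.injective (hD x y hxy (e.injective hij))

theorem hasCDM_mul {a b : ℕ} (ha : HasCDM a) (hb : HasCDM b) (ha0 : a ≠ 0) (hb0 : b ≠ 0) :
    HasCDM (a * b) := by
  obtain ⟨A, hA⟩ := ha
  obtain ⟨B, hB⟩ := hb
  have : NeZero a := ⟨ha0⟩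
  have : NeZero b := ⟨hb0⟩
  have : NeZero (a * b) := ⟨mul_ne_zero ha0 hb0⟩
  refine hasCDM_of_inj (v := a * b) (ι := Fin a × Fin b) (by simp) (AddEquiv.refl (ZMod (a * b)))
    (fun x j => ((((A x j.1).val : ℤ) + a * ((B x j.2).val : ℤ) : ℤ) : ZMod (a * b))) ?_
  rintro x y hxy ⟨p, q⟩ ⟨p', q'⟩ h
  simp only [← Int.cast_sub] at h
  rw [ZMod.intCast_eq_intCast_iff_dvd_sub] at h
  have h1 : p = p' := by
    apply (hA x y hxy).1
    have : (a : ℤ) ∣ _ := (Dvd.intro _ (by push_cast; rfl)).trans h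
    have h2 := (ZMod.intCast_eq_intCast_iff_dvd_sub _ _ a).2 this
    push_cast at h2
    simpa using h2
  subst h1
  have h1 : q = q' := by
    apply (hB x y hxy).1
    have h3 : (b : ℤ) ∣ (((B x q').val : ℤ) - (B y q').val) - (((B x q).val : ℤ) - (B y q).val) := by
      have ha' : (a : ℤ) ≠ 0 := by exact_mod_cast ha0
      apply Int.dvd_of_mul_dvd_mul_left ha' 
      refine (by push_cast; exact dvd_refl _ : (a : ℤ) * b ∣ ((a * b : ℕ) : ℤ)).trans (h.trans (dvd_of_eq ?_))
      ring
    have h2 := (ZMod.intCast_eq_intCast_iff_dvd_sub _ _ b).2 h3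
    push_cast at h2
    simpa using h2
  rw [h1]

theorem unit_two {m : ℕ} (h : Nat.Coprime m 6) : IsUnit (2 : ZMod m) := by
  have := (ZMod.isUnit_iff_coprime 2 m).2 (Nat.Coprime.symm (h.coprime_dvd_right (by norm_num)))
  exact_mod_cast this
theorem unit_three {m : ℕ} (h : Nat.Coprime m 6) : IsUnit (3 : ZMod m) := by
  have := (ZMod.isUnit_iff_coprime 3 m).2 (Nat.Coprime.symm (h.coprime_dvd_right (by norm_num)))
  exact_mod_cast this

theorem unit_diff {m : ℕ} (h : Nat.Coprime m 6) (r s : Fin 4) (hrs : r ≠ s) :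
    IsUnit (((r : ℕ) : ZMod m) - ((s : ℕ) : ZMod m)) := by
  have h2 := unit_two h
  have h3 := unit_three h
  have h1 : IsUnit (1 : ZMod m) := isUnit_one
  fin_cases r <;> fin_cases s <;> first | exact absurd rfl hrs | skip
  all_goals norm_num
  all_goals first | exact h1 | exact h2 | exact h3 | assumption

theorem hasCDM_coprime {v : ℕ} (h0 : v ≠ 0) (h : Nat.Coprime v 6) : HasCDM v := by
  have : NeZero v := ⟨h0⟩
  refine hasCDM_of_inj (v := v) (ι := ZMod v) (ZMod.card v) (AddEquiv.refl (ZMod v))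
    (fun x j => ((x : ℕ) : ZMod v) * j) ?_
  intro x y hxy i j hij
  simp only [← sub_mul] at hij
  exact (unit_diff h x y hxy).mul_left_cancel hij

theorem not_even {v : ℕ} (h2 : 2 ≤ v) (he : Even v) : ¬ HasCDM v := by
  rintro ⟨D, hD⟩
  have : NeZero v := ⟨by omega⟩
  have key : ∀ x y : Fin 4, x ≠ y → ∑ j, D x j - ∑ j, D y j = ∑ z : ZMod v, z := by
    intro x y hxy
    rw [← Finset.sum_sub_distrib]
    exact (hD x y hxy).sum_comp (fun z => z)
  have hS : ∑ z : ZMod v, z = 0 := by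
    have a := key 0 1 (by decide)
    have b := key 1 2 (by decide)
    have c := key 0 2 (by decide)
    linear_combination c - a - b
  have hb : Function.Bijective (fun i : Fin v => (((i : ℕ) : ℕ) : ZMod v)) := by
    rw [Fintype.bijective_iff_injective_and_card]
    refine ⟨fun i j hij => ?_, by simp [ZMod.card]⟩
    have := (ZMod.natCast_eq_natCast_iff' _ _ _).1 hij
    rw [Nat.mod_eq_of_lt i.2, Nat.mod_eq_of_lt j.2] at this
    exact Fin.ext this
  have h3 : ∑ i : Fin v, ((i : ℕ) : ZMod v) = 0 := by
    rw [← hS]; exact hb.sum_comp (fun z => z)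
  rw [Fin.sum_univ_eq_sum_range (fun i => (i : ZMod v)), ← Nat.cast_sum, ZMod.natCast_eq_zero_iff] at h3
  have h4 := Finset.sum_range_id_mul_two v
  obtain ⟨k, hk⟩ := he
  obtain ⟨c, hc⟩ := h3
  rw [hc, mul_assoc] at h4
  have h5 := Nat.eq_of_mul_eq_mul_left (by omega) h4
  omega

/-- Entry of row `r` in a column whose first entry is zero. -/
def ent (r : ℕ) (c : ℕ × ℕ × ℕ) : ℕ :=
  match r with
  | 0 => 0
  | 1 => c.1
  | 2 => c.2.1
  | _ => c.2.2

def cmask (v r s : ℕ) (L : List (ℕ × ℕ × ℕ)) : ℕ :=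
  L.foldr (fun c acc => 2 ^ ((ent r c + (v - 1) * ent s c) % v) ||| acc) 0

def cchk (v : ℕ) (L : List (ℕ × ℕ × ℕ)) : Bool :=
  L.length == v && (List.range 4).all fun r => (List.range 4).all fun s =>
    r == s || cmask v r s L == 2 ^ v - 1

theorem cmask_sound (v r s k : ℕ) (L : List (ℕ × ℕ × ℕ)) (h : (cmask v r s L).testBit k = true) :
    ∃ c ∈ L, (ent r c + (v - 1) * ent s c) % v = k := by
  induction L with
  | nil => simp [cmask] at h
  | cons c L ih =>
    rw [cmask, List.foldr_cons, Nat.testBit_or, Bool.or_eq_true] at h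
    rcases h with h | h
    · rw [Nat.testBit_two_pow] at h
      exact ⟨c, by simp, by simpa using h⟩
    · obtain ⟨d, hd, e⟩ := ih h
      exact ⟨d, by simp [hd], e⟩

theorem cast_diff {v : ℕ} (hv : 0 < v) (a b : ℕ) :
    (((a + (v - 1) * b) % v : ℕ) : ZMod v) = (a : ZMod v) - b := by
  rw [ZMod.natCast_mod]
  push_cast [Nat.cast_sub (show 1 ≤ v from hv)]
  simp [sub_eq_add_neg]

theorem cchk_sound {v : ℕ} (hv : 0 < v) (L : List (ℕ × ℕ × ℕ)) (h : cchk v L = true) :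
    HasCDM v := by
  have : NeZero v := ⟨hv.ne'⟩
  simp only [cchk, Bool.and_eq_true, beq_iff_eq, List.all_eq_true, List.mem_range,
    Bool.or_eq_true] at h
  obtain ⟨hl, h⟩ := h
  refine ⟨fun r j => ((ent r (L.get (j.cast hl.symm)) : ℕ) : ZMod v), fun r s hrs => ?_⟩
  rw [Fintype.bijective_iff_surjective_and_card]
  refine ⟨fun z => ?_, by simp [ZMod.card]⟩
  have h1 := (h r r.2 s s.2).resolve_left (fun e => hrs (Fin.ext e))
  have h2 : (cmask v r s L).testBit z.val = true := by
    rw [h1, Nat.testBit_two_pow_sub_one]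
    simpa using z.val_lt
  obtain ⟨c, hc, e⟩ := cmask_sound _ _ _ _ _ h2
  obtain ⟨n, rfl⟩ := List.get_of_mem hc
  refine ⟨n.cast hl, ?_⟩
  have := congrArg (fun k : ℕ => (k : ZMod v)) e
  simp only [cast_diff hv, ZMod.natCast_val, ZMod.cast_id', id] at this
  simpa using this

/-- Expand base triples under the group generated by negation and the twisted rotation. -/
def cexpand (v : ℕ) (L : List (ℕ × ℕ × ℕ)) : List (ℕ × ℕ × ℕ) :=
  let u := 1 + v / 3
  (0, 0, 0) :: (1, u, u * u % v) :: (v - 1, (v - 1) * u % v, (v - 1) * (u * u) % v) ::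
  L.flatMap fun t =>
    let a := t.1
    let b := u * t.2.1 % v
    let c := u * u * t.2.2 % v
    let w := u * u
    [(a, b, c), (u * c % v, u * a % v, u * b % v), (w * b % v, w * c % v, w * a % v)].flatMap
      fun s => [s, ((v - 1) * s.1 % v, (v - 1) * s.2.1 % v, (v - 1) * s.2.2 % v)]

theorem hasCDM_27 : HasCDM 27 := cchk_sound (by norm_num)
  [(15, 4, 15), (0, 1, 16), (21, 17, 14), (10, 0, 0), (25, 24, 4), (4, 22, 26), (26, 3, 20), (20,
  20, 12), (14, 2, 1), (3, 25, 6), (18, 10, 19), (24, 5, 23), (16, 9, 21), (1, 12, 25), (22, 7,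
  2), (17, 15, 8), (23, 26, 9), (11, 8, 13), (6, 16, 18), (12, 19, 22), (9, 11, 5), (13, 18, 24),
  (19, 6, 7), (7, 13, 11), (8, 21, 17), (5, 14, 3), (2, 23, 10)]
  (by decide +kernel)

theorem hasCDM_81 : HasCDM 81 := cchk_sound (by norm_num) (cexpand 81
  [(60, 61, 25), (48, 43, 24), (13, 27, 72), (71, 52, 55), (63, 50, 70), (30, 62, 14), (41, 37,
  35), (58, 17, 2), (53, 47, 16), (4, 73, 74), (49, 12, 75), (42, 76, 45), (78, 66, 22)])
  (by decide +kernel)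

theorem hasCDM_243 : HasCDM 243 := cchk_sound (by norm_num) (cexpand 243
  [(8, 227, 58), (205, 44, 163), (111, 64, 71), (11, 87, 77), (100, 135, 122), (182, 50, 168),
  (37, 113, 90), (176, 236, 98), (212, 51, 183), (126, 28, 184), (201, 152, 29), (189, 2, 226),
  (53, 162, 14), (97, 48, 124), (228, 12, 62), (219, 66, 46), (125, 139, 22), (238, 218, 129),
  (149, 211, 134), (140, 203, 210), (45, 116, 240), (18, 105, 83), (56, 65, 39), (233, 20, 19),
  (186, 174, 148), (23, 137, 35), (167, 107, 222), (99, 74, 234), (175, 158, 237), (89, 239, 86),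
  (165, 230, 180), (188, 194, 115), (196, 173, 155), (159, 96, 112), (110, 73, 102), (216, 41,
  30), (26, 191, 142), (161, 93, 207), (43, 79, 120), (34, 151, 171)])
  (by decide +kernel)

def kap (r s : ℕ) : ℤ :=
  match r, s with
  | 0, 2 => 1
  | 2, 0 => 1
  | 1, 2 => 2
  | 2, 1 => 2
  | 2, 3 => -2
  | 3, 2 => -2
  | _, _ => 0

def gam (r : ℕ) : ℤ := if r = 2 then 2 else 0

theorem gam_kap (r s : Fin 4) (h : r ≠ s) :
    gam r - gam s = (((r : ℕ) : ℤ) - ((s : ℕ) : ℤ)) * kap r s := by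
  revert r s; decide

theorem sft_main {q m : ℕ} (hq0 : q ≠ 0) (hm0 : m ≠ 0) (hm : Nat.Coprime m 6)
    (hqm : Nat.Coprime q m) (f : ZMod m → ℕ) (e : Fin q → ℤ) (A : ℕ → Fin q → Fin 4 → ZMod q)
    (hloc : ∀ (t : ZMod m) (r s : Fin 4), r ≠ s → Function.Injective fun i =>
      A (f (t - ((kap r s * e i : ℤ) : ZMod m))) i r -
        A (f (t - ((kap r s * e i : ℤ) : ZMod m))) i s) : HasCDM (q * m) := by
  have : NeZero q := ⟨hq0⟩
  have : NeZero m := ⟨hm0⟩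
  have : NeZero (q * m) := ⟨mul_ne_zero hq0 hm0⟩
  refine hasCDM_of_inj (v := q * m) (ι := Fin q × ZMod m) (H := ZMod q × ZMod m)
    (by simp [ZMod.card]) (ZMod.chineseRemainder hqm).symm.toAddEquiv
    (fun r c => (A (f c.2) c.1 r, ((r : ℕ) : ZMod m) * c.2 + ((gam r * e c.1 : ℤ) : ZMod m))) ?_
  rintro r s hrs ⟨i, x⟩ ⟨j, y⟩ h
  simp only [Prod.mk_sub_mk, Prod.mk.injEq] at h
  obtain ⟨h1, h2⟩ := h
  have key : ∀ (z : ZMod m) (k : Fin q),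
      ((r : ℕ) : ZMod m) * z + ((gam r * e k : ℤ) : ZMod m) -
        (((s : ℕ) : ZMod m) * z + ((gam s * e k : ℤ) : ZMod m)) =
      (((r : ℕ) : ZMod m) - ((s : ℕ) : ZMod m)) * (z + ((kap r s * e k : ℤ) : ZMod m)) := by
    intro z k
    have g := congrArg (fun n : ℤ => (n : ZMod m)) (gam_kap r s hrs)
    push_cast at g ⊢
    linear_combination (e k : ZMod m) * g
  rw [key, key] at h2
  have h3 := (unit_diff hm r s hrs).mul_left_cancel h2
  have hx : x = (x + ((kap r s * e i : ℤ) : ZMod m)) - ((kap r s * e i : ℤ) : ZMod m) := by ring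
  have hy : y = (x + ((kap r s * e i : ℤ) : ZMod m)) - ((kap r s * e j : ℤ) : ZMod m) := by
    rw [h3]; ring
  have hij : i = j := by
    apply hloc (x + ((kap r s * e i : ℤ) : ZMod m)) r s hrs
    simp only
    rw [← hx, ← hy]
    exact h1
  subst hij
  rw [hx, hy]

def sA (tbl : List (List (List ℕ))) (l i r : ℕ) : ℕ := ((tbl.getD l []).getD i []).getD r 0

def sdv (q : ℕ) (tbl : List (List (List ℕ))) (e : List ℤ) (w : List ℕ) (r s i : ℕ) : ℕ :=
  let l := w.getD (2 - kap r s * e.getD i 0).toNat 0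
  (sA tbl l i r + (q - 1) * sA tbl l i s) % q

def sgood (q : ℕ) (tbl : List (List (List ℕ))) (e : List ℤ) (w : List ℕ) : Bool :=
  (List.range 4).all fun r => (List.range 4).all fun s =>
    r == s || decide ((List.range q).map (sdv q tbl e w r s)).Nodup

def schk (q : ℕ) (tbl : List (List (List ℕ))) (e : List ℤ) (T : List (ℕ × ℕ)) : Bool :=
  (List.range q).all (fun i => decide (-1 ≤ e.getD i 0) && decide (e.getD i 0 ≤ 1)) &&
  T.all fun a => T.all fun b => a.2 != b.1 || T.all fun c => b.2 != c.1 || T.all fun d =>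
    c.2 != d.1 || sgood q tbl e [a.1, b.1, c.1, d.1, d.2]

theorem kap_bd (r s : Fin 4) : kap r s = 0 ∨ kap r s = 1 ∨ kap r s = 2 ∨ kap r s = -2 := by
  revert r s; decide

theorem sft_chk {q m : ℕ} (hq0 : q ≠ 0) (hm0 : m ≠ 0) (hm : Nat.Coprime m 6)
    (hqm : Nat.Coprime q m) (tbl : List (List (List ℕ))) (e : List ℤ) (T : List (ℕ × ℕ))
    (hc : schk q tbl e T = true) (f : ZMod m → ℕ) (hf : ∀ x, (f x, f (x + 1)) ∈ T) :
    HasCDM (q * m) := by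
  simp only [schk, Bool.and_eq_true, List.all_eq_true, decide_eq_true_eq, Bool.or_eq_true,
    bne_iff_ne, List.mem_range] at hc
  obtain ⟨he, hc⟩ := hc
  refine sft_main hq0 hm0 hm hqm f (fun i => e.getD i 0)
    (fun l i r => ((sA tbl l i r : ℕ) : ZMod q)) ?_
  intro t r s hrs
  have e1 : t - 2 + 1 = t - 1 := by ring
  have e2 : t - 1 + 1 = t := by ring
  have e3 : t + 1 + 1 = t + 2 := by ring
  have c1 := hf (t - 2)
  have c2 := hf (t - 1)
  have c3 := hf t
  have c4 := hf (t + 1)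
  rw [e1] at c1
  rw [e2] at c2
  rw [e3] at c4
  have g := (((hc _ c1 _ c2).resolve_left (by simp) _ c3).resolve_left (by simp) _ c4).resolve_left
    (by simp)
  simp only [sgood, List.all_eq_true, List.mem_range, Bool.or_eq_true, beq_iff_eq,
    decide_eq_true_eq] at g
  have g1 := (g r r.2 s s.2).resolve_left (fun h => hrs (Fin.ext h))
  have g2 := List.inj_on_of_nodup_map g1
  have hw : ∀ i : Fin q,
      [f (t - 2), f (t - 1), f t, f (t + 1), f (t + 2)].getD (2 - kap r s * e.getD i 0).toNat 0
        = f (t - ((kap r s * e.getD i 0 : ℤ) : ZMod m)) := by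
    intro i
    obtain ⟨b1, b2⟩ := he i i.2
    have b3 : e.getD i 0 = -1 ∨ e.getD i 0 = 0 ∨ e.getD i 0 = 1 := by omega
    have b4 : kap r s * e.getD i 0 = -2 ∨ kap r s * e.getD i 0 = -1 ∨ kap r s * e.getD i 0 = 0 ∨
        kap r s * e.getD i 0 = 1 ∨ kap r s * e.getD i 0 = 2 := by
      rcases kap_bd r s with h | h | h | h <;> rcases b3 with h' | h' | h' <;> rw [h, h'] <;> decide
    rcases b4 with h | h | h | h | h <;> rw [h]
    · change f (t + 2) = _
      push_cast; congr 1; ring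
    · change f (t + 1) = _
      push_cast; congr 1; ring
    · change f t = _
      push_cast; congr 1; ring
    · change f (t - 1) = _
      push_cast; congr 1
    · change f (t - 2) = _
      push_cast; congr 1
  intro i j hij
  apply Fin.ext
  refine g2 (List.mem_range.2 i.2) (List.mem_range.2 j.2) ?_
  simp only [sdv]
  rw [hw i, hw j]
  simp only at hij
  rw [← cast_diff (Nat.pos_of_ne_zero hq0), ← cast_diff (Nat.pos_of_ne_zero hq0),
    ZMod.natCast_eq_natCast_iff', Nat.mod_mod, Nat.mod_mod] at hij
  exact hij

def word (k o n : ℕ) : ℕ := if n < k then o + n else (n - k) % 3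

def tr4 : List (ℕ × ℕ) := [(0, 1), (1, 2), (2, 0), (2, 3), (3, 4), (4, 5), (5, 6), (6, 0)]

def tr5 : List (ℕ × ℕ) :=
  [(0, 1), (1, 2), (2, 0), (2, 7), (7, 8), (8, 9), (9, 10), (10, 11), (11, 0), (11, 7)]

theorem word_tr4 (a n : ℕ) (ha : 1 ≤ a) (hn : n < 3 * a + 4) :
    (word 4 3 n, word 4 3 ((n + 1) % (3 * a + 4))) ∈ tr4 := by
  by_cases h : n < 4
  · rw [Nat.mod_eq_of_lt (by omega)]
    interval_cases n <;> decide
  · have h0 : word 4 3 n = (n - 4) % 3 := if_neg h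
    by_cases h1 : n + 1 = 3 * a + 4
    · rw [h1, Nat.mod_self, h0, show (n - 4) % 3 = 2 by omega]; decide
    · rw [Nat.mod_eq_of_lt (by omega), h0, show word 4 3 (n + 1) = (n + 1 - 4) % 3 from
        if_neg (by omega)]
      have h2 : (n - 4) % 3 = 0 ∨ (n - 4) % 3 = 1 ∨ (n - 4) % 3 = 2 := by omega
      rcases h2 with h2 | h2 | h2
      · rw [h2, show (n + 1 - 4) % 3 = 1 by omega]; decide
      · rw [h2, show (n + 1 - 4) % 3 = 2 by omega]; decide
      · rw [h2, show (n + 1 - 4) % 3 = 0 by omega]; decide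

theorem word_tr5 (a n : ℕ) (hn : n < 3 * a + 5) :
    (word 5 7 n, word 5 7 ((n + 1) % (3 * a + 5))) ∈ tr5 := by
  by_cases h : n < 5
  · by_cases h1 : n + 1 = 3 * a + 5
    · rw [h1, Nat.mod_self, show n = 4 by omega]; decide
    rw [Nat.mod_eq_of_lt (by omega)]
    interval_cases n <;> decide
  · have h0 : word 5 7 n = (n - 5) % 3 := if_neg h
    by_cases h1 : n + 1 = 3 * a + 5
    · rw [h1, Nat.mod_self, h0, show (n - 5) % 3 = 2 by omega]; decide
    · rw [Nat.mod_eq_of_lt (by omega), h0, show word 5 7 (n + 1) = (n + 1 - 5) % 3 from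
        if_neg (by omega)]
      have h2 : (n - 5) % 3 = 0 ∨ (n - 5) % 3 = 1 ∨ (n - 5) % 3 = 2 := by omega
      rcases h2 with h2 | h2 | h2
      · rw [h2, show (n + 1 - 5) % 3 = 1 by omega]; decide
      · rw [h2, show (n + 1 - 5) % 3 = 2 by omega]; decide
      · rw [h2, show (n + 1 - 5) % 3 = 0 by omega]; decide

theorem sft_all {q m : ℕ} (hq0 : q ≠ 0) (hm5 : 5 ≤ m) (hm : Nat.Coprime m 6)
    (hqm : Nat.Coprime q m) (tbl : List (List (List ℕ))) (e : List ℤ)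
    (hc4 : schk q tbl e tr4 = true) (hc5 : schk q tbl e tr5 = true) : HasCDM (q * m) := by
  have : NeZero m := ⟨by omega⟩
  have : Fact (1 < m) := ⟨by omega⟩
  have h3 : m % 3 ≠ 0 := by
    intro h
    have := Nat.dvd_gcd (Nat.dvd_of_mod_eq_zero h) (show 3 ∣ 6 by norm_num)
    rw [hm] at this
    omega
  have h2 : m % 2 ≠ 0 := by
    intro h
    have := Nat.dvd_gcd (Nat.dvd_of_mod_eq_zero h) (show 2 ∣ 6 by norm_num)
    rw [hm] at this
    omega
  rcases (by omega : m % 3 = 1 ∨ m % 3 = 2) with h | h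
  · refine sft_chk hq0 (by omega) hm hqm tbl e tr4 hc4 (fun x => word 4 3 x.val) fun x => ?_
    have := word_tr4 ((m - 4) / 3) x.val (by omega) (by have := x.val_lt; omega)
    rw [show 3 * ((m - 4) / 3) + 4 = m by omega] at this
    rw [ZMod.val_add, ZMod.val_one]
    exact this
  · refine sft_chk hq0 (by omega) hm hqm tbl e tr5 hc5 (fun x => word 5 7 x.val) fun x => ?_
    have := word_tr5 ((m - 5) / 3) x.val (by have := x.val_lt; omega)
    rw [show 3 * ((m - 5) / 3) + 5 = m by omega] at this
    rw [ZMod.val_add, ZMod.val_one]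
    exact this

def tbl3 : List (List (List ℕ)) :=
  [[[0, 0, 0, 0], [0, 1, 0, 2], [0, 2, 0, 1]], [[0, 0, 1, 0], [0, 1, 1, 2], [0, 2, 1, 1]], [[0,
  0, 2, 0], [0, 1, 2, 2], [0, 2, 2, 1]], [[0, 0, 1, 0], [0, 1, 0, 2], [0, 2, 0, 1]], [[0, 2, 1,
  2], [0, 0, 0, 1], [0, 1, 0, 0]], [[0, 1, 1, 1], [0, 2, 2, 0], [0, 0, 2, 2]], [[0, 0, 1, 0], [0,
  1, 2, 2], [0, 2, 2, 1]], [[0, 0, 1, 1], [0, 1, 0, 0], [0, 2, 1, 2]], [[0, 2, 0, 1], [0, 0, 0,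
  0], [0, 1, 2, 2]], [[0, 1, 1, 2], [0, 2, 2, 1], [0, 0, 1, 0]], [[0, 0, 0, 2], [0, 1, 0, 1], [0,
  2, 1, 0]], [[0, 0, 2, 0], [0, 1, 2, 2], [0, 2, 2, 1]]]

def tbl9 : List (List (List ℕ)) :=
  [[[0, 3, 4, 8], [0, 6, 5, 0], [0, 0, 5, 4], [0, 1, 0, 2], [0, 4, 1, 6], [0, 7, 7, 7], [0, 5, 3,
  3], [0, 2, 6, 1], [0, 8, 2, 5]], [[0, 3, 1, 8], [0, 0, 2, 3], [0, 6, 8, 7], [0, 4, 0, 2], [0,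
  1, 4, 0], [0, 7, 7, 4], [0, 2, 0, 6], [0, 8, 3, 1], [0, 5, 2, 5]], [[0, 3, 4, 2], [0, 0, 8, 0],
  [0, 6, 8, 1], [0, 7, 3, 8], [0, 4, 7, 6], [0, 1, 1, 4], [0, 5, 6, 3], [0, 2, 6, 7], [0, 8, 5,
  5]], [[0, 0, 4, 5], [0, 3, 5, 0], [0, 6, 5, 7], [0, 7, 3, 2], [0, 4, 7, 3], [0, 1, 1, 1], [0,
  8, 6, 6], [0, 2, 6, 4], [0, 5, 2, 8]], [[0, 3, 1, 8], [0, 0, 8, 0], [0, 6, 8, 7], [0, 7, 3, 5],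
  [0, 1, 7, 3], [0, 4, 4, 1], [0, 2, 0, 6], [0, 5, 0, 4], [0, 8, 2, 2]], [[0, 0, 1, 2], [0, 3, 5,
  0], [0, 6, 5, 1], [0, 1, 6, 8], [0, 7, 4, 3], [0, 4, 7, 4], [0, 5, 3, 6], [0, 8, 0, 7], [0, 2,
  2, 5]], [[0, 6, 7, 5], [0, 0, 8, 3], [0, 3, 8, 1], [0, 7, 0, 8], [0, 4, 1, 6], [0, 1, 4, 7],
  [0, 5, 6, 0], [0, 8, 3, 4], [0, 2, 2, 2]], [[0, 3, 7, 8], [0, 0, 5, 0], [0, 6, 2, 1], [0, 1, 0,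
  2], [0, 7, 1, 6], [0, 4, 4, 7], [0, 5, 3, 3], [0, 2, 6, 4], [0, 8, 5, 5]], [[0, 3, 1, 5], [0,
  0, 5, 6], [0, 6, 2, 7], [0, 7, 0, 2], [0, 4, 4, 3], [0, 1, 7, 1], [0, 2, 3, 0], [0, 8, 3, 4],
  [0, 5, 8, 8]], [[0, 0, 4, 8], [0, 6, 5, 0], [0, 3, 2, 4], [0, 7, 0, 5], [0, 4, 7, 6], [0, 1, 1,
  7], [0, 8, 6, 3], [0, 5, 6, 1], [0, 2, 8, 2]], [[0, 6, 4, 2], [0, 3, 5, 3], [0, 0, 8, 1], [0,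
  1, 3, 8], [0, 7, 7, 6], [0, 4, 1, 7], [0, 5, 3, 0], [0, 2, 6, 4], [0, 8, 2, 5]], [[0, 3, 4, 2],
  [0, 0, 8, 0], [0, 6, 8, 4], [0, 4, 0, 8], [0, 7, 1, 3], [0, 1, 7, 7], [0, 5, 6, 6], [0, 8, 0,
  1], [0, 2, 2, 5]]]

theorem hasCDM_3 {m : ℕ} (hm5 : 5 ≤ m) (hm : Nat.Coprime m 6) : HasCDM (3 * m) :=
  sft_all (by norm_num) hm5 hm ((hm.coprime_dvd_right (by norm_num)).symm) tbl3 [0, -1, 1]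
    (by decide +kernel) (by decide +kernel)

theorem hasCDM_9 {m : ℕ} (hm5 : 5 ≤ m) (hm : Nat.Coprime m 6) : HasCDM (9 * m) :=
  sft_all (by norm_num) hm5 hm
    (Nat.Coprime.pow_left 2 (m := 3) ((hm.coprime_dvd_right (by norm_num)).symm)) tbl9
    [0, 1, 0, 0, 0, 0, 1, -1, 0]
    (by decide +kernel) (by decide +kernel)

def srch {α : Type} (B : α → ℕ → ℕ) (v : ℕ) (k : List ℕ → Bool) : List α → ℕ → List ℕ → Bool
  | [], _, acc => k acc
  | a :: P, m, acc => (List.range v).any fun f =>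
      (m &&& B a f) == 0 && srch B v k P (m ||| B a f) (f :: acc)

def force (n : ℕ) (F : ℕ → Bool) : Bool :=
  match n with
  | 0 => F 0
  | p + 1 => F (Nat.succ p)

def forceL : List ℕ → (List ℕ → Bool) → Bool
  | [], F => F []
  | a :: l, F => force a fun b => forceL l fun l' => F (b :: l')

def forceLL : List (List ℕ) → (List (List ℕ) → Bool) → Bool
  | [], F => F []
  | a :: l, F => forceL a fun b => forceLL l fun l' => F (b :: l')

noncomputable def srch2 (L : List (List ℕ)) : ℕ → Bool :=
  @List.rec (List ℕ) (fun _ => ℕ → Bool) (fun _ => true) (fun C _ rec m =>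
    @List.rec ℕ (fun _ => Bool) false (fun b _ r =>
      @Bool.rec (fun _ => Bool) r (@Bool.rec (fun _ => Bool) r true (rec (Nat.lor m b)))
        (Nat.beq (Nat.land m b) 0)) C) L

def bb1 (v x f : ℕ) : ℕ := 2 ^ f ||| 2 ^ (v + (f + (v - 1) * x) % v)

def bb2 (v : ℕ) (p : ℕ × ℕ) (f : ℕ) : ℕ := bb1 v p.1 f ||| 2 ^ (v + v + (f + (v - 1) * p.2) % v)

def posl (v : ℕ) : List ℕ := (List.range (v - 1)).map (· + 1)

def cands (v : ℕ) (p : ℕ × ℕ) : List ℕ :=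
  ((List.range v).map (bb2 v p)).filter fun b => Nat.beq (Nat.land (bb2 v (0, 0) 0) b) 0

noncomputable def full (v : ℕ) : Bool :=
  srch (bb1 v) v (fun acc => forceL acc fun acc =>
    forceLL ((List.zip (posl v).reverse acc).map (cands v)) fun L => srch2 L (bb2 v (0, 0) 0))
    (posl v) (bb1 v 0 0) []

theorem full_3 : full 3 = false := by decide +kernel
theorem full_9 : full 9 = false := by decide +kernel

theorem force_eq (n : ℕ) (F : ℕ → Bool) : force n F = F n := by
  cases n <;> rfl

theorem forceL_eq (l : List ℕ) (F : List ℕ → Bool) : forceL l F = F l := by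
  induction l generalizing F with
  | nil => rfl
  | cons a l ih => rw [forceL, force_eq, ih]

theorem forceLL_eq (l : List (List ℕ)) (F : List (List ℕ) → Bool) : forceLL l F = F l := by
  induction l generalizing F with
  | nil => rfl
  | cons a l ih => rw [forceLL, forceL_eq, ih]

theorem or_and_zero {m b c : ℕ} (h1 : m &&& c = 0) (h2 : b &&& c = 0) : (m ||| b) &&& c = 0 := by
  rw [Nat.and_or_distrib_right, h1, h2]; rfl

theorem srch_sound {α : Type} (B : α → ℕ → ℕ) (v : ℕ) (k : List ℕ → Bool) (g : α → ℕ)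
    (P : List α) (m : ℕ) (acc : List ℕ) (hg : ∀ a ∈ P, g a < v)
    (hp : P.Pairwise fun a b => B a (g a) &&& B b (g b) = 0)
    (hm : ∀ a ∈ P, m &&& B a (g a) = 0) (hk : k ((P.map g).reverse ++ acc) = true) :
    srch B v k P m acc = true := by
  induction P generalizing m acc with
  | nil => simpa [srch] using hk
  | cons a P ih =>
    rw [srch, List.any_eq_true]
    refine ⟨g a, List.mem_range.2 (hg a (by simp)), ?_⟩
    rw [Bool.and_eq_true, beq_iff_eq]
    rw [List.pairwise_cons] at hp
    refine ⟨hm a (by simp), ih _ _ (fun b hb => hg b (by simp [hb])) hp.2 ?_ ?_⟩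
    · intro b hb
      exact or_and_zero (hm b (by simp [hb])) (hp.1 b hb)
    · simpa using hk

theorem srch2_cons (C : List ℕ) (L : List (List ℕ)) (m : ℕ) (b : ℕ) (hb : b ∈ C)
    (h0 : m &&& b = 0) (h : srch2 L (m ||| b) = true) : srch2 (C :: L) m = true := by
  induction C with
  | nil => simp at hb
  | cons c C ih =>
    have e : srch2 ((c :: C) :: L) m =
      @Bool.rec (fun _ => Bool) (srch2 (C :: L) m)
        (@Bool.rec (fun _ => Bool) (srch2 (C :: L) m) true (srch2 L (m ||| c)))
        (Nat.beq (m &&& c) 0) := rfl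
    rw [e]
    rcases List.mem_cons.1 hb with rfl | hb
    · rw [h0, h]; rfl
    · rw [ih hb]
      cases (m &&& c).beq 0 <;> cases srch2 L (m ||| c) <;> rfl

theorem srch2_sound {α : Type} (C : α → List ℕ) (g : α → ℕ)
    (P : List α) (m : ℕ) (hg : ∀ a ∈ P, g a ∈ C a)
    (hp : P.Pairwise fun a b => g a &&& g b = 0)
    (hm : ∀ a ∈ P, m &&& g a = 0) : srch2 (P.map C) m = true := by
  induction P generalizing m with
  | nil => rfl
  | cons a P ih =>
    rw [List.pairwise_cons] at hp
    refine srch2_cons _ _ _ (g a) (hg a (by simp)) (hm a (by simp)) ?_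
    refine ih _ (fun b hb => hg b (by simp [hb])) hp.2 ?_
    intro b hb
    exact or_and_zero (hm b (by simp [hb])) (hp.1 b hb)

theorem bb1_disj {v x y f g : ℕ} (hv : 0 < v) (hf : f < v) (hg : g < v) (h1 : f ≠ g)
    (h2 : (f + (v - 1) * x) % v ≠ (g + (v - 1) * y) % v) : bb1 v x f &&& bb1 v y g = 0 := by
  apply Nat.eq_of_testBit_eq
  intro n
  have := Nat.mod_lt (f + (v - 1) * x) hv
  have := Nat.mod_lt (g + (v - 1) * y) hv
  simp only [bb1, Nat.testBit_and, Nat.testBit_or, Nat.testBit_two_pow, Nat.zero_testBit]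
  rw [Bool.eq_false_iff]
  simp only [ne_eq, Bool.and_eq_true, Bool.or_eq_true, decide_eq_true_eq]
  generalize (f + (v - 1) * x) % v = A at *
  generalize (g + (v - 1) * y) % v = C at *
  omega

theorem bb2_disj {v f g : ℕ} {p r : ℕ × ℕ} (hv : 0 < v) (hf : f < v) (hg : g < v) (h1 : f ≠ g)
    (h2 : (f + (v - 1) * p.1) % v ≠ (g + (v - 1) * r.1) % v)
    (h3 : (f + (v - 1) * p.2) % v ≠ (g + (v - 1) * r.2) % v) : bb2 v p f &&& bb2 v r g = 0 := by
  apply Nat.eq_of_testBit_eq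
  intro n
  have := Nat.mod_lt (f + (v - 1) * p.1) hv
  have := Nat.mod_lt (g + (v - 1) * r.1) hv
  have := Nat.mod_lt (f + (v - 1) * p.2) hv
  have := Nat.mod_lt (g + (v - 1) * r.2) hv
  simp only [bb2, bb1, Nat.testBit_and, Nat.testBit_or, Nat.testBit_two_pow, Nat.zero_testBit]
  rw [Bool.eq_false_iff]
  simp only [ne_eq, Bool.and_eq_true, Bool.or_eq_true, decide_eq_true_eq]
  generalize (f + (v - 1) * p.1) % v = A at *
  generalize (g + (v - 1) * r.1) % v = C at *
  generalize (f + (v - 1) * p.2) % v = A' at *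
  generalize (g + (v - 1) * r.2) % v = C' at *
  omega

theorem full_of_nat {v : ℕ} (hv : 0 < v) (t p : ℕ → ℕ) (ht : ∀ x, t x < v) (hp : ∀ x, p x < v)
    (t0 : t 0 = 0) (p0 : p 0 = 0)
    (h : ∀ x y, x < v → y < v → x ≠ y → t x ≠ t y ∧ p x ≠ p y ∧
      (t x + (v - 1) * x) % v ≠ (t y + (v - 1) * y) % v ∧
      (p x + (v - 1) * x) % v ≠ (p y + (v - 1) * y) % v ∧
      (p x + (v - 1) * t x) % v ≠ (p y + (v - 1) * t y) % v) : full v = true := by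
  have hmem : ∀ x ∈ posl v, x ≠ 0 ∧ x < v := by
    intro x hx
    simp only [posl, List.mem_map, List.mem_range] at hx
    omega
  have hnd : (posl v).Nodup :=
    List.Nodup.map (fun a b h => by simpa using h) List.nodup_range
  rw [full]
  refine srch_sound _ _ _ t _ _ _ (fun a _ => ht a) ?_ ?_ ?_
  · refine List.Pairwise.imp_of_mem ?_ hnd
    intro a b ha hb hab
    have := h a b (hmem a ha).2 (hmem b hb).2 hab
    exact bb1_disj hv (ht a) (ht b) this.1 this.2.2.1
  · intro a ha
    have := h 0 a hv (hmem a ha).2 (hmem a ha).1.symm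
    have q := bb1_disj hv (ht 0) (ht a) this.1 this.2.2.1
    rwa [t0] at q
  · rw [forceL_eq, forceLL_eq, List.append_nil, ← List.map_reverse]
    have e : List.zip (posl v).reverse (List.map t (posl v).reverse) =
        (posl v).reverse.map fun x => (x, t x) := by
      have := List.zip_map' (f := fun x : ℕ => x) (g := t) (l := (posl v).reverse)
      simpa using this
    rw [e, List.map_map]
    have hz : ∀ a ∈ (posl v).reverse, bb2 v (0, 0) 0 &&& bb2 v (a, t a) (p a) = 0 := by
      intro a ha
      rw [List.mem_reverse] at ha
      have := h 0 a hv (hmem a ha).2 (hmem a ha).1.symm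
      have q := bb2_disj (p := (0, t 0)) (r := (a, t a)) hv (hp 0) (hp a) this.2.1
        this.2.2.2.1 this.2.2.2.2
      rwa [t0, p0] at q
    refine srch2_sound _ (fun x => bb2 v (x, t x) (p x)) _ _ ?_ ?_ hz
    · intro a ha
      simp only [Function.comp, cands, List.mem_filter, List.mem_map, List.mem_range]
      refine ⟨⟨p a, hp a, rfl⟩, ?_⟩
      have q : (bb2 v (0, 0) 0).land (bb2 v (a, t a) (p a)) = 0 := hz a ha
      rw [q]; rfl
    · refine List.Pairwise.imp_of_mem ?_ (List.nodup_reverse.2 hnd)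
      intro a b ha hb hab
      rw [List.mem_reverse] at ha hb
      have := h a b (hmem a ha).2 (hmem b hb).2 hab
      exact bb2_disj hv (hp a) (hp b) this.2.1 this.2.2.2.1 this.2.2.2.2

theorem full_of_hasCDM {v : ℕ} (hv : 0 < v) (hc : HasCDM v) : full v = true := by
  obtain ⟨D, hD⟩ := hc
  have : NeZero v := ⟨hv.ne'⟩
  let E := Equiv.ofBijective _ (hD 1 0 (by decide))
  let th : ZMod v → ZMod v := fun x => D 2 (E.symm x) - D 0 (E.symm x)
  let ph : ZMod v → ZMod v := fun x => D 3 (E.symm x) - D 0 (E.symm x)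
  have hE : ∀ x, x = D 1 (E.symm x) - D 0 (E.symm x) := fun x => (E.apply_symm_apply x).symm
  have inj : ∀ r s : Fin 4, r ≠ s → ∀ x y : ZMod v,
      D r (E.symm x) - D s (E.symm x) = D r (E.symm y) - D s (E.symm y) → x = y :=
    fun r s hrs x y h => E.symm.injective ((hD r s hrs).1 h)
  have key : ∀ (a b : ZMod v), ((a.val + (v - 1) * b.val) % v : ℕ) = (a - b).val := by
    intro a b
    have := cast_diff hv a.val b.val
    simp only [ZMod.natCast_val, ZMod.cast_id', id] at this
    rw [← this, ZMod.val_natCast, Nat.mod_mod]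
  refine full_of_nat hv (fun n => (th n - th 0).val) (fun n => (ph n - ph 0).val)
    (fun _ => ZMod.val_lt _) (fun _ => ZMod.val_lt _) (by simp) (by simp) ?_
  intro x y hx hy hxy
  have hne : (x : ZMod v) ≠ (y : ZMod v) := by
    intro e
    rw [ZMod.natCast_eq_natCast_iff', Nat.mod_eq_of_lt hx, Nat.mod_eq_of_lt hy] at e
    exact hxy e
  have vx : (x : ZMod v).val = x := ZMod.val_cast_of_lt hx
  have vy : (y : ZMod v).val = y := ZMod.val_cast_of_lt hy
  have k1 := key (th x - th 0) x
  have k2 := key (th y - th 0) y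
  have k3 := key (ph x - ph 0) x
  have k4 := key (ph y - ph 0) y
  rw [vx] at k1 k3
  rw [vy] at k2 k4
  simp only [k1, k2, k3, k4, key]
  have ex := hE x
  have ey := hE y
  refine ⟨fun e => hne ?_, fun e => hne ?_, fun e => hne ?_, fun e => hne ?_, fun e => hne ?_⟩ <;>
    have e := ZMod.val_injective v e
  · exact inj 2 0 (by decide) _ _ (by linear_combination e)
  · exact inj 3 0 (by decide) _ _ (by linear_combination e)
  · exact inj 2 1 (by decide) _ _ (by linear_combination e + ex - ey)
  · exact inj 3 1 (by decide) _ _ (by linear_combination e + ex - ey)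
  · exact inj 3 2 (by decide) _ _ (by linear_combination e)

theorem hasCDM_pow (n : ℕ) : HasCDM (3 ^ (n + 3)) := by
  induction n using Nat.strong_induction_on with
  | _ n ih =>
    match n, ih with
    | 0, _ => exact hasCDM_27
    | 1, _ => exact hasCDM_81
    | 2, _ => exact hasCDM_243
    | k + 3, ih =>
      have h := hasCDM_mul (ih k (by omega)) hasCDM_27 (by positivity) (by norm_num)
      rwa [show 3 ^ (k + 3) * 27 = 3 ^ (k + 3 + 3) by rw [pow_add 3 (k + 3) 3]; norm_num] at h

theorem coprime_six {m : ℕ} (h2 : m % 2 = 1) (h3 : ¬ 3 ∣ m) : Nat.Coprime m 6 := by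
  have a : Nat.Coprime 2 m := (Nat.coprime_two_left).2 (Nat.odd_iff.2 h2)
  have b : Nat.Coprime 3 m := (Nat.Prime.coprime_iff_not_dvd Nat.prime_three).2 h3
  exact (Nat.Coprime.mul_left a b).symm

theorem suff {v : ℕ} (ho : Odd v) (h5 : 5 ≤ v) (h9 : v ≠ 9) : HasCDM v := by
  obtain ⟨a, m, hm, rfl⟩ := Nat.exists_eq_pow_mul_and_not_dvd (show v ≠ 0 by omega) 3 (by norm_num)
  have mo : m % 2 = 1 := Nat.odd_iff.1 (Nat.odd_mul.1 ho).2
  have c := coprime_six mo hm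
  have m0 : m ≠ 0 := by omega
  match a with
  | 0 => simpa using hasCDM_coprime m0 c
  | 1 =>
    rw [pow_one] at *
    exact hasCDM_3 (by omega) c
  | 2 =>
    norm_num at *
    exact hasCDM_9 (by omega) c
  | k + 3 => exact hasCDM_mul (hasCDM_pow k) (hasCDM_coprime m0 c) (by positivity) m0

theorem stmt_12 (v : ℕ) (hv : 2 ≤ v) :
    (∃ D : Fin 4 → Fin v → ZMod v, IsCDM v 4 D) ↔ (Odd v ∧ 5 ≤ v ∧ v ≠ 9) := by
  constructor
  · intro h
    have h : HasCDM v := h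
    have ho : Odd v := by
      by_contra hn
      exact not_even hv (Nat.not_odd_iff_even.1 hn) h
    have h3 : v ≠ 3 := by
      rintro rfl
      have := full_of_hasCDM (by norm_num) h
      rw [full_3] at this
      exact absurd this (by decide)
    have h9 : v ≠ 9 := by
      rintro rfl
      have := full_of_hasCDM (by norm_num) h
      rw [full_9] at this
      exact absurd this (by decide)
    have := Nat.odd_iff.1 ho
    exact ⟨ho, by omega, h9⟩
  · rintro ⟨ho, h5, h9⟩
    exact suff ho h5 h9
end

section
/- There exists a 1-rotational S(2,4,v) if and only if v ≡ 4 (mod 12) and v ≠ 28. -/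
/-- A 1-rotational `S(2,4,v)`: a Steiner system on the point set
`Z_{v-1} ∪ {∞}` (encoded as `Option (ZMod (v-1))`, with `none = ∞`) whose block
set is invariant under the permutation fixing `∞` and mapping `i ↦ i + 1` on
`Z_{v-1}`. -/
def IsOneRotationalS24 (v : ℕ) (𝓑 : Set (Finset (Option (ZMod (v - 1))))) : Prop :=
  (∀ B ∈ 𝓑, B.card = 4) ∧
  (∀ x y : Option (ZMod (v - 1)), x ≠ y →
    ∃! B : Finset (Option (ZMod (v - 1))), B ∈ 𝓑 ∧ x ∈ B ∧ y ∈ B) ∧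
  (∀ B ∈ 𝓑, B.image (Option.map (· + (1 : ZMod (v - 1)))) ∈ 𝓑)

namespace OneRot

/-- Translate of the short block through `∞`. -/
def shortB {n : ℕ} (u c : ZMod n) : Finset (Option (ZMod n)) :=
  {none, some c, some (c + u), some (c + 2 * u)}

/-- Translate of a long base block. -/
def longB {n : ℕ} (b : Fin 4 → ZMod n) (c : ZMod n) : Finset (Option (ZMod n)) :=
  Finset.univ.image (fun p => some (b p + c))

lemma mem_longB {n : ℕ} (b : Fin 4 → ZMod n) (c x : ZMod n) :
    some x ∈ longB b c ↔ ∃ p, b p + c = x := by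
  simp [longB]

lemma none_longB {n : ℕ} (b : Fin 4 → ZMod n) (c : ZMod n) : none ∉ longB b c := by
  simp [longB]

lemma mem_shortB {n : ℕ} (u c x : ZMod n) :
    some x ∈ shortB u c ↔ x = c ∨ x = c + u ∨ x = c + 2 * u := by
  simp [shortB]

lemma shortB_eq {n : ℕ} {u c x : ZMod n} (h3 : 3 * u = 0) (h : some x ∈ shortB u c) :
    shortB u c = shortB u x := by
  rw [mem_shortB] at h
  ext z
  cases z with
  | none => simp [shortB]
  | some z =>
    rw [mem_shortB, mem_shortB]
    rcases h with rfl | rfl | rfl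
    · rfl
    · have e1 : c + u + 2 * u = c := by linear_combination h3
      have e2 : c + u + u = c + 2 * u := by ring
      rw [e1, e2]; tauto
    · have e1 : c + 2 * u + 2 * u = c + u := by linear_combination h3
      have e2 : c + 2 * u + u = c := by linear_combination h3
      rw [e1, e2]; tauto

lemma build {n t : ℕ} (hn : n = 12 * t + 3) {ι : Type} [Fintype ι] (hι : Fintype.card ι = t)
    (u : ZMod n) (hu : u = ((4 * t + 1 : ℕ) : ZMod n))
    (b : ι → Fin 4 → ZMod n)
    (hc : ∀ d : ZMod n, d ≠ 0 → d ≠ u → d ≠ 2 * u → ∃ i p q, p ≠ q ∧ b i p - b i q = d) :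
    ∃ 𝓑 : Set (Finset (Option (ZMod n))),
      (∀ B ∈ 𝓑, B.card = 4) ∧
      (∀ x y : Option (ZMod n), x ≠ y → ∃! B, B ∈ 𝓑 ∧ x ∈ B ∧ y ∈ B) ∧
      (∀ B ∈ 𝓑, B.image (Option.map (· + (1 : ZMod n))) ∈ 𝓑) := by
  classical
  have : NeZero n := ⟨by omega⟩
  have h3 : 3 * u = 0 := by
    rw [hu]
    have : ((n : ℕ) : ZMod n) = 0 := ZMod.natCast_self n
    rw [← this, hn]; push_cast; ring
  have hu0 : u ≠ 0 := by
    rw [hu, Ne, ZMod.natCast_eq_zero_iff]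
    intro h; have := Nat.le_of_dvd (by omega) h; omega
  have hu2 : 2 * u ≠ 0 := by
    intro h; apply hu0; linear_combination h3 - h
  have huu : u ≠ 2 * u := by
    intro h; apply hu0; linear_combination -h
  let Q := {pq : Fin 4 × Fin 4 // pq.1 ≠ pq.2}
  let φ : ι × Q → ZMod n := fun x => b x.1 x.2.1.1 - b x.1 x.2.1.2
  let S : Finset (ZMod n) := Finset.univ \ {0, u, 2 * u}
  have hS : S.card = 12 * t := by
    rw [Finset.card_sdiff_of_subset (Finset.subset_univ _), Finset.card_univ, ZMod.card,
      Finset.card_insert_of_notMem, Finset.card_pair huu, hn]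
    · omega
    · simp [hu0.symm, hu2.symm]
  have hQ : Fintype.card (ι × Q) = 12 * t := by
    rw [Fintype.card_prod, hι]
    have : Fintype.card Q = 12 := by decide
    rw [this]; ring
  have hsub : S ⊆ Finset.univ.image φ := by
    intro d hd
    simp only [S, Finset.mem_sdiff, Finset.mem_univ, true_and, Finset.mem_insert,
      Finset.mem_singleton, not_or] at hd
    obtain ⟨i, p, q, hpq, h⟩ := hc d hd.1 hd.2.1 hd.2.2
    exact Finset.mem_image.2 ⟨(i, ⟨(p, q), hpq⟩), Finset.mem_univ _, h⟩
  have hle : (Finset.univ.image φ).card ≤ 12 * t := by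
    rw [← hQ, ← Finset.card_univ]; exact Finset.card_image_le
  have hSe : S = Finset.univ.image φ := Finset.eq_of_subset_of_card_le hsub (by rw [hS]; exact hle)
  have hinj : Function.Injective φ := by
    have : (Finset.univ.image φ).card = (Finset.univ : Finset (ι × Q)).card := by
      rw [← hSe, hS, Finset.card_univ, hQ]
    have h := Finset.card_image_iff.1 this
    intro x y hxy
    exact h (by simp) (by simp) hxy
  have hne : ∀ i p q, p ≠ q → b i p - b i q ≠ 0 ∧ b i p - b i q ≠ u ∧ b i p - b i q ≠ 2 * u := by
    intro i p q hpq
    have : φ (i, ⟨(p, q), hpq⟩) ∈ S := by rw [hSe]; exact Finset.mem_image_of_mem _ (Finset.mem_univ _)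
    simpa [S, φ] using this
  have huni : ∀ i p q i' p' q', p ≠ q → p' ≠ q' → b i p - b i q = b i' p' - b i' q' →
      i = i' ∧ q = q' := by
    intro i p q i' p' q' h h' e
    have := @hinj (i, ⟨(p, q), h⟩) (i', ⟨(p', q'), h'⟩) e
    have h2 := congrArg (fun z : ι × Q => z.2.1.2) this
    exact ⟨congrArg Prod.fst this, h2⟩
  have hbinj : ∀ i, Function.Injective (b i) := by
    intro i p q h
    by_contra hpq
    exact (hne i p q hpq).1 (sub_eq_zero.2 h)
  let 𝓑 : Set (Finset (Option (ZMod n))) :=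
    {B | (∃ i c, B = longB (b i) c) ∨ ∃ c, B = shortB u c}
  have hshort : ∀ x, ∀ B ∈ 𝓑, none ∈ B → some x ∈ B → B = shortB u x := by
    rintro x B (⟨i, c, rfl⟩ | ⟨c, rfl⟩) h1 h2
    · exact absurd h1 (none_longB _ _)
    · exact shortB_eq h3 h2
  have hself : ∀ x, some x ∈ shortB u x := fun x => by simp [shortB]
  have hnone : ∀ x, none ∈ shortB u x := fun x => by simp [shortB]
  refine ⟨𝓑, ?_, ?_, ?_⟩
  · rintro B (⟨i, c, rfl⟩ | ⟨c, rfl⟩)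
    · rw [longB, Finset.card_image_of_injective]
      · simp
      · intro p q h
        exact hbinj i (by simpa using h)
    · have e1 : c ≠ c + u := by
        intro h; apply hu0; linear_combination -h
      have e2 : c ≠ c + 2 * u := by
        intro h; apply hu2; linear_combination -h
      have e3 : c + u ≠ c + 2 * u := by simpa using huu
      rw [shortB, Finset.card_insert_of_notMem (by simp), Finset.card_insert_of_notMem,
        Finset.card_pair]
      · simpa using huu
      · simp only [Finset.mem_insert, Finset.mem_singleton, Option.some.injEq, not_or]
        exact ⟨e1, e2⟩
  · intro x y hxy
    match x, y, hxy with
    | none, none, h => exact absurd rfl h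
    | none, some y, _ =>
      exact ⟨shortB u y, ⟨Or.inr ⟨y, rfl⟩, hnone y, hself y⟩,
        fun B hB => hshort y B hB.1 hB.2.1 hB.2.2⟩
    | some x, none, _ =>
      exact ⟨shortB u x, ⟨Or.inr ⟨x, rfl⟩, hself x, hnone x⟩,
        fun B hB => hshort x B hB.1 hB.2.2 hB.2.1⟩
    | some x, some y, h =>
      have hxy : x - y ≠ 0 := by
        intro h'; exact h (by rw [sub_eq_zero.1 h'])
      by_cases hd : x - y = u ∨ x - y = 2 * u
      · refine ⟨shortB u y, ⟨Or.inr ⟨y, rfl⟩, ?_, hself y⟩, ?_⟩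
        · rw [mem_shortB]
          rcases hd with hd | hd
          · right; left; linear_combination hd
          · right; right; linear_combination hd
        · rintro B ⟨(⟨i, c, rfl⟩ | ⟨c, rfl⟩), h1, h2⟩
          · exfalso
            obtain ⟨p, hp⟩ := (mem_longB _ _ _).1 h1
            obtain ⟨q, hq⟩ := (mem_longB _ _ _).1 h2
            have e : b i p - b i q = x - y := by linear_combination hp - hq
            have hpq : p ≠ q := by
              rintro rfl; apply hxy; rw [← e]; ring
            have := hne i p q hpq
            rw [e] at this; tauto
          · exact shortB_eq h3 h2
      · rw [not_or] at hd
        obtain ⟨i, p, q, hpq, e⟩ := hc (x - y) hxy hd.1 hd.2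
        refine ⟨longB (b i) (y - b i q), ⟨Or.inl ⟨i, _, rfl⟩, ?_, ?_⟩, ?_⟩
        · rw [mem_longB]; exact ⟨p, by linear_combination e⟩
        · rw [mem_longB]; exact ⟨q, by ring⟩
        · rintro B ⟨(⟨i', c, rfl⟩ | ⟨c, rfl⟩), h1, h2⟩
          · obtain ⟨p', hp⟩ := (mem_longB _ _ _).1 h1
            obtain ⟨q', hq⟩ := (mem_longB _ _ _).1 h2
            have e' : b i' p' - b i' q' = x - y := by linear_combination hp - hq
            have hpq' : p' ≠ q' := by
              rintro rfl; apply hxy; rw [← e']; ring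
            obtain ⟨rfl, rfl⟩ := huni i p q i' p' q' hpq hpq' (e.trans e'.symm)
            congr 1
            linear_combination hq
          · exfalso
            rw [shortB_eq h3 h2, mem_shortB] at h1
            rcases h1 with h1 | h1 | h1
            · exact hxy (by rw [h1]; ring)
            · exact hd.1 (by rw [h1]; ring)
            · exact hd.2 (by rw [h1]; ring)
  · rintro B (⟨i, c, rfl⟩ | ⟨c, rfl⟩)
    · left
      refine ⟨i, c + 1, ?_⟩
      rw [longB, longB, Finset.image_image]
      congr 1
      funext p
      simp [add_assoc]
    · right
      refine ⟨c + 1, ?_⟩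
      simp only [shortB, Finset.image_insert, Finset.image_singleton, Option.map_none,
        Option.map_some]
      rw [add_right_comm c u 1, add_right_comm c (2 * u) 1]

/-- There is a 1-rotational `S(2,4,12t+4)`. -/
def Good (t : ℕ) : Prop :=
  ∃ 𝓑 : Set (Finset (Option (ZMod (12 * t + 3)))),
      (∀ B ∈ 𝓑, B.card = 4) ∧
      (∀ x y : Option (ZMod (12 * t + 3)), x ≠ y → ∃! B, B ∈ 𝓑 ∧ x ∈ B ∧ y ∈ B) ∧
      (∀ B ∈ 𝓑, B.image (Option.map (· + (1 : ZMod (12 * t + 3)))) ∈ 𝓑)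

/-- Base blocks of a template: six families of `m` blocks each (point `p` of a family moves with
slope `p`) and `r` sporadic blocks; a pair `(k, c)` stands for the number `k * m + c`. -/
def blk {r : ℕ} (A : Fin 6 → Fin 4 → ℤ × ℤ) (Sp : Fin r → Fin 4 → ℤ × ℤ) (m : ℕ) :
    (Fin 6 × Fin m) ⊕ Fin r → Fin 4 → ℤ
  | .inl x, p => (A x.1 p).1 * m + (A x.1 p).2 + (p : ℕ) * ((x.2 : ℕ) : ℤ)
  | .inr s, p => (Sp s p).1 * m + (Sp s p).2

/-- `d` is a difference of some base block. -/
def Cov {r : ℕ} (A : Fin 6 → Fin 4 → ℤ × ℤ) (Sp : Fin r → Fin 4 → ℤ × ℤ) (m : ℕ) (d : ℤ) : Prop :=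
  ∃ x p q, p ≠ q ∧ (72 * m + 12 * r + 3 : ℤ) ∣ d - (blk A Sp m x p - blk A Sp m x q)

/-- some family has a progression of differences of slope `s` starting at `k * m + c` -/
def hitF (r : ℕ) (A : Fin 6 → Fin 4 → ℤ × ℤ) (s : ℕ) (k c : ℤ) : Prop :=
  ∃ f : Fin 6, ∃ p q : Fin 4, (q : ℕ) = p + s ∧ ∃ w : Fin 3,
    ((A f q).1 - (A f p).1 + ((w : ℕ) - 1 : ℤ) * 72 = k ∧
      (A f q).2 - (A f p).2 + ((w : ℕ) - 1 : ℤ) * (12 * r + 3) = c) ∨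
    ((A f p).1 - (A f q).1 - s + ((w : ℕ) - 1 : ℤ) * 72 = k ∧
      (A f p).2 - (A f q).2 + s + ((w : ℕ) - 1 : ℤ) * (12 * r + 3) = c)

instance (r : ℕ) (A : Fin 6 → Fin 4 → ℤ × ℤ) (s : ℕ) (k c : ℤ) : Decidable (hitF r A s k c) := by
  unfold hitF; infer_instance

/-- some sporadic block has the difference `k * m + c` -/
def hitS {r : ℕ} (Sp : Fin r → Fin 4 → ℤ × ℤ) (k c : ℤ) : Prop :=
  ∃ f : Fin r, ∃ p q : Fin 4, p ≠ q ∧ ∃ w : Fin 3,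
    (Sp f q).1 - (Sp f p).1 + ((w : ℕ) - 1 : ℤ) * 72 = k ∧
      (Sp f q).2 - (Sp f p).2 + ((w : ℕ) - 1 : ℤ) * (12 * r + 3) = c

instance {r : ℕ} (Sp : Fin r → Fin 4 → ℤ × ℤ) (k c : ℤ) : Decidable (hitS Sp k c) := by
  unfold hitS; infer_instance

/-- Checks that the differences tile the interval from `k * m + c` to the end. -/
def chk {r : ℕ} (A : Fin 6 → Fin 4 → ℤ × ℤ) (Sp : Fin r → Fin 4 → ℤ × ℤ) : List ℕ → ℤ → ℤ → Bool
  | [], k, c => decide (k = 36 ∧ c = 6 * r + 2)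
  | 0 :: l, k, c => decide ((k = 24 ∧ c = 4 * r + 1) ∨ hitS Sp k c) && chk A Sp l k (c + 1)
  | (s + 1) :: l, k, c =>
      decide (∀ j : Fin (s + 1), hitF r A (s + 1) k (c + (j : ℕ))) && chk A Sp l (k + (s + 1 : ℕ)) c

lemma cov_hitS {r : ℕ} {A : Fin 6 → Fin 4 → ℤ × ℤ} {Sp : Fin r → Fin 4 → ℤ × ℤ} {k c : ℤ} (m : ℕ)
    (h : hitS Sp k c) : Cov A Sp m (k * m + c) := by
  obtain ⟨f, p, q, hpq, w, h1, h2⟩ := h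
  refine ⟨.inr f, q, p, hpq.symm, ((w : ℕ) - 1 : ℤ), ?_⟩
  simp only [blk]
  rw [← h1, ← h2]; ring

lemma cov_hitF {r : ℕ} {A : Fin 6 → Fin 4 → ℤ × ℤ} {Sp : Fin r → Fin 4 → ℤ × ℤ} {s : ℕ} {k c : ℤ}
    (m : ℕ) (hs : 0 < s) (h : hitF r A s k c) (i : ℕ) (hi : i < m) :
    Cov A Sp m (k * m + c + s * i) := by
  obtain ⟨f, p, q, hpq, w, ⟨h1, h2⟩ | ⟨h1, h2⟩⟩ := h
  · refine ⟨.inl (f, ⟨i, hi⟩), q, p, ?_, ((w : ℕ) - 1 : ℤ), ?_⟩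
    · rintro rfl; omega
    · simp only [blk]
      rw [← h1, ← h2, hpq]; push_cast; ring
  · refine ⟨.inl (f, ⟨m - 1 - i, by omega⟩), p, q, ?_, ((w : ℕ) - 1 : ℤ), ?_⟩
    · rintro rfl; omega
    · have e : ((m - 1 - i : ℕ) : ℤ) = m - 1 - i := by omega
      simp only [blk]
      rw [← h1, ← h2, hpq, e]; push_cast; ring

lemma chk_sound {r : ℕ} {A : Fin 6 → Fin 4 → ℤ × ℤ} {Sp : Fin r → Fin 4 → ℤ × ℤ} (m : ℕ)
    (l : List ℕ) : ∀ (k c : ℤ), chk A Sp l k c = true → ∀ d : ℤ, k * m + c ≤ d →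
      d ≤ 36 * m + 6 * r + 1 → d = 24 * m + 4 * r + 1 ∨ Cov A Sp m d := by
  induction l with
  | nil =>
    intro k c h d h1 h2
    simp only [chk, decide_eq_true_eq] at h
    obtain ⟨rfl, rfl⟩ := h
    omega
  | cons s l ih =>
    intro k c h d h1 h2
    cases s with
    | zero =>
      simp only [chk, Bool.and_eq_true, decide_eq_true_eq] at h
      rcases h1.eq_or_lt with h1 | h1
      · subst h1
        rcases h.1 with ⟨rfl, rfl⟩ | h
        · left; ring
        · right; exact cov_hitS m h
      · exact ih k (c + 1) h.2 d (by omega) h2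
    | succ s =>
      simp only [chk, Bool.and_eq_true, decide_eq_true_eq] at h
      by_cases hd : (k + (s + 1 : ℕ)) * m + c ≤ d
      · exact ih _ _ h.2 d hd h2
      · right
        obtain ⟨e, he⟩ := Int.eq_ofNat_of_zero_le (sub_nonneg.2 h1)
        have hlt : e < m * (s + 1) := by
          have : (e : ℤ) < m * (s + 1) := by
            push_cast at hd
            nlinarith
          exact_mod_cast this
        have hm := Nat.mod_lt e (Nat.succ_pos s)
        have := cov_hitF (Sp := Sp) m (Nat.succ_pos s) (h.1 ⟨e % (s + 1), hm⟩) (e / (s + 1))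
          (Nat.div_lt_of_lt_mul (by rw [mul_comm]; exact hlt))
        have e2 : d = k * m + (c + ((e % (s + 1) : ℕ) : ℤ)) + (s + 1 : ℕ) * (e / (s + 1) : ℕ) := by
          have := Nat.mod_add_div e (s + 1)
          have h' : ((e % (s + 1) : ℕ) : ℤ) + (s + 1 : ℕ) * (e / (s + 1) : ℕ) = e := by
            exact_mod_cast this
          linear_combination he - h'
        rw [e2]; exact this

lemma template {r : ℕ} (A : Fin 6 → Fin 4 → ℤ × ℤ) (Sp : Fin r → Fin 4 → ℤ × ℤ) (l : List ℕ)
    (h : chk A Sp l 0 1 = true) (m : ℕ) : Good (6 * m + r) := by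
  refine build rfl (ι := (Fin 6 × Fin m) ⊕ Fin r) (by simp) _ rfl
    (fun x p => ((blk A Sp m x p : ℤ) : ZMod _)) ?_
  intro d h0 h1 h2
  have hN : NeZero (12 * (6 * m + r) + 3) := ⟨by omega⟩
  have key : ∀ e : ℕ, 1 ≤ e → e ≤ 36 * m + 6 * r + 1 → e ≠ 24 * m + 4 * r + 1 →
      ∃ x p q, p ≠ q ∧ ((blk A Sp m x p : ℤ) : ZMod (12 * (6 * m + r) + 3)) -
        ((blk A Sp m x q : ℤ) : ZMod (12 * (6 * m + r) + 3)) = (e : ZMod (12 * (6 * m + r) + 3)) := by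
    intro e he1 he2 he3
    rcases chk_sound m l 0 1 h e (by omega) (by omega) with h' | ⟨x, p, q, hpq, hd⟩
    · omega
    · refine ⟨x, p, q, hpq, ?_⟩
      have hd' : (((12 * (6 * m + r) + 3 : ℕ) : ℤ)) ∣ (e : ℤ) - (blk A Sp m x p - blk A Sp m x q) := by
        have : (((12 * (6 * m + r) + 3 : ℕ) : ℤ)) = 72 * m + 12 * r + 3 := by push_cast; ring
        rw [this]; exact hd
      rw [← ZMod.intCast_zmod_eq_zero_iff_dvd] at hd'
      push_cast at hd'
      linear_combination -hd'
  have hval := ZMod.val_lt d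
  have hcast : ((d.val : ℕ) : ZMod (12 * (6 * m + r) + 3)) = d := ZMod.natCast_zmod_val d
  have hv0 : d.val ≠ 0 := by rwa [Ne, ZMod.val_eq_zero]
  by_cases hle : d.val ≤ 36 * m + 6 * r + 1
  · obtain ⟨x, p, q, hpq, e⟩ := key d.val (by omega) hle (by
      intro h'; apply h1; rw [← hcast, h']; congr 1; ring)
    exact ⟨x, p, q, hpq, by rw [e, hcast]⟩
  · obtain ⟨x, p, q, hpq, e⟩ := key (12 * (6 * m + r) + 3 - d.val) (by omega) (by omega) (by
      intro h'; apply h2; rw [← hcast]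
      have : d.val = 2 * (4 * (6 * m + r) + 1) := by omega
      rw [this]; push_cast; ring)
    refine ⟨x, q, p, hpq.symm, ?_⟩
    rw [Nat.cast_sub hval.le, hcast, ZMod.natCast_self] at e
    linear_combination -e

lemma case0 : Good 0 :=
  build rfl (ι := Fin 0) (by simp) _ rfl (fun _ _ => 0) (by decide)

lemma case1 : Good 1 :=
  build rfl (ι := Fin 1) (by simp) _ rfl (fun _ => ![0, 1, 3, 7]) (by decide +kernel)

lemma case3 : Good 3 :=
  build rfl (ι := Fin 3) (by simp) _ rfl
    ![![0, 1, 6, 31], ![0, 2, 12, 23], ![0, 3, 7, 22]] (by decide +kernel)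

lemma case4 (m : ℕ) : Good (6 * m + 4) := by
  refine template (r := 4)
    ![![(0, 0), (49, 35), (53, 38), (5, 5)],
      ![(0, 0), (11, 8), (14, 11), (0, 1)],
      ![(0, 0), (40, 29), (61, 45), (5, 6)],
      ![(0, 0), (30, 22), (53, 39), (0, 2)],
      ![(0, 0), (39, 28), (26, 20), (0, 3)],
      ![(0, 0), (51, 37), (14, 12), (5, 7)]]
    ![![(0, 0), (3, 1), (59, 41), (20, 14)],
      ![(0, 0), (5, 3), (51, 36), (46, 32)],
      ![(0, 0), (3, 2), (63, 45), (35, 25)],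
      ![(0, 0), (8, 5), (63, 44), (50, 35)]]
    [3, 0, 0, 1, 1, 0, 0, 3, 0, 1, 0, 0, 2, 1, 0, 1, 0, 0, 1, 2, 0, 1, 0, 0, 2, 1, 0, 1, 0, 1, 0, 1, 1, 0, 1, 1, 0, 0, 2, 0, 2, 0, 1, 0, 1, 0, 1, 0, 2, 0, 1] (by decide +kernel) m

lemma case5 (m : ℕ) : Good (6 * m + 5) := by
  refine template (r := 5)
    ![![(0, 0), (62, 55), (54, 49), (0, 2)],
      ![(0, 0), (34, 30), (60, 54), (12, 14)],
      ![(0, 0), (8, 7), (54, 48), (12, 12)],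
      ![(0, 0), (40, 35), (4, 4), (0, 1)],
      ![(0, 0), (44, 39), (50, 46), (0, 3)],
      ![(0, 0), (56, 50), (32, 30), (12, 13)]]
    ![![(0, 0), (24, 22), (66, 59), (50, 45)],
      ![(0, 0), (23, 20), (60, 52), (45, 39)],
      ![(0, 0), (3, 1), (66, 57), (56, 48)],
      ![(0, 0), (3, 3), (66, 58), (31, 28)],
      ![(0, 0), (3, 2), (60, 53), (41, 36)]]
    [3, 0, 0, 0, 1, 2, 0, 0, 0, 1, 1, 1, 0, 0, 1, 0, 2, 0, 0, 3, 0, 0, 1, 0, 0, 2, 1, 0, 0, 1, 2, 0, 0, 1, 0, 1, 0, 0, 1, 1, 0, 1, 0, 1, 0, 2, 0, 1, 0, 0, 1, 2, 0, 1, 0, 0, 1] (by decide +kernel) m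

lemma case6 (m : ℕ) : Good (6 * m + 6) := by
  refine template (r := 6)
    ![![(0, 0), (39, 41), (26, 29), (29, 32)],
      ![(0, 0), (25, 26), (44, 47), (29, 31)],
      ![(0, 0), (6, 7), (49, 53), (0, 3)],
      ![(0, 0), (10, 11), (21, 23), (0, 1)],
      ![(0, 0), (64, 67), (16, 18), (29, 33)],
      ![(0, 0), (56, 58), (37, 40), (0, 2)]]
    ![![(0, 0), (3, 1), (64, 65), (57, 58)],
      ![(0, 0), (32, 31), (6, 5), (46, 47)],
      ![(0, 0), (4, 4), (53, 55), (39, 40)],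
      ![(0, 0), (3, 2), (52, 54), (32, 32)],
      ![(0, 0), (4, 3), (64, 66), (36, 37)],
      ![(0, 0), (6, 6), (65, 67), (19, 19)]]
    [3, 0, 0, 1, 0, 0, 2, 0, 0, 1, 0, 0, 1, 0, 0, 2, 1, 0, 1, 0, 1, 0, 0, 1, 0, 0, 1, 0, 1, 2, 0, 1, 0, 0, 1, 0, 0, 1, 2, 0, 0, 1, 0, 1, 1, 0, 0, 0, 2, 0, 1, 0, 3, 0, 0, 0, 0, 1, 0, 2, 0, 1, 0] (by decide +kernel) m

lemma case7 (m : ℕ) : Good (6 * m + 7) := by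
  refine template (r := 7)
    ![![(0, 0), (27, 33), (30, 38), (4, 8)],
      ![(0, 0), (60, 73), (33, 41), (4, 6)],
      ![(0, 0), (10, 13), (30, 39), (0, 2)],
      ![(0, 0), (14, 17), (49, 61), (0, 1)],
      ![(0, 0), (64, 78), (16, 21), (0, 3)],
      ![(0, 0), (39, 47), (58, 72), (4, 7)]]
    ![![(0, 0), (24, 27), (64, 76), (61, 73)],
      ![(0, 0), (3, 1), (68, 82), (15, 17)],
      ![(0, 0), (29, 37), (69, 85), (54, 67)],
      ![(0, 0), (20, 25), (60, 72), (44, 53)],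
      ![(0, 0), (3, 4), (65, 79), (46, 55)],
      ![(0, 0), (7, 7), (51, 61), (44, 52)],
      ![(0, 0), (8, 10), (61, 74), (26, 31)]]
    [3, 0, 0, 0, 0, 1, 0, 3, 0, 0, 0, 0, 1, 0, 0, 2, 0, 1, 0, 0, 1, 0, 0, 2, 1, 0, 0, 1, 0, 2, 0, 0, 1, 0, 0, 0, 1, 0, 1, 0, 2, 1, 0, 0, 0, 1, 0, 1, 0, 0, 1, 1, 0, 0, 0, 1, 0, 0, 1, 2, 0, 0, 0, 1, 2, 0, 0, 0, 1] (by decide +kernel) m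

lemma case8 (m : ℕ) : Good (6 * m + 8) := by
  refine template (r := 8)
    ![![(0, 0), (19, 26), (10, 15), (0, 1)],
      ![(0, 0), (12, 17), (28, 41), (0, 3)],
      ![(0, 0), (56, 77), (17, 26), (20, 31)],
      ![(0, 0), (58, 80), (25, 36), (20, 30)],
      ![(0, 0), (14, 20), (45, 64), (20, 29)],
      ![(0, 0), (66, 91), (42, 59), (0, 2)]]
    ![![(0, 0), (17, 25), (69, 98), (9, 14)],
      ![(0, 0), (23, 29), (8, 9), (39, 52)],
      ![(0, 0), (20, 27), (69, 96), (33, 46)],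
      ![(0, 0), (30, 41), (69, 95), (17, 24)],
      ![(0, 0), (36, 48), (63, 86), (48, 64)],
      ![(0, 0), (15, 21), (64, 89), (59, 81)],
      ![(0, 0), (3, 2), (48, 65), (44, 59)],
      ![(0, 0), (4, 5), (67, 92), (27, 37)]]
    [3, 0, 0, 0, 0, 1, 0, 0, 1, 0, 0, 1, 2, 0, 0, 0, 1, 0, 0, 0, 1, 2, 0, 0, 1, 0, 0, 0, 1, 1, 0, 0, 0, 1, 0, 1, 0, 0, 2, 1, 0, 0, 0, 3, 0, 0, 0, 0, 1, 0, 0, 0, 1, 2, 0, 0, 0, 1, 0, 0, 2, 0, 1, 0, 0, 1, 0, 1, 0, 0, 0, 1, 2, 0, 0] (by decide +kernel) m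

lemma case9 (m : ℕ) : Good (6 * m + 9) := by
  refine template (r := 9)
    ![![(0, 0), (39, 61), (26, 42), (29, 48)],
      ![(0, 0), (57, 87), (4, 7), (29, 46)],
      ![(0, 0), (23, 36), (66, 105), (0, 3)],
      ![(0, 0), (10, 15), (21, 34), (0, 1)],
      ![(0, 0), (64, 99), (16, 26), (29, 47)],
      ![(0, 0), (56, 86), (37, 58), (0, 2)]]
    ![![(0, 0), (3, 1), (64, 97), (57, 86)],
      ![(0, 0), (23, 34), (3, 2), (43, 67)],
      ![(0, 0), (14, 24), (66, 104), (33, 53)],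
      ![(0, 0), (32, 47), (7, 9), (39, 59)],
      ![(0, 0), (13, 20), (61, 95), (49, 76)],
      ![(0, 0), (28, 42), (68, 105), (54, 83)],
      ![(0, 0), (3, 3), (69, 106), (61, 93)],
      ![(0, 0), (3, 4), (46, 72), (32, 49)],
      ![(0, 0), (7, 10), (61, 94), (26, 40)]]
    [3, 0, 0, 0, 0, 0, 1, 0, 2, 0, 0, 1, 0, 0, 0, 0, 1, 0, 0, 2, 1, 0, 0, 0, 0, 1, 0, 1, 0, 1, 0, 0, 0, 0, 1, 0, 1, 2, 0, 0, 0, 1, 0, 0, 1, 0, 0, 0, 1, 2, 0, 0, 1, 0, 0, 1, 0, 1, 0, 0, 0, 2, 0, 1, 0, 0, 0, 3, 0, 0, 0, 0, 0, 1, 0, 0, 0, 2, 0, 1, 0] (by decide +kernel) m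

lemma good_all (t : ℕ) (ht : t ≠ 2) : Good t := by
  by_cases h : t < 4
  · interval_cases t
    · exact case0
    · exact case1
    · exact absurd rfl ht
    · exact case3
  · obtain ⟨m, h | h | h | h | h | h⟩ : ∃ m, t = 6 * m + 4 ∨ t = 6 * m + 5 ∨ t = 6 * m + 6 ∨
        t = 6 * m + 7 ∨ t = 6 * m + 8 ∨ t = 6 * m + 9 := ⟨(t - 4) / 6, by omega⟩
    · rw [h]; exact case4 m
    · rw [h]; exact case5 m
    · rw [h]; exact case6 m
    · rw [h]; exact case7 m
    · rw [h]; exact case8 m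
    · rw [h]; exact case9 m

/-- The relative difference-family structure underlying a 1-rotational design. -/
structure Red {n : ℕ} (H : AddSubgroup (ZMod n)) (C : Set (Finset (ZMod n))) : Prop where
  cardH : Nat.card H = 3
  card : ∀ B ∈ C, B.card = 4
  tr : ∀ B ∈ C, ∀ c, B.image (· + c) ∈ C
  ex : ∀ x y, x - y ∉ H → ∃ B ∈ C, x ∈ B ∧ y ∈ B
  un : ∀ B ∈ C, ∀ B' ∈ C, ∀ x y, x ≠ y → x ∈ B → y ∈ B → x ∈ B' → y ∈ B' → B = B'
  nH : ∀ B ∈ C, ∀ x ∈ B, ∀ y ∈ B, x ≠ y → x - y ∉ H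

lemma reduce {n : ℕ} [NeZero n] (𝓑 : Set (Finset (Option (ZMod n))))
    (h1 : ∀ B ∈ 𝓑, B.card = 4)
    (h2 : ∀ x y : Option (ZMod n), x ≠ y → ∃! B, B ∈ 𝓑 ∧ x ∈ B ∧ y ∈ B)
    (h3 : ∀ B ∈ 𝓑, B.image (Option.map (· + (1 : ZMod n))) ∈ 𝓑) :
    ∃ H C, @Red n H C := by
  have trN : ∀ k : ℕ, ∀ B ∈ 𝓑, B.image (Option.map (· + (k : ZMod n))) ∈ 𝓑 := by
    intro k
    induction k with
    | zero => intro B hB; simpa using hB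
    | succ k ih =>
      intro B hB
      have := h3 _ (ih B hB)
      rw [Finset.image_image] at this
      convert this using 2
      funext z
      cases z <;> simp [add_assoc]
  have tr : ∀ c : ZMod n, ∀ B ∈ 𝓑, B.image (Option.map (· + c)) ∈ 𝓑 := by
    intro c B hB
    have := trN c.val B hB
    rwa [ZMod.natCast_zmod_val] at this
  have memtr : ∀ (B : Finset (Option (ZMod n))) (c x : ZMod n),
      some x ∈ B.image (Option.map (· + c)) ↔ some (x - c) ∈ B := by
    intro B c x
    simp only [Finset.mem_image, Option.map_eq_some_iff]
    constructor
    · rintro ⟨_, ha, a, rfl, rfl⟩; simpa using ha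
    · intro h; exact ⟨_, h, x - c, rfl, by ring⟩
  have nonetr : ∀ (B : Finset (Option (ZMod n))) (c : ZMod n),
      none ∈ B.image (Option.map (· + c)) ↔ none ∈ B := by
    intro B c
    simp
  have un : ∀ B ∈ 𝓑, ∀ B' ∈ 𝓑, ∀ x y, x ≠ y → x ∈ B → y ∈ B → x ∈ B' → y ∈ B' → B = B' := by
    intro B hB B' hB' x y hxy a b c d
    exact (h2 x y hxy).unique ⟨hB, a, b⟩ ⟨hB', c, d⟩
  obtain ⟨A, ⟨hA, hAn, hA0⟩, -⟩ := h2 none (some 0) (by simp)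
  have hAx : ∀ B ∈ 𝓑, none ∈ B → ∀ y, some y ∈ B → ∀ x, some x ∈ B ↔ some (x - y) ∈ A := by
    intro B hB hn y hy x
    have : B.image (Option.map (· + (-y))) = A := by
      refine un _ (tr _ _ hB) A hA none (some 0) (by simp) ?_ ?_ hAn hA0
      · rw [nonetr]; exact hn
      · rw [memtr]; simpa using hy
    rw [← this, memtr]; simp
  have hsub : ∀ x y, some x ∈ A → some y ∈ A → some (x - y) ∈ A := by
    intro x y hx hy
    exact (hAx A hA hAn y hy x).1 hx
  have hneg : ∀ x, some x ∈ A → some (-x) ∈ A := by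
    intro x hx; simpa using hsub 0 x hA0 hx
  let H : AddSubgroup (ZMod n) :=
    { carrier := {x | some x ∈ A}
      zero_mem' := hA0
      add_mem' := by
        intro x y hx hy
        have := hsub x (-y) hx (hneg y hy)
        simpa using this
      neg_mem' := by
        intro x hx; exact hneg x hx }
  have hH : ∀ x, x ∈ H ↔ some x ∈ A := fun x => Iff.rfl
  have hcast : ∀ B : Finset (Option (ZMod n)), none ∉ B → (Finset.eraseNone B).map Function.Embedding.some = B := by
    intro B hB
    ext z
    cases z with
    | none => simpa using hB
    | some z => simp
  refine ⟨H, {D | D.map Function.Embedding.some ∈ 𝓑}, ?_, ?_, ?_, ?_, ?_, ?_⟩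
  · have e : (H : Set (ZMod n)) = ↑(Finset.eraseNone A) := by
      ext x; simp [hH]
    have : Nat.card H = (H : Set (ZMod n)).ncard := rfl
    rw [this, e, Set.ncard_coe_finset]
    have h4 := h1 A hA
    have : (insert none ((Finset.eraseNone A).map Function.Embedding.some)) = A := by
      ext z
      cases z with
      | none => simpa using hAn
      | some z => simp
    rw [← this, Finset.card_insert_of_notMem (by simp), Finset.card_map] at h4
    omega
  · intro B hB
    have := h1 _ hB
    rwa [Finset.card_map] at this
  · intro B hB c
    have := tr c _ hB
    show (B.image (· + c)).map Function.Embedding.some ∈ 𝓑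
    convert this using 1
    ext z
    cases z with
    | none => simp
    | some z => rw [memtr]; simp [sub_eq_add_neg]
  · intro x y hxy
    have hne : x ≠ y := by rintro rfl; apply hxy; rw [sub_self]; exact H.zero_mem
    obtain ⟨B, ⟨hB, hx, hy⟩, -⟩ := h2 (some x) (some y) (by simpa using hne)
    have hn : none ∉ B := by
      intro hn
      exact hxy ((hAx B hB hn y hy x).1 hx)
    refine ⟨Finset.eraseNone B, ?_, ?_, ?_⟩
    · show _ ∈ 𝓑
      rw [hcast B hn]; exact hB
    · simpa using hx
    · simpa using hy
  · intro B hB B' hB' x y hxy a b c d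
    have := un _ hB _ hB' (some x) (some y) (by simpa using hxy) (by simpa using a)
      (by simpa using b) (by simpa using c) (by simpa using d)
    exact Finset.map_injective _ this
  · intro B hB x hx y hy hxy hm
    have := un _ hB _ (tr y A hA) (some x) (some y) (by simpa using hxy) (by simpa using hx)
      (by simpa using hy) (by rw [memtr]; exact hm) (by rw [memtr]; simpa using hA0)
    have hn : none ∈ B.map Function.Embedding.some := by
      rw [this, nonetr]; exact hAn
    simp at hn

lemma memtr' {n : ℕ} (B : Finset (ZMod n)) (c x : ZMod n) : x ∈ B.image (· + c) ↔ x - c ∈ B := by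
  simp only [Finset.mem_image]
  constructor
  · rintro ⟨a, ha, rfl⟩; simpa using ha
  · intro h; exact ⟨_, h, by ring⟩

/-- The set of differences of a block. -/
def Dl {n : ℕ} (B : Finset (ZMod n)) : Finset (ZMod n) := B.offDiag.image (fun z => z.1 - z.2)

lemma mem_Dl {n : ℕ} (B : Finset (ZMod n)) (d : ZMod n) :
    d ∈ Dl B ↔ ∃ x ∈ B, ∃ y ∈ B, x ≠ y ∧ x - y = d := by
  simp only [Dl, Finset.mem_image, Finset.mem_offDiag, Prod.exists]
  constructor
  · rintro ⟨x, y, ⟨a, b, c⟩, e⟩; exact ⟨x, a, y, b, c, e⟩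
  · rintro ⟨x, a, y, b, c, e⟩; exact ⟨x, y, ⟨a, b, c⟩, e⟩

lemma Dl_tr {n : ℕ} (B : Finset (ZMod n)) (c : ZMod n) : Dl (B.image (· + c)) = Dl B := by
  ext d
  rw [mem_Dl, mem_Dl]
  constructor
  · rintro ⟨x, a, y, b, h, e⟩
    rw [memtr'] at a b
    exact ⟨_, a, _, b, by simpa using h, by linear_combination e⟩
  · rintro ⟨x, a, y, b, h, e⟩
    exact ⟨x + c, by rw [memtr']; simpa using a, y + c, by rw [memtr']; simpa using b,
      by simpa using h, by linear_combination e⟩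

section
variable {n : ℕ} {H : AddSubgroup (ZMod n)} {C : Set (Finset (ZMod n))}

/-- Two blocks sharing a difference are translates of one another. -/
lemma Red.share (R : Red H C) {B B' : Finset (ZMod n)} (hB : B ∈ C) (hB' : B' ∈ C) {x y x' y' : ZMod n}
    (hx : x ∈ B) (hy : y ∈ B) (hx' : x' ∈ B') (hy' : y' ∈ B') (hxy : x ≠ y)
    (e : x - y = x' - y') : B.image (· + (x' - x)) = B' := by
  refine R.un _ (R.tr B hB _) B' hB' x' y' ?_ ?_ ?_ hx' hy'
  · rintro rfl; apply hxy; rw [sub_self] at e; exact sub_eq_zero.1 e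
  · rw [memtr']; simpa using hx
  · rw [memtr']
    have : y' - (x' - x) = y := by linear_combination e
    rw [this]; exact hy

lemma Red.stab4 (R : Red H C) {B : Finset (ZMod n)} (hB : B ∈ C) {c : ZMod n}
    (h : B.image (· + c) = B) : 4 * c = 0 := by
  have h1 : ∑ x ∈ B.image (· + c), x = ∑ x ∈ B, (x + c) :=
    Finset.sum_image (by intro a _ b _ h; simpa using h)
  rw [h, Finset.sum_add_distrib, Finset.sum_const, R.card B hB] at h1
  simp only [left_eq_add] at h1
  rw [← h1]; simp

lemma Red.cardDl (R : Red H C) {B : Finset (ZMod n)} (hB : B ∈ C)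
    (hs : ∀ c, B.image (· + c) = B → c = 0) : (Dl B).card = 12 := by
  rw [Dl, Finset.card_image_of_injOn, Finset.offDiag_card, R.card B hB]
  rintro ⟨x, y⟩ h1 ⟨x', y'⟩ h2 e
  simp only [Finset.coe_offDiag, Set.mem_offDiag, Finset.mem_coe] at h1 h2 e
  have := hs _ (R.share hB hB h1.1 h1.2.1 h2.1 h2.2.1 h1.2.2 e)
  have hx : x' = x := sub_eq_zero.1 this
  subst hx
  have : y = y' := by linear_combination -e
  rw [this]

lemma Red.dvd [NeZero n] (R : Red H C) (S : Finset (ZMod n))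
    (hS : ∀ d ∈ S, d ∉ H)
    (hst : ∀ d ∈ S, ∀ B ∈ C, 0 ∈ B → d ∈ B → (∀ c, B.image (· + c) = B → c = 0) ∧ Dl B ⊆ S) :
    12 ∣ S.card := by
  classical
  have hex : ∀ d : ZMod n, ∃ B : Finset (ZMod n), d ∈ S → B ∈ C ∧ 0 ∈ B ∧ d ∈ B := by
    intro d
    by_cases hd : d ∈ S
    · obtain ⟨B, hB, h1, h2⟩ := R.ex d 0 (by simpa using hS d hd)
      exact ⟨B, fun _ => ⟨hB, h2, h1⟩⟩
    · exact ⟨∅, fun h => absurd h hd⟩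
  choose f hf using hex
  have hmem : ∀ d ∈ S, d ∈ Dl (f d) := by
    intro d hd
    obtain ⟨_, h0, h1⟩ := hf d hd
    refine (mem_Dl _ _).2 ⟨d, h1, 0, h0, ?_, sub_zero d⟩
    rintro rfl; exact hS _ hd H.zero_mem
  have hfib : ∀ d ∈ S, S.filter (fun d' => Dl (f d') = Dl (f d)) = Dl (f d) := by
    intro d hd
    obtain ⟨hB, h0, h1⟩ := hf d hd
    ext d'
    rw [Finset.mem_filter]
    constructor
    · rintro ⟨h, e⟩; rw [← e]; exact hmem d' h
    · intro h
      have hd' := (hst d hd _ hB h0 h1).2 h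
      refine ⟨hd', ?_⟩
      obtain ⟨hB', h0', h1'⟩ := hf d' hd'
      obtain ⟨x, hx, y, hy, hxy, e⟩ := (mem_Dl _ _).1 h
      rw [← R.share hB hB' hx hy h1' h0' hxy (by rw [e, sub_zero]), Dl_tr]
  rw [Finset.card_eq_sum_card_image (fun d => Dl (f d)) S]
  refine Finset.dvd_sum ?_
  intro D hD
  obtain ⟨d, hd, rfl⟩ := Finset.mem_image.1 hD
  obtain ⟨hB, h0, h1⟩ := hf d hd
  rw [hfib d hd, R.cardDl hB (hst d hd _ hB h0 h1).1]

lemma Red.DlH (R : Red H C) {B : Finset (ZMod n)} (hB : B ∈ C) {d : ZMod n} (hd : d ∈ Dl B) :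
    d ∉ H := by
  obtain ⟨x, hx, y, hy, hxy, rfl⟩ := (mem_Dl _ _).1 hd
  exact R.nH B hB x hx y hy hxy

end

lemma four_mul_eq_zero {n : ℕ} [NeZero n] (k : ℕ) {c : ZMod n} (h : (k : ZMod n) * c = 0) :
    n ∣ k * c.val := by
  rw [← ZMod.natCast_eq_zero_iff]
  push_cast
  rw [ZMod.natCast_zmod_val]; exact h

lemma Red.cardF {n : ℕ} [NeZero n] {H : AddSubgroup (ZMod n)} {C : Set (Finset (ZMod n))}
    (R : Red H C) [DecidablePred (· ∈ H)] : (Finset.univ.filter (· ∈ H)).card = 3 := by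
  rw [← R.cardH, Nat.card_eq_fintype_card, Fintype.card_subtype]

lemma Red.odd {n : ℕ} [NeZero n] {H : AddSubgroup (ZMod n)} {C : Set (Finset (ZMod n))}
    (R : Red H C) (hn : n % 2 = 1) {B : Finset (ZMod n)} (hB : B ∈ C) (c : ZMod n)
    (h : B.image (· + c) = B) : c = 0 := by
  have h4 := R.stab4 hB h
  have := four_mul_eq_zero 4 (c := c) (by exact_mod_cast h4)
  have hco : Nat.Coprime n 4 := by
    have : Nat.Coprime n 2 := (Nat.coprime_two_right).2 (Nat.odd_iff.2 hn)
    exact Nat.Coprime.pow_right 2 this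
  have h0 := hco.dvd_of_dvd_mul_left this
  exact (ZMod.val_eq_zero c).1 (Nat.eq_zero_of_dvd_of_lt h0 (ZMod.val_lt c))

lemma Red.three {n : ℕ} [NeZero n] {H : AddSubgroup (ZMod n)} {C : Set (Finset (ZMod n))}
    (R : Red H C) {x : ZMod n} (hx : x ∈ H) : 3 * x = 0 := by
  have : (Nat.card H) • (⟨x, hx⟩ : H) = 0 := card_nsmul_eq_zero'
  rw [R.cardH] at this
  have := congrArg Subtype.val this
  simpa using this

lemma Red.not_even {n : ℕ} [NeZero n] {H : AddSubgroup (ZMod n)} {C : Set (Finset (ZMod n))}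
    (R : Red H C) (hn : n % 2 = 0) : False := by
  classical
  have hn0 : n ≠ 0 := NeZero.ne n
  set h : ZMod n := ((n / 2 : ℕ) : ZMod n) with hh
  have h0 : h ≠ 0 := by
    rw [hh, Ne, ZMod.natCast_eq_zero_iff]
    intro hd; have := Nat.le_of_dvd (by omega) hd; omega
  have h2 : h + h = 0 := by
    have : ((n / 2 + n / 2 : ℕ) : ZMod n) = 0 := by
      rw [ZMod.natCast_eq_zero_iff]
      have : n / 2 + n / 2 = n := by omega
      rw [this]
    rw [← this, hh]; push_cast; rfl
  have hinv : ∀ x : ZMod n, x + x = 0 → x ≠ 0 → x = h := by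
    intro x hx hx0
    have hd := four_mul_eq_zero 2 (c := x) (by push_cast; rw [two_mul]; exact hx)
    have hlt := ZMod.val_lt x
    have hne : x.val ≠ 0 := by rwa [Ne, ZMod.val_eq_zero]
    obtain ⟨k, hk⟩ := hd
    have : k = 1 := by
      have h1 : k < 2 := by
        by_contra hk2
        have : n * 2 ≤ n * k := Nat.mul_le_mul_left n (by omega)
        omega
      interval_cases k
      · omega
      · rfl
    subst this
    have : x.val = n / 2 := by omega
    rw [← ZMod.natCast_zmod_val x, this]
  have hhH : h ∉ H := by
    intro hm
    apply h0
    linear_combination R.three hm - h2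
  obtain ⟨B, hB, hhB, h0B⟩ := R.ex h 0 (by simpa using hhH)
  -- a block stabilised by `h` and containing `0` is `B`
  have hst : ∀ D ∈ C, D.image (· + h) = D → 0 ∈ D → D = B := by
    intro D hD he hd
    refine R.un D hD B hB h 0 h0 ?_ hd hhB h0B
    rw [← he, memtr']; simpa using hd
  have hBh : B.image (· + h) = B := by
    refine R.un _ (R.tr B hB h) B hB h 0 h0 ?_ ?_ hhB h0B
    · rw [memtr']; simpa using h0B
    · rw [memtr']
      have : 0 - h = h := by linear_combination -h2
      rw [this]; exact hhB
  have hBs : ∀ x ∈ B, B.image (· + (-x)) = B := by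
    intro x hx
    refine R.un _ (R.tr B hB (-x)) B hB h 0 h0 ?_ ?_ hhB h0B
    · have : x + h ∈ B := by rw [← hBh, memtr']; simpa using hx
      rw [memtr']
      have e : h - -x = x + h := by ring
      rw [e]; exact this
    · rw [memtr']; simpa using hx
  have hBsub : ∀ x ∈ B, ∀ y ∈ B, y - x ∈ B := by
    intro x hx y hy
    rw [← hBs x hx, memtr']; simpa using hy
  have hBneg : ∀ x ∈ B, -x ∈ B := by
    intro x hx; simpa using hBsub x hx 0 h0B
  let K : AddSubgroup (ZMod n) :=
    { carrier := {x | x ∈ B}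
      zero_mem' := h0B
      add_mem' := by
        intro x y hx hy
        have := hBsub (-y) (hBneg y hy) x hx
        simpa using this
      neg_mem' := by
        intro x hx; exact hBneg x hx }
  have hK : Nat.card K = 4 := by
    have e : (K : Set (ZMod n)) = ↑B := by ext x; exact Iff.rfl
    have : Nat.card K = (K : Set (ZMod n)).ncard := rfl
    rw [this, e, Set.ncard_coe_finset, R.card B hB]
  have h4n : 4 ∣ n := by
    have := AddSubgroup.card_addSubgroup_dvd_card K
    rwa [hK, Nat.card_zmod] at this
  -- the generic differences
  let S : Finset (ZMod n) := Finset.univ \ (Finset.univ.filter (· ∈ H) ∪ B)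
  have hmS : ∀ d, d ∈ S ↔ d ∉ H ∧ d ∉ B := by
    intro d; simp [S]
  have hSc : S.card + 6 = n := by
    have hi : Finset.univ.filter (· ∈ H) ∩ B = {0} := by
      ext x
      simp only [Finset.mem_inter, Finset.mem_filter, Finset.mem_univ, true_and,
        Finset.mem_singleton]
      constructor
      · rintro ⟨hx, hxB⟩
        by_contra hx0
        exact R.nH B hB x hxB 0 h0B hx0 (by simpa using hx)
      · rintro rfl; exact ⟨H.zero_mem, h0B⟩
    have hc := Finset.card_union_add_card_inter (Finset.univ.filter (· ∈ H)) B
    rw [hi, R.cardF, R.card B hB, Finset.card_singleton] at hc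
    have hle := Finset.card_le_univ (Finset.univ.filter (· ∈ H) ∪ B)
    have : S.card = n - 6 := by
      rw [Finset.card_sdiff_of_subset (Finset.subset_univ _), Finset.card_univ, ZMod.card]
      omega
    rw [ZMod.card] at hle
    omega
  have h12 : 12 ∣ S.card := by
    refine R.dvd S (fun d hd => ((hmS d).1 hd).1) ?_
    intro d hd D hD h0D hdD
    have hdn := (hmS d).1 hd
    have hDB : D ≠ B := by rintro rfl; exact hdn.2 hdD
    constructor
    · intro c hc
      by_contra hc0
      have h4 := R.stab4 hD hc
      apply hDB
      refine hst D hD ?_ h0D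
      by_cases hcc : c + c = 0
      · rw [← hinv c hcc hc0]; exact hc
      · have : c + c = h := hinv _ (by linear_combination h4) hcc
        rw [← this]
        have e : D.image (· + (c + c)) = (D.image (· + c)).image (· + c) := by
          rw [Finset.image_image]; congr 1; funext z; simp [add_assoc]
        rw [e, hc, hc]
    · intro d' hd'
      refine (hmS d').2 ⟨R.DlH hD hd', ?_⟩
      intro hB'
      obtain ⟨x, hx, y, hy, hxy, e⟩ := (mem_Dl _ _).1 hd'
      have hs := R.share hB hD hB' h0B hx hy (by rw [← e]; exact sub_ne_zero.2 hxy)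
        (by rw [e, sub_zero])
      apply hDB
      refine hst D hD ?_ h0D
      rw [← hs, Finset.image_image]
      conv_rhs => rw [← hBh, Finset.image_image]
      congr 1; funext z; simp only [Function.comp]; ring
  omega

/-- Differences of the quadruple `0, d, e, f`. -/
def qd (d e f : ZMod 27) : List (ZMod 27) :=
  [d, -d, e, -e, f, -f, e - d, d - e, f - d, d - f, f - e, e - f]

def sN (a b : ℕ) : ℕ := (a + (27 - b)) % 27

def qdN (d e f : ℕ) : List ℕ :=
  [d, sN 0 d, e, sN 0 e, f, sN 0 f, sN e d, sN d e, sN f d, sN d f, sN f e, sN e f]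

def memN (x : ℕ) : List ℕ → Bool
  | [] => false
  | a :: l => (Nat.beq x a) || memN x l

def ndN : List ℕ → Bool
  | [] => true
  | a :: l => !(memN a l) && ndN l

def NL : List ℕ :=
  [0, 1, 2, 3, 4, 5, 6, 7, 8, 9, 10, 11, 12, 13, 14, 15, 16, 17, 18, 19, 20, 21, 22, 23, 24, 25, 26]

def chkN : Bool :=
  NL.all fun b => NL.all fun c => !(ndN (9 :: 18 :: qdN 1 b c)) ||
    NL.any fun d => !(memN d (0 :: 9 :: 18 :: qdN 1 b c)) &&
      NL.all fun e => memN e (qdN 1 b c) || (memN (sN e d) (qdN 1 b c) ||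
        NL.all fun f => memN f (qdN 1 b c) || (memN (sN f d) (qdN 1 b c) ||
          (memN (sN f e) (qdN 1 b c) || !(ndN (9 :: 18 :: qdN d e f)))))

set_option maxRecDepth 10000 in
lemma chkN_true : chkN = true := by decide +kernel

lemma memN_iff (x : ℕ) (l : List ℕ) : memN x l = true ↔ x ∈ l := by
  induction l with
  | nil => simp [memN]
  | cons a l ih => simp [memN, ih]

lemma ndN_iff (l : List ℕ) : ndN l = true ↔ l.Nodup := by
  induction l with
  | nil => simp [ndN]
  | cons a l ih =>
    rw [ndN, Bool.and_eq_true, ih, List.nodup_cons, ← memN_iff]; simp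

lemma val_NL (x : ZMod 27) : x.val ∈ NL := by revert x; decide

lemma sN_cast (a b : ℕ) (hb : b < 27) : ((sN a b : ℕ) : ZMod 27) = a - b := by
  have h : ((27 : ℕ) : ZMod 27) = 0 := ZMod.natCast_self 27
  rw [sN, ZMod.natCast_mod, Nat.cast_add, Nat.cast_sub hb.le, h]; ring

lemma qdN_cast (d e f : ℕ) (hd : d < 27) (he : e < 27) (hf : f < 27) :
    (qdN d e f).map (Nat.cast : ℕ → ZMod 27) = qd d e f := by
  simp [qdN, qd, sN_cast _ _ hd, sN_cast _ _ he, sN_cast _ _ hf]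

lemma qdN_lt (d e f : ℕ) (hd : d < 27) (he : e < 27) (hf : f < 27) :
    ∀ x ∈ qdN d e f, x < 27 := by
  intro x hx
  simp only [qdN, sN, List.mem_cons, List.not_mem_nil, or_false] at hx
  omega

lemma nd_cast (d e f : ℕ) (hd : d < 27) (he : e < 27) (hf : f < 27)
    (h : (9 :: 18 :: qd d e f).Nodup) : ndN (9 :: 18 :: qdN d e f) = true := by
  rw [ndN_iff]
  apply List.Nodup.of_map (Nat.cast : ℕ → ZMod 27)
  rw [List.map_cons, List.map_cons, qdN_cast d e f hd he hf]
  exact h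

lemma comp27 (b c : ZMod 27) (h : (9 :: 18 :: qd 1 b c).Nodup) :
    ∃ d : ZMod 27, d ∉ 0 :: 9 :: 18 :: qd 1 b c ∧
      ∀ e : ZMod 27, (∀ z ∈ [e, e - d], z ∉ qd 1 b c) →
        ∀ f : ZMod 27, (9 :: 18 :: qd d e f).Nodup → ¬ (∀ z ∈ qd d e f, z ∉ qd 1 b c) := by
  have hb := ZMod.val_lt b
  have hc := ZMod.val_lt c
  have hq : (qdN 1 b.val c.val).map (Nat.cast : ℕ → ZMod 27) = qd 1 b c := by
    rw [qdN_cast 1 _ _ (by norm_num) hb hc]; simp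
  have hmem : ∀ x : ℕ, (x : ZMod 27) ∉ qd 1 b c → memN x (qdN 1 b.val c.val) = false := by
    intro x hx
    rw [← Bool.not_eq_true, memN_iff]
    intro h'
    apply hx
    rw [← hq]
    exact List.mem_map_of_mem h'
  have H := chkN_true
  simp only [chkN, List.all_eq_true] at H
  have H1 := H _ (val_NL b) _ (val_NL c)
  rw [nd_cast 1 _ _ (by norm_num) hb hc (by simpa using h)] at H1
  simp only [Bool.not_true, Bool.false_or, List.any_eq_true, Bool.and_eq_true,
    List.all_eq_true] at H1
  obtain ⟨d, hdL, hd, H2⟩ := H1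
  have hdlt : d < 27 := by
    have : ∀ x ∈ NL, x < 27 := by decide
    exact this d hdL
  refine ⟨d, ?_, ?_⟩
  · intro hm
    rw [← hq] at hm
    have hm' : (d : ZMod 27) ∈ (0 :: 9 :: 18 :: qdN 1 b.val c.val).map (Nat.cast : ℕ → ZMod 27) := by
      simpa using hm
    obtain ⟨x, hx, hxd⟩ := List.mem_map.1 hm'
    have hxlt : x < 27 := by
      simp only [List.mem_cons] at hx
      rcases hx with rfl | rfl | rfl | hx
      · norm_num
      · norm_num
      · norm_num
      · exact qdN_lt 1 _ _ (by norm_num) hb hc x hx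
    have := (ZMod.natCast_eq_natCast_iff' _ _ _).1 hxd
    rw [Nat.mod_eq_of_lt hxlt, Nat.mod_eq_of_lt hdlt] at this
    subst this
    rw [← memN_iff] at hx
    rw [hx] at hd
    exact absurd hd (by decide)
  · intro e he f hN hall
    have hel := ZMod.val_lt e
    have hfl := ZMod.val_lt f
    have H3 := H2 _ (val_NL e)
    rw [hmem e.val (by simpa using he e (by simp)),
      hmem (sN e.val d) (by
        rw [sN_cast _ _ hdlt]; simpa using he (e - d) (by simp))] at H3
    simp only [Bool.false_or, List.all_eq_true] at H3
    have H4 := H3 _ (val_NL f)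
    rw [hmem f.val (by simpa using hall f (by simp [qd])),
      hmem (sN f.val d) (by
        rw [sN_cast _ _ hdlt]; simpa using hall (f - d) (by simp [qd])),
      hmem (sN f.val e.val) (by
        rw [sN_cast _ _ hel]; simpa using hall (f - e) (by simp [qd])),
      nd_cast d _ _ hdlt hel hfl (by simpa using hN)] at H4
    exact absurd H4 (by decide)

lemma Red.quad {H : AddSubgroup (ZMod 27)} {C : Set (Finset (ZMod 27))} (R : Red H C)
    (h9 : 9 ∈ H) (h18 : 18 ∈ H) {d : ZMod 27} (hd : d ∉ H) : ∃ B ∈ C, ∃ e f,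
      (9 :: 18 :: qd d e f).Nodup ∧ ∀ z, z ∈ Dl B ↔ z ∈ qd d e f := by
  obtain ⟨B, hB, hdB, h0B⟩ := R.ex d 0 (by simpa using hd)
  have hd0 : d ≠ 0 := by rintro rfl; exact hd H.zero_mem
  have hsub : ({0, d} : Finset (ZMod 27)) ⊆ B := by
    intro x hx
    simp only [Finset.mem_insert, Finset.mem_singleton] at hx
    rcases hx with rfl | rfl <;> assumption
  have h2 : (B \ {0, d}).card = 2 := by
    rw [Finset.card_sdiff_of_subset hsub, R.card B hB, Finset.card_pair hd0.symm]
  obtain ⟨e, f, -, hef⟩ := Finset.card_eq_two.1 h2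
  have hBm : ∀ x ∈ B, x = 0 ∨ x = d ∨ x = e ∨ x = f := by
    intro x hx
    by_cases h : x ∈ ({0, d} : Finset (ZMod 27))
    · simp only [Finset.mem_insert, Finset.mem_singleton] at h; tauto
    · have : x ∈ B \ {0, d} := Finset.mem_sdiff.2 ⟨hx, h⟩
      rw [hef] at this
      simp only [Finset.mem_insert, Finset.mem_singleton] at this; tauto
  have h12 := R.cardDl hB (R.odd (by norm_num) hB)
  have hs : Dl B ⊆ (qd d e f).toFinset := by
    intro z hz
    obtain ⟨x, hx, y, hy, hxy, rfl⟩ := (mem_Dl _ _).1 hz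
    rw [List.mem_toFinset]
    rcases hBm x hx with rfl | rfl | rfl | rfl <;> rcases hBm y hy with rfl | rfl | rfl | rfl <;>
      first
      | exact absurd rfl hxy
      | simp [qd]
  have hle : (qd d e f).toFinset.card ≤ 12 := (List.toFinset_card_le _)
  have heq := Finset.eq_of_subset_of_card_le hs (by rw [h12]; exact hle)
  have hm : ∀ z, z ∈ Dl B ↔ z ∈ qd d e f := by
    intro z; rw [heq, List.mem_toFinset]
  have hnd : (qd d e f).Nodup := by
    rw [heq] at h12
    exact (Multiset.toFinset_card_eq_card_iff_nodup (m := (qd d e f : Multiset (ZMod 27)))).1 h12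
  refine ⟨B, hB, e, f, ?_, hm⟩
  rw [List.nodup_cons, List.nodup_cons]
  refine ⟨?_, ?_, hnd⟩
  · rw [List.mem_cons, not_or]
    refine ⟨by decide, ?_⟩
    rw [← hm]; intro h; exact R.DlH hB h h9
  · rw [← hm]; intro h; exact R.DlH hB h h18

lemma Red.not27 {H : AddSubgroup (ZMod 27)} {C : Set (Finset (ZMod 27))} (R : Red H C) :
    False := by
  classical
  have hs : Finset.univ.filter (· ∈ H) ⊆ ({0, 9, 18} : Finset (ZMod 27)) := by
    intro x hx
    have h3 := R.three (Finset.mem_filter.1 hx).2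
    revert h3
    clear hx
    revert x
    decide
  have heq := Finset.eq_of_subset_of_card_le hs (by rw [R.cardF]; decide)
  have hH : ∀ x, x ∈ H ↔ x ∈ ({0, 9, 18} : Finset (ZMod 27)) := by
    intro x; rw [← heq]; simp
  have h9 : (9 : ZMod 27) ∈ H := by rw [hH]; decide
  have h18 : (18 : ZMod 27) ∈ H := by rw [hH]; decide
  have h1 : (1 : ZMod 27) ∉ H := by rw [hH]; decide
  obtain ⟨B, hB, b, c, hnd, hm⟩ := R.quad h9 h18 h1
  obtain ⟨d, hd, hall⟩ := comp27 b c hnd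
  simp only [List.mem_cons, not_or] at hd
  have hdH : d ∉ H := by
    rw [hH]; simp only [Finset.mem_insert, Finset.mem_singleton]; tauto
  have hdq : d ∉ qd 1 b c := by
    tauto
  obtain ⟨B', hB', e, f, hnd', hm'⟩ := R.quad h9 h18 hdH
  have hdis : ∀ z ∈ qd d e f, z ∉ qd 1 b c := by
    intro z hz hz'
    rw [← hm'] at hz
    rw [← hm] at hz'
    obtain ⟨x, hx, y, hy, hxy, e1⟩ := (mem_Dl _ _).1 hz
    obtain ⟨x', hx', y', hy', -, e2⟩ := (mem_Dl _ _).1 hz'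
    have := R.share hB' hB hx hy hx' hy' hxy (e1.trans e2.symm)
    apply hdq
    rw [← hm, ← this, Dl_tr, hm']
    simp [qd]
  refine hall e ?_ f hnd' hdis
  intro z hz
  apply hdis
  simp only [List.mem_cons, List.not_mem_nil, or_false] at hz
  rcases hz with rfl | rfl <;> simp [qd]

lemma Red.nec {n : ℕ} [NeZero n] {H : AddSubgroup (ZMod n)} {C : Set (Finset (ZMod n))}
    (R : Red H C) : n % 12 = 3 := by
  classical
  have hodd : n % 2 = 1 := by
    by_contra h
    exact R.not_even (by omega)
  let S : Finset (ZMod n) := Finset.univ \ Finset.univ.filter (· ∈ H)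
  have hmS : ∀ d, d ∈ S ↔ d ∉ H := by
    intro d; simp [S]
  have hle := Finset.card_le_univ (Finset.univ.filter (· ∈ H))
  rw [R.cardF, ZMod.card] at hle
  have hc : S.card = n - 3 := by
    rw [Finset.card_sdiff_of_subset (Finset.subset_univ _), Finset.card_univ, ZMod.card, R.cardF]
  have h12 : 12 ∣ S.card := by
    refine R.dvd S (fun d hd => (hmS d).1 hd) ?_
    intro d hd D hD h0D hdD
    exact ⟨R.odd hodd hD, fun d' hd' => (hmS d').2 (R.DlH hD hd')⟩
  omega

end OneRot

/-- A 1-rotational `S(2,4,v)` exists iff `v ≡ 4 (mod 12)` and `v ≠ 28`. -/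
theorem stmt_16 (v : ℕ) (hv : 2 ≤ v) :
    (∃ 𝓑 : Set (Finset (Option (ZMod (v - 1)))), IsOneRotationalS24 v 𝓑) ↔
      (v % 12 = 4 ∧ v ≠ 28) := by
  constructor
  · rintro ⟨𝓑, h1, h2, h3⟩
    have : NeZero (v - 1) := ⟨by omega⟩
    obtain ⟨H, C, R⟩ := OneRot.reduce 𝓑 h1 h2 h3
    have hm := R.nec
    refine ⟨by omega, ?_⟩
    rintro rfl
    exact OneRot.Red.not27 R
  · rintro ⟨h4, h28⟩
    obtain ⟨t, rfl⟩ : ∃ t, v = 12 * t + 4 := ⟨v / 12, by omega⟩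
    exact OneRot.good_all t (by omega)
end
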